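/- arXiv:2603.07033 — 4 statements merged into one kernel-verified Lean document; each statement's English description precedes it below -/
import Mathlib

section
/- For every n ≥ 2 and every polynomial f (an element of the free associative ℂ-algebra ℂ⟨X₁,X₂,…⟩), every element of the ℂ-linear span of f(M_n(ℂ)) is a linear combination of at most 5 elements from f(M_n(ℂ)). That is, the Waring constant of M_n(ℂ) satisfies W_{M_n(ℂ)} ≤ 5. -/
namespace WaringAux

open Polynomial

/-- Similarity of square matrices. -/
def Sim {n : ℕ} (A B : Matrix (Fin n) (Fin n) ℂ) : Prop :=
  ∃ P Q : Matrix (Fin n) (Fin n) ℂ, P * Q = 1 ∧ Q * P = 1 ∧ B = P * A * Q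

lemma Sim.symm {n : ℕ} {A B : Matrix (Fin n) (Fin n) ℂ} (h : Sim A B) : Sim B A := by
  obtain ⟨P, Q, h1, h2, rfl⟩ := h
  refine ⟨Q, P, h2, h1, ?_⟩
  calc A = (Q * P) * A * (Q * P) := by rw [h2]; simp
    _ = _ := by simp only [mul_assoc]

lemma Sim.trans {n : ℕ} {A B C : Matrix (Fin n) (Fin n) ℂ} (h : Sim A B) (h' : Sim B C) :
    Sim A C := by
  obtain ⟨P, Q, h1, h2, rfl⟩ := h
  obtain ⟨P', Q', h1', h2', rfl⟩ := h'
  refine ⟨P' * P, Q * Q', ?_, ?_, by simp only [mul_assoc]⟩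
  · calc P' * P * (Q * Q') = P' * (P * Q) * Q' := by simp only [mul_assoc]
      _ = 1 := by rw [h1]; simpa
  · calc Q * Q' * (P' * P) = Q * (Q' * P') * P := by simp only [mul_assoc]
      _ = 1 := by rw [h2']; simpa

/-- The Hankel determinant of traces of powers (the discriminant). -/
noncomputable def hank {n : ℕ} (M : Matrix (Fin n) (Fin n) ℂ) : ℂ :=
  (Matrix.of fun i j : Fin n => (M ^ ((i : ℕ) + (j : ℕ))).trace).det

lemma continuous_hank {n : ℕ} : Continuous (hank (n := n)) := by
  unfold hank
  refine Continuous.matrix_det ?_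
  refine continuous_matrix fun i j => ?_
  simp only [Matrix.of_apply]
  exact (continuous_id.pow _).matrix_trace

lemma hank_smul {n : ℕ} (c : ℂ) (M : Matrix (Fin n) (Fin n) ℂ) :
    hank (c • M) = (∏ i : Fin n, c ^ (i : ℕ)) * ((∏ i : Fin n, c ^ (i : ℕ)) * hank M) := by
  unfold hank
  rw [← Matrix.det_mul_row, ← Matrix.det_mul_column]
  congr 1
  ext i j
  simp [_root_.smul_pow, pow_add]
  ring

lemma hank_smul_ne {n : ℕ} {c : ℂ} (hc : c ≠ 0) (M : Matrix (Fin n) (Fin n) ℂ) :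
    hank (c • M) ≠ 0 ↔ hank M ≠ 0 := by
  have : (∏ i : Fin n, c ^ (i : ℕ)) ≠ 0 := Finset.prod_ne_zero_iff.2 fun i _ => pow_ne_zero _ hc
  rw [hank_smul]
  simp [this]

lemma separable_of_hank {n : ℕ} {M : Matrix (Fin n) (Fin n) ℂ} (h : hank M ≠ 0) :
    M.charpoly.roots.Nodup := by
  classical
  by_contra hnd
  rw [Multiset.nodup_iff_count_le_one] at hnd
  push Not at hnd
  obtain ⟨l, hl⟩ := hnd
  rw [count_roots] at hl
  have hne : M.charpoly ≠ 0 := M.charpoly_monic.ne_zero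
  have hd : (X - C l) ^ 2 ∣ M.charpoly := (le_rootMultiplicity_iff hne).1 hl
  obtain ⟨q, hq⟩ := hd
  set r : ℂ[X] := (X - C l) * q with hr
  have hcr : M.charpoly = (X - C l) * r := by rw [hq, hr]; ring
  have hr0 : r ≠ 0 := by rintro h0; rw [h0, mul_zero] at hcr; exact hne hcr
  have hdeg : r.natDegree + 1 = n := by
    have := congrArg natDegree hcr
    rw [Matrix.charpoly_natDegree_eq_dim, natDegree_mul (X_sub_C_ne_zero l) hr0,
      natDegree_X_sub_C, Fintype.card_fin] at this
    omega
  have hnil : ∀ p : ℂ[X], (aeval M (p * r)).trace = 0 := by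
    intro p
    have h2 : (aeval M (p * r)) ^ 2 = 0 := by
      rw [← map_pow]
      have : (p * r) ^ 2 = (p ^ 2 * q) * M.charpoly := by rw [hq, hr]; ring
      rw [this, map_mul, Matrix.aeval_self_charpoly, mul_zero]
    have h3 : IsNilpotent (aeval M (p * r)) := ⟨2, h2⟩
    exact (Matrix.isNilpotent_trace_of_isNilpotent h3).eq_zero
  apply h
  unfold hank
  apply Matrix.exists_mulVec_eq_zero_iff.1
  refine ⟨fun j => r.coeff j, ?_, ?_⟩
  · intro h0
    have := congrFun h0 ⟨r.natDegree, by omega⟩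
    simp at this
    exact hr0 this
  · ext i
    have := hnil (X ^ (i : ℕ))
    rw [map_mul, aeval_eq_sum_range' (n := n) (by omega : r.natDegree < n), Finset.sum_range,
      Finset.mul_sum, Matrix.trace_sum] at this
    simp only [Matrix.mulVec, dotProduct, Matrix.of_apply, Pi.zero_apply]
    rw [← this]
    refine Finset.sum_congr rfl fun j _ => ?_
    simp [pow_add, mul_comm]

/-- A matrix with characteristic polynomial having distinct roots is diagonalisable. -/
lemma sim_diagonal {n : ℕ} {M : Matrix (Fin n) (Fin n) ℂ} {l : Fin n → ℂ}
    (hl : Function.Injective l) (h : M.charpoly = ∏ i, (X - C (l i))) :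
    Sim (Matrix.diagonal l) M := by
  have hev : ∀ i, ∃ v, Module.End.HasEigenvector (Matrix.toLin' M) (l i) v := by
    intro i
    apply Module.End.HasEigenvalue.exists_hasEigenvector
    rw [Module.End.hasEigenvalue_iff_isRoot_charpoly]
    rw [Matrix.charpoly_toLin', h, IsRoot, eval_prod]
    exact Finset.prod_eq_zero (Finset.mem_univ i) (by simp)
  choose v hv using hev
  have hli := Module.End.eigenvectors_linearIndependent' (Matrix.toLin' M) l hl v hv
  let P : Matrix (Fin n) (Fin n) ℂ := Matrix.of fun i j => v j i
  have hP : IsUnit P := by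
    apply Matrix.linearIndependent_cols_iff_isUnit.1
    exact hli
  have hdet := (Matrix.isUnit_iff_isUnit_det P).1 hP
  have hMP : M * P = P * Matrix.diagonal l := by
    ext i j
    have := congrFun (hv j).apply_eq_smul i
    rw [Matrix.mul_diagonal]
    simpa [Matrix.mul_apply, Matrix.mulVec, dotProduct, P, mul_comm] using this
  refine ⟨P, P⁻¹, Matrix.mul_nonsing_inv _ hdet, Matrix.nonsing_inv_mul _ hdet, ?_⟩
  rw [← hMP, mul_assoc, Matrix.mul_nonsing_inv _ hdet, mul_one]

lemma exists_diag_of_hank {n : ℕ} {M : Matrix (Fin n) (Fin n) ℂ} (h : hank M ≠ 0) :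
    ∃ l : Fin n → ℂ, Function.Injective l ∧ Sim (Matrix.diagonal l) M := by
  have hnd := separable_of_hank h
  have hsp := IsAlgClosed.splits M.charpoly
  have hcard : Multiset.card M.charpoly.roots = n := by
    rw [← hsp.natDegree_eq_card_roots, Matrix.charpoly_natDegree_eq_dim, Fintype.card_fin]
  have hpr := hsp.eq_prod_roots_of_monic M.charpoly_monic
  revert hnd hcard hpr
  generalize M.charpoly.roots = s
  induction s using Quotient.inductionOn with
  | h L =>
    intro hnd hcard hpr
    have hL : L.length = n := hcard
    subst hL
    refine ⟨L.get, List.nodup_iff_injective_get.1 hnd, ?_⟩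
    apply sim_diagonal (List.nodup_iff_injective_get.1 hnd)
    rw [hpr]
    simp only [Multiset.quot_mk_to_coe, Multiset.map_coe,
      Multiset.prod_coe, ← List.prod_ofFn]
    congr 1
    conv_lhs => rw [← List.ofFn_get L]
    rw [List.map_ofFn]
    rfl

lemma sim_of_upper {n : ℕ} {l : Fin n → ℂ} (hl : Function.Injective l)
    {M : Matrix (Fin n) (Fin n) ℂ} (hd : ∀ i, M i i = l i) (hu : ∀ i j, j < i → M i j = 0) :
    Sim (Matrix.diagonal l) M := by
  apply sim_diagonal hl
  rw [Matrix.charpoly_of_isUpperTriangular]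
  · simp [hd]
  · intro i j hij; exact hu i j hij

lemma sim_of_lower {n : ℕ} {l : Fin n → ℂ} (hl : Function.Injective l)
    {M : Matrix (Fin n) (Fin n) ℂ} (hd : ∀ i, M i i = l i) (hu : ∀ i j, i < j → M i j = 0) :
    Sim (Matrix.diagonal l) M := by
  apply sim_diagonal hl
  rw [← Matrix.charpoly_transpose, Matrix.charpoly_of_isUpperTriangular]
  · simp [hd]
  · intro i j hij; exact hu j i hij

lemma exists_zero_diag_basis (n : ℕ) : ∀ (V : Type) [AddCommGroup V] [Module ℂ V]
    [FiniteDimensional ℂ V] (_ : Module.finrank ℂ V = n) (T : V →ₗ[ℂ] V)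
    (_ : LinearMap.trace ℂ V T = 0),
    ∃ b : Module.Basis (Fin n) ℂ V, ∀ i, b.repr (T (b i)) i = 0 := by
  induction n with
  | zero => 
    intro V _ _ _ h T _
    exact ⟨Module.finBasisOfFinrankEq ℂ V h, fun i => i.elim0⟩
  | succ n ih =>
    intro V _ _ _ h T hT
    by_cases hs : ∀ v : V, ¬ LinearIndependent ℂ ![v, T v]
    · obtain ⟨a, ha⟩ := LinearMap.exists_eq_smul_id_of_forall_notLinearIndependent hs
      rw [ha, map_smul, LinearMap.trace_one, h, smul_eq_mul, mul_eq_zero] at hT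
      have ha0 : a = 0 := hT.resolve_right (by exact_mod_cast Nat.succ_ne_zero n)
      refine ⟨Module.finBasisOfFinrankEq ℂ V h, fun i => ?_⟩
      simp [ha, ha0]
    · push Not at hs
      obtain ⟨v, hv⟩ := hs
      obtain ⟨φ, hφv, hφT⟩ : ∃ φ : V →ₗ[ℂ] ℂ, φ v = 1 ∧ φ (T v) = 0 := by
        obtain ⟨φ, hφ⟩ := LinearMap.exists_extend
          ((Finsupp.lapply (0 : Fin 2)) ∘ₗ hv.repr)
        have key : ∀ i : Fin 2, φ (![v, T v] i) = (Finsupp.single i 1 : Fin 2 →₀ ℂ) 0 := by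
          intro i
          have hm : ![v, T v] i ∈ Submodule.span ℂ (Set.range ![v, T v]) :=
            Submodule.subset_span ⟨i, rfl⟩
          have h1 := LinearMap.congr_fun hφ ⟨_, hm⟩
          rw [LinearMap.comp_apply, LinearMap.comp_apply,
            hv.repr_eq_single i ⟨_, hm⟩ rfl] at h1
          exact h1
        exact ⟨φ, by simpa using key 0, by simpa using key 1⟩
      let W := LinearMap.ker φ
      let π : V →ₗ[ℂ] W := LinearMap.codRestrict W (LinearMap.id - φ.smulRight v) (by
        intro x; simp [W, hφv])
      have hπ : ∀ x, (π x : V) = x - φ x • v := fun x => rfl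
      have hW : Module.finrank ℂ W = n := by
        have h1 := LinearMap.finrank_range_add_finrank_ker φ
        have h2 : LinearMap.range φ = ⊤ := LinearMap.range_eq_top.2 fun c => ⟨c • v, by simp [hφv]⟩
        rw [h2, finrank_top, Module.finrank_self, h] at h1
        change _ = n
        change 1 + Module.finrank ℂ W = n + 1 at h1
        omega
      have htr : LinearMap.trace ℂ W (π ∘ₗ (T ∘ₗ W.subtype)) = 0 := by
        rw [LinearMap.trace_comp_comm', LinearMap.comp_assoc]
        have : W.subtype ∘ₗ π = LinearMap.id - φ.smulRight v := by ext x; simp [hπ]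
        rw [this, LinearMap.comp_sub, map_sub, LinearMap.comp_id, hT]
        have : T ∘ₗ φ.smulRight v = φ.smulRight (T v) := by ext x; simp
        rw [this, LinearMap.trace_smulRight, hφT, sub_zero]
      obtain ⟨b', hb'⟩ := ih W hW _ htr
      have hφW : ∀ w : W, φ w = 0 := fun w => w.2
      have hπW : ∀ w : W, π w = w := fun w => Subtype.ext (by rw [hπ, hφW]; simp)
      have hπv : π v = 0 := Subtype.ext (by rw [hπ, hφv]; simp)
      let e : V ≃ₗ[ℂ] (Fin (n + 1) → ℂ) :=
        { toFun := fun x => Fin.cons (φ x) (b'.equivFun (π x))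
          map_add' := by
            intro x y; ext i; refine Fin.cases ?_ (fun i => ?_) i <;> simp
          map_smul' := by
            intro c x; ext i; refine Fin.cases ?_ (fun i => ?_) i <;> simp
          invFun := fun c => c 0 • v + (b'.equivFun.symm (Fin.tail c) : W)
          left_inv := by
            intro x
            simp only [Fin.cons_zero, Fin.tail_cons, LinearEquiv.symm_apply_apply, hπ]
            abel
          right_inv := by
            intro c
            simp only [map_add, map_smul, hφv, hφW, hπW, hπv, smul_zero, zero_add, add_zero,
              smul_eq_mul, mul_one, LinearEquiv.apply_symm_apply]
            exact Fin.cons_self_tail c }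
      have he0 : ∀ x, e x 0 = φ x := fun x => rfl
      have hes : ∀ x (i : Fin n), e x i.succ = b'.repr (π x) i := fun x i => rfl
      let b : Module.Basis (Fin (n+1)) ℂ V := Module.Basis.ofEquivFun e
      have heb : ∀ i, e (b i) = Pi.single i 1 := fun i => by simp [b]
      have hb0 : b 0 = v := by
        apply e.injective
        ext i
        refine Fin.cases ?_ (fun i => ?_) i
        · rw [heb, he0, hφv]; simp
        · rw [heb, hes, hπv]; simp
      have hbs : ∀ i : Fin n, b i.succ = b' i := by
        intro i
        apply e.injective
        ext j
        refine Fin.cases ?_ (fun j => ?_) j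
        · rw [heb, he0, hφW]; simp
        · rw [heb, hes, hπW]; simp [Finsupp.single_apply, Pi.single_apply, eq_comm]
      refine ⟨b, fun i => ?_⟩
      refine Fin.cases ?_ (fun i => ?_) i
      · rw [hb0]; exact hφT
      · rw [hbs]; exact hb' i

lemma exists_zero_diag {n : ℕ} (T : Matrix (Fin n) (Fin n) ℂ) (hT : T.trace = 0) :
    ∃ Z, Sim Z T ∧ ∀ i, Z i i = 0 := by
  obtain ⟨b, hb⟩ := exists_zero_diag_basis n (Fin n → ℂ) (by simp) (Matrix.toLin' T) (by
    simpa using hT)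
  refine ⟨LinearMap.toMatrix b b (Matrix.toLin' T),
    ⟨(Pi.basisFun ℂ (Fin n)).toMatrix b, b.toMatrix (Pi.basisFun ℂ (Fin n)), ?_, ?_, ?_⟩, ?_⟩
  · simp
  · simp
  · rw [basis_toMatrix_mul_linearMap_toMatrix_mul_basis_toMatrix]
    exact (LinearMap.toMatrix'_toLin' T).symm
  · intro i
    rw [LinearMap.toMatrix_apply]; exact hb i

/-- Every trace zero matrix is a difference of two conjugates of `W`. -/
lemma trace_zero_eq_sub {n : ℕ} {W : Matrix (Fin n) (Fin n) ℂ} (hW : hank W ≠ 0)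
    (T : Matrix (Fin n) (Fin n) ℂ) (hT : T.trace = 0) :
    ∃ W₁ W₂, Sim W W₁ ∧ Sim W W₂ ∧ T = W₁ - W₂ := by
  obtain ⟨l, hl, hs⟩ := exists_diag_of_hank hW
  obtain ⟨Z, ⟨P, Q, h1, h2, rfl⟩, hZ⟩ := exists_zero_diag T hT
  let U : Matrix (Fin n) (Fin n) ℂ := Matrix.of fun i j =>
    if i < j then Z i j else if i = j then l i else 0
  let L : Matrix (Fin n) (Fin n) ℂ := Matrix.of fun i j =>
    if j < i then - Z i j else if i = j then l i else 0
  have hU : Sim W U := hs.symm.trans (sim_of_upper hl (by simp [U])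
    (by intro i j h; simp [U, h.not_gt, h.ne']))
  have hL : Sim W L := hs.symm.trans (sim_of_lower hl (by simp [L])
    (by intro i j h; simp [L, h.not_gt, h.ne]))
  refine ⟨P * U * Q, P * L * Q, hU.trans ⟨P, Q, h1, h2, rfl⟩, hL.trans ⟨P, Q, h1, h2, rfl⟩, ?_⟩
  rw [← sub_mul, ← mul_sub]
  congr 2
  ext i j
  rcases lt_trichotomy i j with h | h | h
  · simp [U, L, h, h.not_gt, h.ne]
  · subst h; simp [U, L, hZ]
  · simp [U, L, h, h.not_gt, h.ne']

/-- Clock matrix. -/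
noncomputable def clockM (n : ℕ) (w : ℂ) : Matrix (Fin n) (Fin n) ℂ :=
  Matrix.diagonal fun i => w ^ (i : ℕ)

/-- Shift matrix. -/
noncomputable def shiftM (n : ℕ) [NeZero n] : Matrix (Fin n) (Fin n) ℂ :=
  Matrix.of fun i j => if j = i + 1 then 1 else 0

lemma shift_mul_clock {n : ℕ} [NeZero n] {w : ℂ} (hw : w ^ n = 1) :
    shiftM n * clockM n w = w • (clockM n w * shiftM n) := by
  ext i j
  simp only [clockM, Matrix.mul_diagonal, Matrix.smul_apply, Matrix.diagonal_mul, shiftM,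
    Matrix.of_apply, smul_eq_mul]
  split_ifs with h
  · subst h
    rw [Fin.val_add, ← pow_eq_pow_mod _ hw, pow_add, Fin.val_one', ← pow_eq_pow_mod _ hw]
    ring
  · simp

lemma nsmul_one_val {n : ℕ} [NeZero n] (k : ℕ) : ((k • (1 : Fin n) : Fin n) : ℕ) = k % n := by
  induction k with
  | zero => simp
  | succ k ih => rw [succ_nsmul, Fin.val_add, ih, Fin.val_one', ← Nat.add_mod]

lemma shift_pow {n : ℕ} [NeZero n] (k : ℕ) (i j : Fin n) :
    (shiftM n ^ k) i j = if j = i + k • 1 then 1 else 0 := by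
  induction k generalizing j with
  | zero => simp [Matrix.one_apply, eq_comm]
  | succ k ih =>
    rw [pow_succ, Matrix.mul_apply]
    simp only [ih, succ_nsmul, ← add_assoc]
    simp only [ite_mul, one_mul, zero_mul, Finset.sum_ite_eq', Finset.sum_ite_eq,
      Finset.mem_univ, if_true, shiftM, Matrix.of_apply]

lemma shift_pow_n {n : ℕ} [NeZero n] : shiftM n ^ n = 1 := by
  ext i j
  have : (n • (1 : Fin n)) = 0 := Fin.ext (by rw [nsmul_one_val]; simp)
  rw [shift_pow, this, Matrix.one_apply, add_zero]
  simp [eq_comm]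

lemma clock_pow_n {n : ℕ} {w : ℂ} (hw : w ^ n = 1) : clockM n w ^ n = 1 := by
  rw [clockM, Matrix.diagonal_pow, ← Matrix.diagonal_one]
  congr 1
  ext i
  rw [Pi.pow_apply, ← pow_mul, mul_comm, pow_mul, hw, one_pow]

lemma adjoin_clock_shift {n : ℕ} [NeZero n] {w : ℂ} (hw : IsPrimitiveRoot w n) :
    Algebra.adjoin ℂ {clockM n w, shiftM n} = ⊤ := by
  rw [eq_top_iff]
  set S := Algebra.adjoin ℂ {clockM n w, shiftM n} with hS
  have hX : clockM n w ∈ S := Algebra.subset_adjoin (by simp)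
  have hY : shiftM n ∈ S := Algebra.subset_adjoin (by simp)
  have hdiag : ∀ d : Fin n → ℂ, Matrix.diagonal d ∈ S := by
    intro d
    have hinj : Set.InjOn (fun i : Fin n => w ^ (i : ℕ)) (Finset.univ : Finset (Fin n)) := by
      intro i _ j _ hij
      exact Fin.ext (hw.pow_inj i.2 j.2 hij)
    let p := Lagrange.interpolate Finset.univ (fun i : Fin n => w ^ (i : ℕ)) d
    have hp : aeval (clockM n w) p = Matrix.diagonal d := by
      have h1 : clockM n w = Matrix.diagonalAlgHom ℂ (fun i : Fin n => w ^ (i : ℕ)) := rfl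
      rw [h1, aeval_algHom_apply]
      change Matrix.diagonal _ = _
      congr 1
      ext i
      have h2 := aeval_algHom_apply (Pi.evalAlgHom ℂ (fun _ : Fin n => ℂ) i)
        (fun i : Fin n => w ^ (i : ℕ)) p
      change _ = (aeval (fun i : Fin n => w ^ (i : ℕ)) p) i at h2
      rw [← h2]
      exact Lagrange.eval_interpolate_at_node d hinj (Finset.mem_univ i)
    rw [← hp]
    exact Algebra.adjoin_mono (by simp) (aeval_mem_adjoin_singleton ℂ (clockM n w))
  intro M _
  rw [Matrix.matrix_eq_sum_single M]
  refine sum_mem fun i _ => sum_mem fun j _ => ?_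
  have : Matrix.single i j (M i j) =
      Matrix.diagonal (Pi.single i (M i j)) * shiftM n ^ ((j - i : Fin n) : ℕ) := by
    have hk : (((j - i : Fin n) : ℕ) • (1 : Fin n)) = j - i :=
      Fin.ext (by rw [nsmul_one_val, Nat.mod_eq_of_lt (Fin.is_lt _)])
    ext i' j'
    rw [Matrix.diagonal_mul, shift_pow, hk, Matrix.single_apply, Pi.single_apply]
    by_cases h : i' = i
    · subst h
      simp [eq_comm]
    · simp [h, Ne.symm h]
  rw [this]
  exact mul_mem (hdiag _) (pow_mem hY _)

lemma qcomm {A : Type*} [Ring A] [Algebra ℂ A] {x y : A} {w : ℂ} (h : y * x = w • (x * y))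
    (q p : ℕ) : y ^ q * x ^ p = w ^ (q * p) • (x ^ p * y ^ q) := by
  have h1 : ∀ q, y ^ q * x = w ^ q • (x * y ^ q) := by
    intro q
    induction q with
    | zero => simp
    | succ q ih =>
      rw [pow_succ, mul_assoc, h, mul_smul_comm, ← mul_assoc, ih, smul_mul_assoc, smul_smul,
        mul_assoc, pow_succ, mul_comm]
  induction p with
  | zero => simp
  | succ p ih =>
    rw [pow_succ, ← mul_assoc, ih, smul_mul_assoc, mul_assoc, h1, mul_smul_comm, smul_smul,
      mul_assoc, mul_add, pow_add, mul_one]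

lemma adjoin_le_span {A : Type*} [Ring A] [Algebra ℂ A] {x y : A} {w : ℂ}
    (h : y * x = w • (x * y)) {z : A} (hz : z ∈ Algebra.adjoin ℂ {x, y}) :
    z ∈ Submodule.span ℂ (Set.range fun pq : ℕ × ℕ => x ^ pq.1 * y ^ pq.2) := by
  induction hz using Algebra.adjoin_induction with
  | mem z hz =>
    rcases hz with rfl | rfl
    · exact Submodule.subset_span ⟨(1, 0), by simp⟩
    · exact Submodule.subset_span ⟨(0, 1), by simp⟩
  | algebraMap c =>
    rw [Algebra.algebraMap_eq_smul_one]
    exact Submodule.smul_mem _ _ (Submodule.subset_span ⟨(0, 0), by simp⟩)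
  | add a b _ _ ha hb => exact add_mem ha hb
  | mul a b _ _ ha hb =>
    have := Submodule.mul_mem_mul ha hb
    rw [Submodule.span_mul_span] at this
    refine Submodule.span_le.2 ?_ this
    rintro _ ⟨_, ⟨⟨p, q⟩, rfl⟩, _, ⟨⟨p', q'⟩, rfl⟩, rfl⟩
    have : (x ^ p * y ^ q) * (x ^ p' * y ^ q') =
        w ^ (q * p') • (x ^ (p + p') * y ^ (q + q')) := by
      calc (x ^ p * y ^ q) * (x ^ p' * y ^ q') = x ^ p * (y ^ q * x ^ p') * y ^ q' := by
            simp only [mul_assoc]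
        _ = _ := by
          rw [qcomm h, mul_smul_comm, smul_mul_assoc, pow_add, pow_add]
          simp only [mul_assoc]
    simp only [this]
    exact Submodule.smul_mem _ _ (Submodule.subset_span ⟨(p + p', q + q'), rfl⟩)

lemma hank_clock {n : ℕ} {w : ℂ} (hw : IsPrimitiveRoot w n) : hank (clockM n w) ≠ 0 := by
  have hinj : Function.Injective (fun i : Fin n => w ^ (i : ℕ)) := by
    intro i j hij
    exact Fin.ext (hw.pow_inj i.2 j.2 hij)
  have : hank (clockM n w) = ((Matrix.vandermonde fun i : Fin n => w ^ (i : ℕ)).transpose *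
      Matrix.vandermonde fun i : Fin n => w ^ (i : ℕ)).det := by
    unfold hank
    congr 1
    ext i j
    simp [clockM, Matrix.diagonal_pow, Matrix.trace_diagonal, Matrix.mul_apply,
      Matrix.vandermonde_apply, pow_add]
  rw [this, Matrix.det_mul, Matrix.det_transpose]
  exact mul_self_ne_zero.2 (Matrix.det_vandermonde_ne_zero_iff.2 hinj)

lemma trace_shift_pow {n : ℕ} [NeZero n] {w : ℂ} (hw : IsPrimitiveRoot w n) (k : ℕ) :
    (shiftM n ^ k).trace = (clockM n w ^ k).trace := by
  have hw0 : w ≠ 0 := hw.ne_zero (NeZero.ne n)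
  have hq := shift_mul_clock hw.pow_eq_one
  have hXu : IsUnit (clockM n w).det :=
    (Matrix.isUnit_iff_isUnit_det _).1 (IsUnit.of_pow_eq_one (clock_pow_n hw.pow_eq_one) (NeZero.ne n))
  have hYu : IsUnit (shiftM n).det :=
    (Matrix.isUnit_iff_isUnit_det _).1 (IsUnit.of_pow_eq_one shift_pow_n (NeZero.ne n))
  by_cases hk : w ^ k = 1
  · obtain ⟨m, rfl⟩ := (hw.pow_eq_one_iff_dvd k).1 hk
    rw [pow_mul, pow_mul, shift_pow_n, clock_pow_n hw.pow_eq_one]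
  · have h1 : (shiftM n ^ k).trace = w ^ k * (shiftM n ^ k).trace := by
      have := qcomm hq k 1
      rw [pow_one, mul_one] at this
      calc (shiftM n ^ k).trace = (shiftM n ^ k * clockM n w * (clockM n w)⁻¹).trace := by
            rw [mul_assoc, Matrix.mul_nonsing_inv _ hXu, mul_one]
        _ = w ^ k * ((clockM n w)⁻¹ * (clockM n w * shiftM n ^ k)).trace := by
            rw [this, smul_mul_assoc, Matrix.trace_smul, Matrix.trace_mul_comm, smul_eq_mul]
        _ = _ := by rw [← mul_assoc, Matrix.nonsing_inv_mul _ hXu, one_mul]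
    have h2 : (clockM n w ^ k).trace = w ^ k * (clockM n w ^ k).trace := by
      have := qcomm hq 1 k
      rw [pow_one, one_mul] at this
      calc (clockM n w ^ k).trace = ((shiftM n)⁻¹ * (shiftM n * clockM n w ^ k)).trace := by
            rw [← mul_assoc, Matrix.nonsing_inv_mul _ hYu, one_mul]
        _ = w ^ k * ((clockM n w ^ k * shiftM n) * (shiftM n)⁻¹).trace := by
            rw [this, mul_smul_comm, Matrix.trace_smul, Matrix.trace_mul_comm, smul_eq_mul]
        _ = _ := by rw [mul_assoc, Matrix.mul_nonsing_inv _ hYu, mul_one]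
    have h3 : ∀ t : ℂ, t = w ^ k * t → t = 0 := by
      intro t ht
      have : (1 - w ^ k) * t = 0 := by linear_combination ht
      exact (mul_eq_zero.1 this).resolve_left (sub_ne_zero.2 (Ne.symm hk))
    rw [h3 _ h1, h3 _ h2]

lemma hank_shift {n : ℕ} [NeZero n] {w : ℂ} (hw : IsPrimitiveRoot w n) : hank (shiftM n) ≠ 0 := by
  have : hank (shiftM n) = hank (clockM n w) := by
    unfold hank
    congr 1
    ext i j
    simp only [Matrix.of_apply, trace_shift_pow hw]
  rw [this]
  exact hank_clock hw

/-- For a noncentral monomial some commutator has distinct eigenvalues. -/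
lemma exists_comm {n : ℕ} [NeZero n] {w : ℂ} (hw : IsPrimitiveRoot w n) (p q : ℕ)
    (h : w ^ p ≠ 1 ∨ w ^ q ≠ 1) : ∃ G : Matrix (Fin n) (Fin n) ℂ,
      hank (G * (clockM n w ^ p * shiftM n ^ q) - (clockM n w ^ p * shiftM n ^ q) * G) ≠ 0 := by
  have hw0 : w ≠ 0 := hw.ne_zero (NeZero.ne n)
  have hq := shift_mul_clock hw.pow_eq_one
  have hXu : IsUnit (clockM n w) :=
    IsUnit.of_pow_eq_one (clock_pow_n hw.pow_eq_one) (NeZero.ne n)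
  have hYu : IsUnit (shiftM n) := IsUnit.of_pow_eq_one shift_pow_n (NeZero.ne n)
  have hH := hank_clock hw
  have hH' := hank_shift hw
  set X := clockM n w
  set Y := shiftM n
  set U := X ^ p * Y ^ q with hU
  have hUu : IsUnit U.det := (Matrix.isUnit_iff_isUnit_det _).1 ((hXu.pow p).mul (hYu.pow q))
  have hUX : U * X = w ^ q • (X * U) := by
    have := qcomm hq q 1
    rw [pow_one, mul_one] at this
    rw [hU, mul_assoc, this, mul_smul_comm, ← mul_assoc, ← mul_assoc, ← pow_succ, ← pow_succ']
  have hYU : Y * U = w ^ p • (U * Y) := by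
    have := qcomm hq 1 p
    rw [pow_one, one_mul] at this
    rw [hU, ← mul_assoc, this, smul_mul_assoc, mul_assoc, mul_assoc, ← pow_succ, ← pow_succ']
  by_cases hwq : w ^ q = 1
  · have hwp : w ^ p ≠ 1 := h.resolve_right (not_not.2 hwq)
    refine ⟨Y * U⁻¹, ?_⟩
    have hUY : U * Y = (w ^ p)⁻¹ • (Y * U) := by
      rw [hYU, smul_smul, inv_mul_cancel₀ (pow_ne_zero _ hw0), one_smul]
    have : Y * U⁻¹ * U - U * (Y * U⁻¹) = (1 - (w ^ p)⁻¹) • Y := by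
      rw [mul_assoc, Matrix.nonsing_inv_mul _ hUu, ← mul_assoc, hUY, smul_mul_assoc, mul_assoc,
        Matrix.mul_nonsing_inv _ hUu, sub_smul, one_smul, mul_one]
    rw [this, hank_smul_ne]
    · exact hH'
    · rw [sub_ne_zero]; intro h; exact hwp (inv_eq_one.1 h.symm)
  · refine ⟨X * U⁻¹, ?_⟩
    have : X * U⁻¹ * U - U * (X * U⁻¹) = (1 - w ^ q) • X := by
      rw [mul_assoc, Matrix.nonsing_inv_mul _ hUu, ← mul_assoc, hUX, smul_mul_assoc, mul_assoc,
        Matrix.mul_nonsing_inv _ hUu, sub_smul, one_smul, mul_one]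
    rw [this, hank_smul_ne]
    · exact hH
    · rw [sub_ne_zero]; exact Ne.symm hwq

/-- Monomials with trivial character are central. -/
lemma central_monomial {n : ℕ} [NeZero n] {w : ℂ} (hw : IsPrimitiveRoot w n) (p q : ℕ)
    (hp : w ^ p = 1) (hq : w ^ q = 1) (G : Matrix (Fin n) (Fin n) ℂ) :
    G * (clockM n w ^ p * shiftM n ^ q) = (clockM n w ^ p * shiftM n ^ q) * G := by
  obtain ⟨a, rfl⟩ := (hw.pow_eq_one_iff_dvd p).1 hp
  obtain ⟨b, rfl⟩ := (hw.pow_eq_one_iff_dvd q).1 hq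
  rw [pow_mul, pow_mul, shift_pow_n, clock_pow_n hw.pow_eq_one]
  simp

lemma lead {n : ℕ} {ι : Type*} (T : Finset ι) (e : ι → ℕ) (M : ι → Matrix (Fin n) (Fin n) ℂ)
    (i₀ : ι) (hi₀ : i₀ ∈ T) (hlt : ∀ i ∈ T, i ≠ i₀ → e i < e i₀) (h : hank (M i₀) ≠ 0) :
    ∃ r : ℂ, hank (∑ i ∈ T, r ^ e i • M i) ≠ 0 := by
  classical
  let g : ℂ → Matrix (Fin n) (Fin n) ℂ := fun u => ∑ i ∈ T, u ^ (e i₀ - e i) • M i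
  have hg : Continuous g := by
    refine continuous_finsetSum _ fun i _ => ?_
    exact (continuous_id.pow _).smul continuous_const
  have hg0 : g 0 = M i₀ := by
    simp only [g]
    rw [Finset.sum_eq_single i₀]
    · simp
    · intro i hi hne
      have := hlt i hi hne
      rw [zero_pow (by omega), zero_smul]
    · intro h; exact absurd hi₀ h
  have hev : ∀ᶠ u in nhds (0 : ℂ), hank (g u) ≠ 0 :=
    ((continuous_hank.comp hg).continuousAt (x := 0)).eventually_ne (by
      simpa [Function.comp, hg0] using h)
  have hev' : ∀ᶠ u in nhdsWithin (0 : ℂ) {0}ᶜ, hank (g u) ≠ 0 ∧ u ≠ 0 :=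
    (hev.filter_mono nhdsWithin_le_nhds).and self_mem_nhdsWithin
  obtain ⟨u, hu, hu0⟩ := hev'.exists
  refine ⟨u⁻¹, ?_⟩
  have : ∑ i ∈ T, u⁻¹ ^ e i • M i = (u⁻¹ ^ e i₀) • g u := by
    simp only [g, Finset.smul_sum, smul_smul]
    refine Finset.sum_congr rfl fun i hi => ?_
    congr 1
    have hle : e i ≤ e i₀ := by
      by_cases hii : i = i₀
      · rw [hii]
      · exact (hlt i hi hii).le
    obtain ⟨d, hd⟩ := Nat.exists_eq_add_of_le hle
    rw [hd, Nat.add_sub_cancel_left, pow_add, mul_assoc, ← mul_pow, inv_mul_cancel₀ hu0, one_pow,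
      mul_one]
  rw [this, hank_smul_ne (pow_ne_zero _ (inv_ne_zero hu0))]
  exact hu

lemma lift_mem {A : Type*} [Ring A] [Algebra ℂ A] (S : Subalgebra ℂ A) (a : ℕ → A)
    (ha : ∀ i, a i ∈ S) (f : FreeAlgebra ℂ ℕ) : FreeAlgebra.lift ℂ a f ∈ S := by
  induction f using FreeAlgebra.induction with
  | grade0 r => rw [AlgHom.commutes]; exact S.algebraMap_mem r
  | grade1 x => rw [FreeAlgebra.lift_ι_apply]; exact ha x
  | mul a b ha hb => rw [map_mul]; exact mul_mem ha hb
  | add a b ha hb => rw [map_add]; exact add_mem ha hb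

lemma lift_map {A B : Type*} [Ring A] [Algebra ℂ A] [Ring B] [Algebra ℂ B] (φ : A →ₐ[ℂ] B)
    (a : ℕ → A) (f : FreeAlgebra ℂ ℕ) :
    φ (FreeAlgebra.lift ℂ a f) = FreeAlgebra.lift ℂ (fun i => φ (a i)) f := by
  induction f using FreeAlgebra.induction with
  | grade0 r => simp
  | grade1 x => simp
  | mul a b ha hb => simp [ha, hb]
  | add a b ha hb => simp [ha, hb]

lemma lift_conj {n : ℕ} {P Q : Matrix (Fin n) (Fin n) ℂ} (h1 : P * Q = 1) (h2 : Q * P = 1)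
    (a : ℕ → Matrix (Fin n) (Fin n) ℂ) (f : FreeAlgebra ℂ ℕ) :
    FreeAlgebra.lift ℂ (fun i => P * a i * Q) f = P * FreeAlgebra.lift ℂ a f * Q := by
  induction f using FreeAlgebra.induction with
  | grade0 r => 
    rw [AlgHom.commutes, AlgHom.commutes, ← Algebra.commutes, mul_assoc, h1, mul_one]
  | grade1 x => simp
  | mul x y hx hy =>
    rw [map_mul, map_mul, hx, hy]
    calc _ = P * FreeAlgebra.lift ℂ a x * (Q * P) * FreeAlgebra.lift ℂ a y * Q := by
          simp only [mul_assoc]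
      _ = _ := by rw [h2]; simp only [mul_assoc, one_mul]
  | add a b ha hb => simp [ha, hb, mul_add, add_mul]

lemma exists_hank_comm {n : ℕ} [NeZero n] (f : FreeAlgebra ℂ ℕ)
    (a : ℕ → Matrix (Fin n) (Fin n) ℂ) (B : Matrix (Fin n) (Fin n) ℂ)
    (hB : B * FreeAlgebra.lift ℂ a f ≠ FreeAlgebra.lift ℂ a f * B) :
    ∃ (a' : ℕ → Matrix (Fin n) (Fin n) ℂ) (G : Matrix (Fin n) (Fin n) ℂ),
      hank (G * FreeAlgebra.lift ℂ a' f - FreeAlgebra.lift ℂ a' f * G) ≠ 0 := by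
  classical
  have hw := Complex.isPrimitiveRoot_exp n (NeZero.ne n)
  generalize Complex.exp (2 * Real.pi * Complex.I / n) = w at hw
  have hwq := shift_mul_clock hw.pow_eq_one
  let x : ℂ × ℂ → Matrix (Fin n) (Fin n) ℂ := fun st => st.1 • clockM n w
  let y : ℂ × ℂ → Matrix (Fin n) (Fin n) ℂ := fun st => st.2 • shiftM n
  have hxy : y * x = w • (x * y) := by
    ext1 st
    simp only [x, y, Pi.mul_apply, Pi.smul_apply, smul_mul_assoc, mul_smul_comm, hwq, smul_smul]
    congr 1; ring
  let ev : ℂ × ℂ → ((ℂ × ℂ → Matrix (Fin n) (Fin n) ℂ) →ₐ[ℂ] Matrix (Fin n) (Fin n) ℂ) :=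
    fun st => Pi.evalAlgHom ℂ _ st
  have hev : ∀ st z, ev st z = z st := fun _ _ => rfl
  have hmap : (Algebra.adjoin ℂ {x, y}).map (ev (1, 1)) = ⊤ := by
    rw [AlgHom.map_adjoin, Set.image_pair, ← adjoin_clock_shift hw]
    congr 2 <;> simp [hev, x, y]
  have hex : ∀ i, ∃ z ∈ Algebra.adjoin ℂ {x, y}, ev (1, 1) z = a i := by
    intro i
    have : a i ∈ (Algebra.adjoin ℂ {x, y}).map (ev (1, 1)) := by rw [hmap]; trivial
    exact this
  choose z hz hza using hex
  have hF := adjoin_le_span hxy (lift_mem _ z hz f)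
  rw [Finsupp.mem_span_range_iff_exists_finsupp] at hF
  obtain ⟨c, hc⟩ := hF
  have hval : ∀ st : ℂ × ℂ, FreeAlgebra.lift ℂ (fun i => ev st (z i)) f =
      ∑ i ∈ c.support, (c i * (st.1 ^ i.1 * st.2 ^ i.2)) •
        (clockM n w ^ i.1 * shiftM n ^ i.2) := by
    intro st
    rw [← lift_map, ← hc, Finsupp.sum, map_sum]
    refine Finset.sum_congr rfl fun i _ => ?_
    rw [map_smul, map_mul, map_pow, map_pow, hev, hev]
    simp only [x, y, _root_.smul_pow, smul_mul_assoc, mul_smul_comm, smul_smul]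
    congr 1; ring
  let T := c.support.filter fun i => w ^ i.1 ≠ 1 ∨ w ^ i.2 ≠ 1
  have hcomm : ∀ st G, G * FreeAlgebra.lift ℂ (fun i => ev st (z i)) f -
      FreeAlgebra.lift ℂ (fun i => ev st (z i)) f * G =
      ∑ i ∈ T, (st.1 ^ i.1 * st.2 ^ i.2) • (c i • (G * (clockM n w ^ i.1 * shiftM n ^ i.2) -
        (clockM n w ^ i.1 * shiftM n ^ i.2) * G)) := by
    intro st G
    rw [hval, Finset.mul_sum, Finset.sum_mul, ← Finset.sum_sub_distrib]
    rw [Finset.sum_filter]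
    refine Finset.sum_congr rfl fun i _ => ?_
    split_ifs with h
    · rw [mul_smul_comm, smul_mul_assoc, ← smul_sub, smul_smul, mul_comm (c i)]
    · push Not at h
      rw [mul_smul_comm, smul_mul_assoc, central_monomial hw _ _ h.1 h.2, sub_self]
  have hTne : T.Nonempty := by
    rw [Finset.nonempty_iff_ne_empty]
    intro hT
    have := hcomm (1, 1) B
    rw [hT, Finset.sum_empty, sub_eq_zero] at this
    simp only [hza] at this
    exact hB this
  let N := (T.sup fun i => i.1) + 1
  have hN : ∀ i ∈ T, i.1 < N := fun i hi => Nat.lt_succ_of_le (Finset.le_sup (f := fun i => i.1) hi)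
  obtain ⟨i₀, hi₀, hmax⟩ := T.exists_max_image (fun i => i.1 + N * i.2) hTne
  have hlt : ∀ i ∈ T, i ≠ i₀ → i.1 + N * i.2 < i₀.1 + N * i₀.2 := by
    intro i hi hne
    refine lt_of_le_of_ne (hmax i hi) fun heq => hne ?_
    have e1 : i.1 = i₀.1 := by
      have := congrArg (· % N) heq
      simpa [Nat.add_mul_mod_self_left, Nat.mod_eq_of_lt (hN i hi), Nat.mod_eq_of_lt (hN _ hi₀)]
        using this
    have e2 : i.2 = i₀.2 := by
      rw [e1] at heq
      exact Nat.eq_of_mul_eq_mul_left (Nat.succ_pos _ : 0 < N) (Nat.add_left_cancel heq)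
    exact Prod.ext e1 e2
  obtain ⟨hs, hch⟩ := Finset.mem_filter.1 hi₀
  obtain ⟨G, hG⟩ := exists_comm hw i₀.1 i₀.2 hch
  have hci : c i₀ ≠ 0 := Finsupp.mem_support_iff.1 hs
  obtain ⟨r, hr⟩ := lead T (fun i => i.1 + N * i.2) (fun i => c i •
    (G * (clockM n w ^ i.1 * shiftM n ^ i.2) - (clockM n w ^ i.1 * shiftM n ^ i.2) * G)) i₀ hi₀ hlt
    ((hank_smul_ne hci _).2 hG)
  refine ⟨fun i => ev (r, r ^ N) (z i), G, ?_⟩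
  rw [hcomm]
  simpa only [← pow_mul, ← pow_add] using hr

/-- A conjugate of `A` whose difference with `A` has distinct eigenvalues. -/
lemma exists_conj_sub {n : ℕ} (A G : Matrix (Fin n) (Fin n) ℂ) (h : hank (G * A - A * G) ≠ 0) :
    ∃ P Q : Matrix (Fin n) (Fin n) ℂ, P * Q = 1 ∧ Q * P = 1 ∧ hank (P * A * Q - A) ≠ 0 := by
  let g : ℂ → Matrix (Fin n) (Fin n) ℂ := fun u => 1 + u • G
  have hg : Continuous g := continuous_const.add (continuous_id.smul continuous_const)
  have hg0 : g 0 = 1 := by simp [g]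
  have h1 : ∀ᶠ u in nhds (0 : ℂ), (g u).det ≠ 0 :=
    (hg.matrix_det.continuousAt (x := 0)).eventually_ne (by simp [hg0])
  have h2 : ∀ᶠ u in nhds (0 : ℂ), hank ((G * A - A * G) * (g u).adjugate) ≠ 0 :=
    ((continuous_hank.comp (continuous_const.mul hg.matrix_adjugate)).continuousAt
      (x := 0)).eventually_ne (by simpa [Function.comp, hg0] using h)
  have hev' : ∀ᶠ u in nhdsWithin (0 : ℂ) {0}ᶜ, ((g u).det ≠ 0 ∧
      hank ((G * A - A * G) * (g u).adjugate) ≠ 0) ∧ u ≠ 0 :=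
    ((h1.and h2).filter_mono nhdsWithin_le_nhds).and self_mem_nhdsWithin
  obtain ⟨u, ⟨hd, hh⟩, hu0⟩ := hev'.exists
  have hdu : IsUnit (g u).det := isUnit_iff_ne_zero.2 hd
  refine ⟨g u, (g u)⁻¹, Matrix.mul_nonsing_inv _ hdu, Matrix.nonsing_inv_mul _ hdu, ?_⟩
  have : g u * A * (g u)⁻¹ - A = (u * (g u).det⁻¹) • ((G * A - A * G) * (g u).adjugate) := by
    have e1 : g u * A * (g u)⁻¹ - A = (g u * A - A * g u) * (g u)⁻¹ := by
      rw [sub_mul, mul_assoc A, Matrix.mul_nonsing_inv _ hdu, mul_one]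
    have e2 : g u * A - A * g u = u • (G * A - A * G) := by
      simp [g, add_mul, mul_add, smul_sub]
    rw [e1, e2, Matrix.inv_def, Ring.inverse_eq_inv', mul_smul_comm, smul_mul_assoc, smul_smul,
      mul_comm]
  rw [this, hank_smul_ne (mul_ne_zero hu0 (inv_ne_zero hd))]
  exact hh

end WaringAux

/-- Theorem (Brešar–Šemrl): the Waring constant of `Mₙ(ℂ)` is at most 5: for every
noncommutative polynomial `f` and every `n ≥ 2`, every element of the span of
`f(Mₙ(ℂ))` is a linear combination of (at most) 5 elements of `f(Mₙ(ℂ))`. -/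
theorem waring_constant_matrices_le_five (n : ℕ) (hn : 2 ≤ n) (f : FreeAlgebra ℂ ℕ) :
    ∀ z ∈ Submodule.span ℂ
        {x : Matrix (Fin n) (Fin n) ℂ | ∃ a : ℕ → Matrix (Fin n) (Fin n) ℂ,
          FreeAlgebra.lift ℂ a f = x},
      ∃ (c : Fin 5 → ℂ) (s : Fin 5 → Matrix (Fin n) (Fin n) ℂ),
        (∀ j, ∃ a : ℕ → Matrix (Fin n) (Fin n) ℂ, FreeAlgebra.lift ℂ a f = s j) ∧
        z = ∑ j, c j • s j := by
    classical
  haveI : NeZero n := ⟨by omega⟩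
  intro z hz
  by_cases hcen : ∀ (a : ℕ → Matrix (Fin n) (Fin n) ℂ) (B : Matrix (Fin n) (Fin n) ℂ),
      B * FreeAlgebra.lift ℂ a f = FreeAlgebra.lift ℂ a f * B
  · have hsc : ∀ a : ℕ → Matrix (Fin n) (Fin n) ℂ, ∃ k : ℂ,
        FreeAlgebra.lift ℂ a f = k • (1 : Matrix (Fin n) (Fin n) ℂ) := by
      intro a
      have hm : FreeAlgebra.lift ℂ a f ∈ Set.center (Matrix (Fin n) (Fin n) ℂ) :=
        Semigroup.mem_center_iff.2 (hcen a)
      rw [Matrix.center_eq_range] at hm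
      obtain ⟨k, hk⟩ := hm
      exact ⟨k, by rw [← hk, Matrix.smul_one_eq_diagonal]; rfl⟩
    have hz1 : z ∈ Submodule.span ℂ {(1 : Matrix (Fin n) (Fin n) ℂ)} := by
      refine Submodule.span_le.2 ?_ hz
      rintro _ ⟨a, rfl⟩
      obtain ⟨k, hk⟩ := hsc a
      rw [hk]
      exact Submodule.smul_mem _ _ (Submodule.mem_span_singleton_self _)
    obtain ⟨d, rfl⟩ := Submodule.mem_span_singleton.1 hz1
    by_cases h0 : ∀ a : ℕ → Matrix (Fin n) (Fin n) ℂ, FreeAlgebra.lift ℂ a f = 0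
    · have hz0 : d • (1 : Matrix (Fin n) (Fin n) ℂ) ∈
          (⊥ : Submodule ℂ (Matrix (Fin n) (Fin n) ℂ)) := by
        refine Submodule.span_le.2 ?_ hz
        rintro _ ⟨a, rfl⟩
        simp [h0 a]
      refine ⟨fun _ => 0, fun _ => FreeAlgebra.lift ℂ 0 f, fun _ => ⟨_, rfl⟩, ?_⟩
      rw [(Submodule.mem_bot ℂ).1 hz0]
      simp
    · push Not at h0
      obtain ⟨a, ha⟩ := h0
      obtain ⟨k, hk⟩ := hsc a
      have hk0 : k ≠ 0 := by rintro rfl; exact ha (by rw [hk, zero_smul])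
      refine ⟨![d / k, 0, 0, 0, 0], fun _ => FreeAlgebra.lift ℂ a f, fun _ => ⟨_, rfl⟩, ?_⟩
      rw [Fin.sum_univ_five, hk]
      simp [smul_smul, hk0]
  · push Not at hcen
    obtain ⟨a₁, B, hB⟩ := hcen
    obtain ⟨a, G, hG⟩ := WaringAux.exists_hank_comm f a₁ B hB
    obtain ⟨P, Q, hPQ, hQP, hW⟩ := WaringAux.exists_conj_sub _ G hG
    obtain ⟨c₀, a₀, htr⟩ : ∃ (c₀ : ℂ) (a₀ : ℕ → Matrix (Fin n) (Fin n) ℂ),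
        (z - c₀ • FreeAlgebra.lift ℂ a₀ f).trace = 0 := by
      by_cases h0 : ∀ a : ℕ → Matrix (Fin n) (Fin n) ℂ, (FreeAlgebra.lift ℂ a f).trace = 0
      · refine ⟨0, a, ?_⟩
        have : z ∈ LinearMap.ker (Matrix.traceLinearMap (Fin n) ℂ ℂ) := by
          refine Submodule.span_le.2 ?_ hz
          rintro _ ⟨a, rfl⟩
          exact h0 a
        rw [zero_smul, sub_zero]
        exact this
      · push Not at h0
        obtain ⟨a₀, h0⟩ := h0
        refine ⟨z.trace / (FreeAlgebra.lift ℂ a₀ f).trace, a₀, ?_⟩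
        rw [Matrix.trace_sub, Matrix.trace_smul, smul_eq_mul, div_mul_cancel₀ _ h0, sub_self]
    obtain ⟨W₁, W₂, ⟨P₁, Q₁, h11, h12, rfl⟩, ⟨P₂, Q₂, h21, h22, rfl⟩, hT⟩ :=
      WaringAux.trace_zero_eq_sub hW _ htr
    set A := FreeAlgebra.lift ℂ a f with hA
    have hPA : FreeAlgebra.lift ℂ (fun i => P * a i * Q) f = P * A * Q :=
      WaringAux.lift_conj hPQ hQP a f
    refine ⟨![c₀, 1, -1, -1, 1], ![FreeAlgebra.lift ℂ a₀ f, P₁ * (P * A * Q) * Q₁, P₁ * A * Q₁,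
      P₂ * (P * A * Q) * Q₂, P₂ * A * Q₂], ?_, ?_⟩
    · intro j
      fin_cases j
      · exact ⟨a₀, rfl⟩
      · exact ⟨_, (WaringAux.lift_conj h11 h12 _ f).trans (by rw [hPA]; rfl)⟩
      · exact ⟨_, WaringAux.lift_conj h11 h12 a f⟩
      · exact ⟨_, (WaringAux.lift_conj h21 h22 _ f).trans (by rw [hPA]; rfl)⟩
      · exact ⟨_, WaringAux.lift_conj h21 h22 a f⟩
    · rw [sub_eq_iff_eq_add] at hT
      rw [hT, Fin.sum_univ_five]
      simp only [Matrix.cons_val, mul_sub, sub_mul, one_smul, neg_smul]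
      abel
end

section
/- Let f be a nonconstant polynomial, i.e., an element of the free associative ℂ-algebra ℂ⟨X₁,X₂,…⟩ not lying in ℂ·1. Then there exists N such that for all n ≥ N, every trace-zero matrix in M_n(ℂ) belongs to f(M_n(ℂ)) − f(M_n(ℂ)), i.e., can be written as s − t with s, t ∈ f(M_n(ℂ)). -/
open Matrix Polynomial in
/-- distinct eigenvalues imply diagonalizable -/
lemma bv_conj_diag {ι : Type*} [Fintype ι] [DecidableEq ι] (A : Matrix ι ι ℂ) (d : ι → ℂ)
    (hd : Function.Injective d) (v : ι → ι → ℂ) (hv : ∀ i, v i ≠ 0)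
    (h : ∀ i, A *ᵥ (v i) = d i • v i) : IsConj (diagonal d) A := by
  have hli : LinearIndependent ℂ v := by
    refine Module.End.eigenvectors_linearIndependent' (Matrix.toLin' A) d hd v fun i => ?_
    refine Module.End.hasEigenvector_iff.2 ⟨Module.End.mem_eigenspace_iff.2 ?_, hv i⟩
    simpa using h i
  let P : Matrix ι ι ℂ := (Matrix.of v)ᵀ
  have hP : IsUnit P := by
    rw [← Matrix.linearIndependent_cols_iff_isUnit]
    exact hli
  refine ⟨hP.unit, ?_⟩
  change P * diagonal d = A * P
  ext i j
  have := congrFun (h j) i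
  rw [Matrix.mul_diagonal]
  simp only [Matrix.mulVec, dotProduct, Pi.smul_apply, smul_eq_mul] at this
  simp only [Matrix.mul_apply, P, Matrix.transpose_apply, Matrix.of_apply]
  rw [this, mul_comm]

open Matrix Polynomial in
lemma bv_exists_eigvec {ι : Type*} [Fintype ι] [DecidableEq ι] (A : Matrix ι ι ℂ) (x : ℂ)
    (h : A.charpoly.IsRoot x) : ∃ v : ι → ℂ, v ≠ 0 ∧ A *ᵥ v = x • v := by
  rw [Polynomial.IsRoot, Matrix.eval_charpoly, ← Matrix.exists_mulVec_eq_zero_iff] at h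
  obtain ⟨v, hv, h⟩ := h
  refine ⟨v, hv, ?_⟩
  rw [Matrix.sub_mulVec, sub_eq_zero] at h
  rw [← h]
  simp [Matrix.scalar_apply, ← Matrix.smul_one_eq_diagonal, Matrix.smul_mulVec]

open Matrix Polynomial in
lemma bv_conj_diag' {ι : Type*} [Fintype ι] [DecidableEq ι] (A : Matrix ι ι ℂ) (d : ι → ℂ)
    (hd : Function.Injective d) (h : ∀ i, A.charpoly.IsRoot (d i)) : IsConj (diagonal d) A := by
  choose v hv hv' using fun i => bv_exists_eigvec A (d i) (h i)
  exact bv_conj_diag A d hd v hv hv'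

open Matrix Polynomial in
lemma bv_upper {n : ℕ} (U : Matrix (Fin n) (Fin n) ℂ) (d : Fin n → ℂ)
    (hd : Function.Injective d) (hU : ∀ i j, j ≤ i → U i j = 0) :
    IsConj (diagonal d) (diagonal d + U) := by
  apply bv_conj_diag' _ _ hd
  intro i
  rw [Matrix.charpoly_of_isUpperTriangular]
  · rw [Polynomial.IsRoot, Polynomial.eval_prod]
    apply Finset.prod_eq_zero (Finset.mem_univ i)
    simp [hU i i le_rfl]
  · intro a b hab
    have hab : b < a := hab
    simp [hU a b hab.le, Matrix.diagonal_apply_ne _ hab.ne']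

open Matrix Polynomial in
lemma bv_lower {n : ℕ} (U : Matrix (Fin n) (Fin n) ℂ) (d : Fin n → ℂ)
    (hd : Function.Injective d) (hU : ∀ i j, i ≤ j → U i j = 0) :
    IsConj (diagonal d) (diagonal d + U) := by
  apply bv_conj_diag' _ _ hd
  intro i
  rw [← Matrix.charpoly_transpose, Matrix.charpoly_of_isUpperTriangular]
  · rw [Polynomial.IsRoot, Polynomial.eval_prod]
    apply Finset.prod_eq_zero (Finset.mem_univ i)
    simp [hU i i le_rfl]
  · intro a b hab
    have hab : b < a := hab
    simp [hU b a hab.le, Matrix.diagonal_apply_ne _ hab.ne]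

open Matrix in
lemma bv_transv {ι : Type*} [Fintype ι] [DecidableEq ι] (A : Matrix ι ι ℂ) (i j : ι) (hij : i ≠ j)
    (c : ℂ) : IsConj A (transvection i j c * A * transvection i j (-c)) := by
  have h1 : transvection i j c * transvection i j (-c) = 1 := by
    rw [transvection_mul_transvection_same _ _ hij]; simp
  have h2 : transvection i j (-c) * transvection i j c = 1 := by
    rw [transvection_mul_transvection_same _ _ hij]; simp
  refine ⟨⟨transvection i j c, transvection i j (-c), h1, h2⟩, ?_⟩
  change transvection i j c * A = _
  simp [Matrix.mul_assoc, h2]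

open Matrix in
lemma bv_kill0 {ι : Type*} [Fintype ι] [DecidableEq ι] (A : Matrix ι ι ℂ) (k j : ι) (hkj : k ≠ j)
    (h : A j k ≠ 0) :
    ∃ B, IsConj A B ∧ B k k = 0 ∧ ∀ i, i ≠ k → i ≠ j → B i i = A i i := by
  refine ⟨_, bv_transv A k j hkj (-(A k k / A j k)), ?_, ?_⟩
  · rw [mul_transvection_apply_of_ne _ _ _ _ hkj, transvection_mul_apply_same]
    field_simp; ring
  · intro i hik hij
    rw [mul_transvection_apply_of_ne _ _ _ _ hij, transvection_mul_apply_of_ne _ _ _ _ hik]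

open Matrix in
lemma bv_kill {ι : Type*} [Fintype ι] [DecidableEq ι] (A : Matrix ι ι ℂ) (k j : ι) (hkj : k ≠ j)
    (h : A k k ≠ A j j) :
    ∃ B, IsConj A B ∧ B k k = 0 ∧ ∀ i, i ≠ k → i ≠ j → B i i = A i i := by
  by_cases h1 : A j k = 0
  · by_cases h2 : A k j = 0
    · have hc := bv_transv A j k hkj.symm 1
      obtain ⟨B, hB, hB0, hBi⟩ := bv_kill0 (transvection j k 1 * A * transvection j k (-1)) k j hkj (by
        rw [mul_transvection_apply_same, transvection_mul_apply_same, transvection_mul_apply_same,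
          h1, h2]
        intro h3
        apply h
        linear_combination h3)
      refine ⟨B, hc.trans hB, hB0, fun i hik hij => ?_⟩
      rw [hBi i hik hij, mul_transvection_apply_of_ne _ _ _ _ hik,
        transvection_mul_apply_of_ne _ _ _ _ hij]
    · refine ⟨_, bv_transv A j k hkj.symm (A k k / A k j), ?_, ?_⟩
      · rw [mul_transvection_apply_same, transvection_mul_apply_of_ne _ _ _ _ hkj,
          transvection_mul_apply_of_ne _ _ _ _ hkj]
        field_simp; ring
      · intro i hik hij
        rw [mul_transvection_apply_of_ne _ _ _ _ hik, transvection_mul_apply_of_ne _ _ _ _ hij]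
  · exact bv_kill0 A k j hkj h1

open Matrix in
lemma bv_trace_conj {ι : Type*} [Fintype ι] [DecidableEq ι] {A B : Matrix ι ι ℂ} (h : IsConj A B) :
    A.trace = B.trace := by
  obtain ⟨P, hP⟩ := h
  have hP : (P : Matrix ι ι ℂ) * A = B * P := hP
  have : A = (↑P⁻¹ : Matrix ι ι ℂ) * (B * P) := by rw [← hP, ← mul_assoc]; simp
  rw [this, Matrix.trace_mul_comm, mul_assoc]; simp

open Matrix in
lemma bv_zero_diag {ι : Type*} [Fintype ι] [DecidableEq ι] (A : Matrix ι ι ℂ) (hA : A.trace = 0)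
    (S : Finset ι) : ∃ B, IsConj A B ∧ ∀ i ∈ S, B i i = 0 := by
  induction S using Finset.induction_on with
  | empty => exact ⟨A, IsConj.refl _, by simp⟩
  | insert k S hk ih =>
    obtain ⟨B, hB, hBS⟩ := ih
    by_cases h0 : B k k = 0
    · refine ⟨B, hB, ?_⟩
      simpa [h0] using hBS
    have htr : ∑ i, B i i = 0 := by
      have := bv_trace_conj hB
      rw [hA] at this
      exact this.symm
    have : ∃ j, j ∉ S ∧ B k k ≠ B j j := by
      by_contra! hcon
      have h1 : ∑ i ∈ Finset.univ \ S, B i i = 0 := by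
        rw [← htr, ← Finset.sum_sdiff (Finset.subset_univ S), Finset.sum_eq_zero (s := S) hBS,
          add_zero]
      rw [Finset.sum_congr rfl (fun i hi => (hcon i (by simpa using hi)).symm)] at h1
      rw [Finset.sum_const, nsmul_eq_mul, mul_eq_zero] at h1
      rcases h1 with h1 | h1
      · rw [Nat.cast_eq_zero, Finset.card_eq_zero] at h1
        have : k ∈ Finset.univ \ S := by simp [hk]
        simp [h1] at this
      · exact h0 h1
    obtain ⟨j, hjS, hj⟩ := this
    have hkj : k ≠ j := by rintro rfl; exact hj rfl
    obtain ⟨C, hC, hC0, hCi⟩ := bv_kill B k j hkj hj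
    refine ⟨C, hB.trans hC, ?_⟩
    intro i hi
    rcases Finset.mem_insert.1 hi with rfl | hiS
    · exact hC0
    · rw [hCi i (fun h => hk (h ▸ hiS)) (fun h => hjS (h ▸ hiS)), hBS i hiS]

open Matrix in
lemma bv_diff {n : ℕ} (X : Matrix (Fin n) (Fin n) ℂ) (hX : X.trace = 0) (d : Fin n → ℂ)
    (hd : Function.Injective d) :
    ∃ s t, IsConj (diagonal d) s ∧ IsConj (diagonal d) t ∧ X = s - t := by
  obtain ⟨Y, hY, hY0⟩ := bv_zero_diag X hX Finset.univ
  let L : Matrix (Fin n) (Fin n) ℂ := Matrix.of fun i j => if j < i then Y i j else 0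
  let U : Matrix (Fin n) (Fin n) ℂ := Matrix.of fun i j => if i < j then - Y i j else 0
  have hL : IsConj (diagonal d) (diagonal d + L) := bv_lower L d hd (by
    intro i j hij; simp [L, not_lt.2 hij])
  have hU : IsConj (diagonal d) (diagonal d + U) := bv_upper U d hd (by
    intro i j hij; simp [U, not_lt.2 hij])
  have hYL : Y = (diagonal d + L) - (diagonal d + U) := by
    ext i j
    rcases lt_trichotomy i j with h | h | h
    · simp [L, U, h, not_lt.2 h.le]
    · subst h; simp [L, U, hY0 i]
    · simp [L, U, h, not_lt.2 h.le]
  obtain ⟨P, hP⟩ := hY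
  have hP : (P : Matrix (Fin n) (Fin n) ℂ) * X = Y * P := hP
  have key : ∀ Z : Matrix (Fin n) (Fin n) ℂ, IsConj Z ((↑P⁻¹ : Matrix (Fin n) (Fin n) ℂ) * Z * P) := by
    intro Z
    refine ⟨P⁻¹, ?_⟩
    change (↑P⁻¹ : Matrix (Fin n) (Fin n) ℂ) * Z = _
    simp [mul_assoc]
  refine ⟨_, _, hL.trans (key _), hU.trans (key _), ?_⟩
  rw [← Matrix.sub_mul, ← Matrix.mul_sub, ← hYL, mul_assoc, ← hP, ← mul_assoc]
  simp

/-- evaluation of a finitely supported combination of words -/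
noncomputable def bvEv {A : Type*} [Ring A] [Algebra ℂ A] (c : List ℕ →₀ ℂ) (a : ℕ → A) : A :=
  c.sum fun w x => x • (w.map a).prod

lemma bvEv_map {A B : Type*} [Ring A] [Algebra ℂ A] [Ring B] [Algebra ℂ B] (φ : A →ₐ[ℂ] B)
    (c : List ℕ →₀ ℂ) (a : ℕ → A) : φ (bvEv c a) = bvEv c (fun i => φ (a i)) := by
  simp only [bvEv, Finsupp.sum, map_sum, map_smul, map_list_prod, List.map_map]
  rfl

lemma bv_exists_coef (f : FreeAlgebra ℂ ℕ) : ∃ c : List ℕ →₀ ℂ, f = bvEv c (FreeAlgebra.ι ℂ) := by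
  have h : f ∈ Subalgebra.toSubmodule (Algebra.adjoin ℂ (Set.range (FreeAlgebra.ι ℂ (X := ℕ)))) := by
    rw [FreeAlgebra.adjoin_range_ι]; simp
  rw [Algebra.adjoin_eq_span] at h
  have h2 : f ∈ Submodule.span ℂ
      (Set.range fun w : List ℕ => (w.map (FreeAlgebra.ι ℂ (X := ℕ))).prod) := by
    refine Submodule.span_mono ?_ h
    intro x hx
    obtain ⟨l, hl, rfl⟩ := Submonoid.exists_list_of_mem_closure hx
    clear hx
    induction l with
    | nil => exact ⟨[], by simp⟩
    | cons y l ih =>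
      obtain ⟨w, hw⟩ := ih (fun z hz => hl z (by simp [hz]))
      obtain ⟨i, hi⟩ := hl y (by simp)
      refine ⟨i :: w, ?_⟩
      simp only [List.map_cons, List.prod_cons] at hw ⊢
      rw [hw, hi]
  obtain ⟨c, hc⟩ := Finsupp.mem_span_range_iff_exists_finsupp.1 h2
  exact ⟨c, hc.symm⟩

lemma bv_lift {A : Type*} [Ring A] [Algebra ℂ A] (c : List ℕ →₀ ℂ) (a : ℕ → A) :
    FreeAlgebra.lift ℂ a (bvEv c (FreeAlgebra.ι ℂ)) = bvEv c a := by
  rw [bvEv_map]; simp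

/-- conjugation by a unit, as an algebra map -/
def bvConj {A : Type*} [Ring A] [Algebra ℂ A] (P : Aˣ) : A →ₐ[ℂ] A :=
  AlgHom.ofLinearMap
    { toFun := fun x => P * x * (↑P⁻¹ : A)
      map_add' := fun x y => by simp [mul_add, add_mul]
      map_smul' := fun r x => by simp }
    (by simp)
    (fun x y => by simp [mul_assoc])

lemma bvEv_conj {A : Type*} [Ring A] [Algebra ℂ A] (c : List ℕ →₀ ℂ) (a : ℕ → A) (B : A)
    (h : IsConj (bvEv c a) B) : ∃ b, bvEv c b = B := by
  obtain ⟨P, hP⟩ := h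
  have hP : (P : A) * bvEv c a = B * P := hP
  refine ⟨fun i => bvConj P (a i), ?_⟩
  rw [← bvEv_map]
  change (P : A) * bvEv c a * (↑P⁻¹ : A) = B
  rw [hP, mul_assoc]; simp

/-- block diagonal embedding -/
def bvBlock (m n : Type*) [Fintype m] [DecidableEq m] [Fintype n] [DecidableEq n] :
    (Matrix m m ℂ × Matrix n n ℂ) →ₐ[ℂ] Matrix (m ⊕ n) (m ⊕ n) ℂ :=
  AlgHom.ofLinearMap
    { toFun := fun x => Matrix.fromBlocks x.1 0 0 x.2
      map_add' := fun x y => by simp [Matrix.fromBlocks_add]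
      map_smul' := fun r x => by simp [Matrix.fromBlocks_smul] }
    (by simp)
    (fun x y => by simp [Matrix.fromBlocks_multiply])

lemma bvEv_block {m n : Type*} [Fintype m] [DecidableEq m] [Fintype n] [DecidableEq n]
    (c : List ℕ →₀ ℂ) (a : ℕ → Matrix m m ℂ) (b : ℕ → Matrix n n ℂ) :
    bvEv c (fun i => Matrix.fromBlocks (a i) 0 0 (b i)) =
      Matrix.fromBlocks (bvEv c a) 0 0 (bvEv c b) := by
  have h := bvEv_map (bvBlock m n) c (fun i => (a i, b i))
  have h1 := bvEv_map (AlgHom.fst ℂ (Matrix m m ℂ) (Matrix n n ℂ)) c (fun i => (a i, b i))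
  have h2 := bvEv_map (AlgHom.snd ℂ (Matrix m m ℂ) (Matrix n n ℂ)) c (fun i => (a i, b i))
  simp only [AlgHom.fst_apply, AlgHom.snd_apply] at h1 h2
  rw [← h1, ← h2]
  exact h.symm

lemma bvEv_smul {A : Type*} [Ring A] [Algebra ℂ A] (c : List ℕ →₀ ℂ) (a : ℕ → A) (s : ℂ) :
    bvEv c (fun i => s • a i) = c.sum fun w x => (x * s ^ w.length) • (w.map a).prod := by
  unfold bvEv
  apply Finsupp.sum_congr
  rintro w -
  rw [mul_smul]
  congr 1
  induction w with
  | nil => simp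
  | cons i w ih =>
    rw [List.map_cons, List.prod_cons, ih, List.map_cons, List.prod_cons, smul_mul_smul_comm,
      List.length_cons, pow_succ']

/-- diagonalizable evaluations with distinct nonzero eigenvalues -/
def BVGood (c : List ℕ →₀ ℂ) (ι : Type) [Fintype ι] [DecidableEq ι] : Prop :=
  ∃ (a : ℕ → Matrix ι ι ℂ) (d : ι → ℂ), Function.Injective d ∧ (∀ i, d i ≠ 0) ∧
    bvEv c a = Matrix.diagonal d

lemma BVGood.reindex {c : List ℕ →₀ ℂ} {ι κ : Type} [Fintype ι] [DecidableEq ι]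
    [Fintype κ] [DecidableEq κ] (e : ι ≃ κ) (h : BVGood c ι) : BVGood c κ := by
  obtain ⟨a, d, hd, hd0, had⟩ := h
  refine ⟨fun i => Matrix.reindexAlgEquiv ℂ ℂ e (a i), d ∘ e.symm, hd.comp e.symm.injective,
    fun i => hd0 _, ?_⟩
  have := bvEv_map (Matrix.reindexAlgEquiv ℂ ℂ e : Matrix ι ι ℂ →ₐ[ℂ] Matrix κ κ ℂ) c a
  simp only [AlgEquiv.coe_toAlgHom] at this
  rw [← this, had]
  simp [Matrix.coe_reindexAlgEquiv]

lemma BVGood.sum {c : List ℕ →₀ ℂ} {d : ℕ} (hd : 0 < d) (hc : ∀ w ∈ c.support, w.length = d)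
    {ι κ : Type} [Fintype ι] [DecidableEq ι]
    [Fintype κ] [DecidableEq κ] (h : BVGood c ι) (h' : BVGood c κ) : BVGood c (ι ⊕ κ) := by
  obtain ⟨a, u, hu, hu0, hau⟩ := h
  obtain ⟨b, v, hv, hv0, hbv⟩ := h'
  have hfin : (insert 0 (Set.range fun p : ι × κ => v p.2 / u p.1)).Finite :=
    (Set.finite_range _).insert _
  obtain ⟨r, hr⟩ := hfin.exists_notMem
  obtain ⟨s, hs⟩ := IsAlgClosed.exists_pow_nat_eq r hd
  have hr0 : r ≠ 0 := fun h => hr (by simp [h])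
  refine ⟨fun i => Matrix.fromBlocks (s • a i) 0 0 (b i), Sum.elim (fun i => r * u i) v, ?_, ?_, ?_⟩
  · rintro (i | i) (j | j) hij
    · simp only [Sum.elim_inl] at hij
      rw [hu (mul_left_cancel₀ hr0 hij)]
    · exfalso
      simp only [Sum.elim_inl, Sum.elim_inr] at hij
      apply hr
      refine Set.mem_insert_of_mem _ ⟨(i, j), ?_⟩
      have := hu0 i
      simp only
      rw [← hij]; field_simp
    · exfalso
      simp only [Sum.elim_inl, Sum.elim_inr] at hij
      apply hr
      refine Set.mem_insert_of_mem _ ⟨(j, i), ?_⟩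
      have := hu0 j
      simp only
      rw [hij]; field_simp
    · simp only [Sum.elim_inr] at hij
      rw [hv hij]
  · rintro (i | i)
    · exact mul_ne_zero hr0 (hu0 i)
    · exact hv0 i
  · rw [bvEv_block, hbv, bvEv_smul]
    have : (c.sum fun w x => (x * s ^ w.length) • (w.map a).prod) = r • bvEv c a := by
      rw [bvEv, Finsupp.smul_sum]
      apply Finsupp.sum_congr
      intro w hw
      rw [hc w hw, hs, smul_smul, mul_comm]
    rw [this, hau, ← Matrix.fromBlocks_diagonal]
    congr 1
    ext i j
    by_cases hij : i = j
    · subst hij; simp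
    · simp [hij]

lemma BVGood.add {c : List ℕ →₀ ℂ} {d : ℕ} (hd : 0 < d) (hc : ∀ w ∈ c.support, w.length = d)
    {m n : ℕ} (h : BVGood c (Fin m)) (h' : BVGood c (Fin n)) : BVGood c (Fin (m + n)) :=
  (h.sum hd hc h').reindex finSumFinEquiv

lemma BVGood.zero (c : List ℕ →₀ ℂ) : BVGood c (Fin 0) :=
  ⟨fun _ => 0, fun i => i.elim0, fun i => i.elim0, fun i => i.elim0, by ext i; exact i.elim0⟩

lemma BVGood.mul {c : List ℕ →₀ ℂ} {d : ℕ} (hd : 0 < d) (hc : ∀ w ∈ c.support, w.length = d)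
    {m : ℕ} (h : BVGood c (Fin m)) (k : ℕ) : BVGood c (Fin (k * m)) := by
  induction k with
  | zero => rw [zero_mul]; exact BVGood.zero c
  | succ k ih => rw [add_mul, one_mul]; exact ih.add hd hc h

/-- weight of the path labelled by a word -/
def bvWt {m : ℕ} (e : ZMod m) (t : ℕ × ZMod m → ℂ) : ZMod m → List ℕ → ℂ
  | _, [] => 1
  | p, i :: w => t (i, p) * bvWt e t (p + e) w

/-- exponent of the path labelled by a word -/
noncomputable def bvEx {m : ℕ} (e : ZMod m) : ZMod m → List ℕ → (ℕ × ZMod m →₀ ℕ)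
  | _, [] => 0
  | p, i :: w => Finsupp.single (i, p) 1 + bvEx e (p + e) w

/-- weighted shift -/
def bvShift {m : ℕ} (e : ZMod m) (t : ℕ × ZMod m → ℂ) (i : ℕ) : Matrix (ZMod m) (ZMod m) ℂ :=
  Matrix.of fun p q => if q = p + e then t (i, p) else 0

lemma bvShift_word {m : ℕ} [NeZero m] (e : ZMod m) (t : ℕ × ZMod m → ℂ) (w : List ℕ) (p q : ZMod m) :
    (w.map (bvShift e t)).prod p q = if q = p + w.length * e then bvWt e t p w else 0 := by
  induction w generalizing p with
  | nil => simp [bvWt, Matrix.one_apply, eq_comm]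
  | cons i w ih =>
    rw [List.map_cons, List.prod_cons, Matrix.mul_apply]
    simp only [ih, bvShift, Matrix.of_apply, ite_mul, zero_mul, Finset.sum_ite_eq',
      Finset.mem_univ, if_true, bvWt, List.length_cons, Nat.cast_add, Nat.cast_one]
    rw [show p + e + (w.length : ZMod m) * e = p + ((w.length : ZMod m) + 1) * e by ring]
    simp

lemma bvEx_vanish {m : ℕ} (e : ZMod m) (w : List ℕ) (q p : ZMod m) (i : ℕ)
    (h : ∀ k < w.length, q + (k : ZMod m) * e ≠ p) : bvEx e q w (i, p) = 0 := by
  induction w generalizing q with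
  | nil => simp [bvEx]
  | cons j w ih =>
    rw [bvEx, Finsupp.add_apply, ih]
    · have h0 := h 0 (by simp)
      simp only [Nat.cast_zero, zero_mul, add_zero] at h0
      rw [Finsupp.single_apply, if_neg]
      intro hh
      exact h0 (Prod.ext_iff.1 hh).2
    · intro k hk hh
      apply h (k + 1) (by simpa using hk)
      rw [← hh]; push_cast; ring

lemma bvEx_inj {m d : ℕ} (e : ZMod m) (he : (d : ZMod m) * e = 1) (w w' : List ℕ) (p : ZMod m)
    (hl : w.length = w'.length) (hm : w.length ≤ m) (h : bvEx e p w = bvEx e p w') : w = w' := by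
  induction w generalizing w' p with
  | nil => simpa [eq_comm] using hl
  | cons i w ih =>
    cases w' with
    | nil => simp at hl
    | cons j w' =>
      simp only [List.length_cons, add_left_inj] at hl hm
      have hv : ∀ k < w.length, p + e + (k : ZMod m) * e ≠ p := by
        intro k hk hh
        have h1 : ((k + 1 : ℕ) : ZMod m) * e = 0 := by
          push_cast
          linear_combination hh
        have h2 : ((k + 1 : ℕ) : ZMod m) = 0 := by
          linear_combination (d : ZMod m) * h1 - ((k + 1 : ℕ) : ZMod m) * he
        rw [ZMod.natCast_eq_zero_iff] at h2
        have := Nat.le_of_dvd (by omega) h2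
        omega
      have hij : i = j := by
        have := DFunLike.congr_fun h (i, p)
        rw [bvEx, bvEx, Finsupp.add_apply, Finsupp.add_apply, bvEx_vanish e w _ _ _ hv,
          bvEx_vanish e w' _ _ _ (hl ▸ hv)] at this
        by_contra hne
        have hne' : ¬ ((j, p) = (i, p)) := fun h => hne (Prod.ext_iff.1 h).1.symm
        rw [Finsupp.single_apply, Finsupp.single_apply, if_neg hne'] at this
        simp at this
      subst hij
      rw [bvEx, bvEx, add_right_inj] at h
      rw [ih w' (p + e) hl (by omega) h]

lemma bv_eval_monomial {m : ℕ} (e : ZMod m) (t : ℕ × ZMod m → ℂ) (w : List ℕ) (p : ZMod m) (x : ℂ) :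
    MvPolynomial.eval t (MvPolynomial.monomial (bvEx e p w) x) = x * bvWt e t p w := by
  induction w generalizing p x with
  | nil => simp [bvEx, bvWt]
  | cons i w ih =>
    rw [bvEx, bvWt, ← one_mul x, ← MvPolynomial.monomial_mul, map_mul, ih]
    rw [MvPolynomial.eval_monomial]
    simp
    ring

lemma bv_exists_t {m d : ℕ} [NeZero m] (e : ZMod m) (he : (d : ZMod m) * e = 1) (hdm : d ≤ m)
    (c : List ℕ →₀ ℂ) (hc : ∀ w ∈ c.support, w.length = d) (hc0 : c ≠ 0) :
    ∃ t : ℕ × ZMod m → ℂ, ∀ p, (c.sum fun w x => x * bvWt e t p w) ≠ 0 := by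
  let F : ZMod m → MvPolynomial (ℕ × ZMod m) ℂ := fun p =>
    c.sum fun w x => MvPolynomial.monomial (bvEx e p w) x
  have hF : ∀ p, F p ≠ 0 := by
    intro p h0
    obtain ⟨w0, hw0⟩ := Finsupp.support_nonempty_iff.2 hc0
    have h1 := congrArg (MvPolynomial.coeff (bvEx e p w0)) h0
    simp only [F, Finsupp.sum, MvPolynomial.coeff_sum, MvPolynomial.coeff_monomial,
      MvPolynomial.coeff_zero] at h1
    rw [Finset.sum_eq_single w0] at h1
    · simp at h1
      exact (Finsupp.mem_support_iff.1 hw0) h1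
    · intro w hw hne
      rw [if_neg]
      intro hh
      exact hne (bvEx_inj e he w w0 p ((hc w hw).trans (hc w0 hw0).symm) ((hc w hw).trans_le hdm) hh)
    · intro h; exact absurd hw0 h
  have hP : ∏ p, F p ≠ 0 := Finset.prod_ne_zero_iff.2 fun p _ => hF p
  have : ∃ t, MvPolynomial.eval t (∏ p, F p) ≠ 0 := by
    by_contra! hcon
    exact hP (MvPolynomial.funext fun t => by rw [hcon t, map_zero])
  obtain ⟨t, ht⟩ := this
  refine ⟨t, fun p => ?_⟩
  rw [map_prod] at ht
  have := Finset.prod_ne_zero_iff.1 ht p (Finset.mem_univ p)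
  simpa only [F, Finsupp.sum, map_sum, bv_eval_monomial] using this

open Matrix in
lemma bv_cycle_eig {m : ℕ} [NeZero m] (F : ZMod m → ℂ) (hF : ∀ p, F p ≠ 0) (l : ℂ)
    (hl : l ^ m = ∏ i ∈ Finset.range m, F i) :
    ∃ v : ZMod m → ℂ, v ≠ 0 ∧
      (Matrix.of fun p q : ZMod m => if q = p + 1 then F p else 0) *ᵥ v = l • v := by
  let u : ℕ → ℂ := fun k => ∏ i ∈ Finset.range k, (l / F i)
  have hum : u m = 1 := by
    simp only [u, Finset.prod_div_distrib, Finset.prod_const, Finset.card_range]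
    rw [hl, div_self]
    exact Finset.prod_ne_zero_iff.2 fun i _ => hF _
  have hstep : ∀ p : ZMod m, u (p + 1).val = u (p.val + 1) := by
    intro p
    have hp := ZMod.val_lt p
    rcases Nat.lt_or_ge (p.val + 1) m with h | h
    · congr 1
      have h2 : ((p.val + 1 : ℕ) : ZMod m) = p + 1 := by simp
      rw [← h2, ZMod.val_natCast_of_lt h]
    · have h1 : p.val + 1 = m := by omega
      have h2 : ((p.val + 1 : ℕ) : ZMod m) = p + 1 := by simp
      rw [← h2, h1, hum]
      simp [u]
  refine ⟨fun p => u p.val, ?_, ?_⟩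
  · intro h
    have := congrFun h 0
    simp [u] at this
  · ext p
    simp only [Matrix.mulVec, dotProduct, Matrix.of_apply, ite_mul, zero_mul, Finset.sum_ite_eq',
      Finset.mem_univ, if_true, Pi.smul_apply, smul_eq_mul, hstep]
    simp only [u, Finset.prod_range_succ]
    have := hF p
    simp only [ZMod.natCast_val, ZMod.cast_id', id_eq]
    field_simp

lemma bv_cycle_good {m d : ℕ} [NeZero m] (e : ZMod m) (he : (d : ZMod m) * e = 1) (hdm : d ≤ m)
    (c : List ℕ →₀ ℂ) (hc : ∀ w ∈ c.support, w.length = d) (hc0 : c ≠ 0) :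
    BVGood c (Fin m) := by
  obtain ⟨t, ht⟩ := bv_exists_t e he hdm c hc hc0
  set F : ZMod m → ℂ := fun p => c.sum fun w x => x * bvWt e t p w with hF
  have hev : bvEv c (bvShift e t) = Matrix.of fun p q : ZMod m => if q = p + 1 then F p else 0 := by
    ext p q
    simp only [bvEv, Finsupp.sum, Matrix.sum_apply, Matrix.smul_apply, bvShift_word, Matrix.of_apply,
      hF]
    rw [Finset.sum_congr rfl (fun w hw => by rw [hc w hw, he])]
    split_ifs <;> simp
  have hm : 0 < m := Nat.pos_of_ne_zero (NeZero.ne m)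
  obtain ⟨l, hl⟩ := IsAlgClosed.exists_pow_nat_eq (∏ i ∈ Finset.range m, F i) hm
  have hl0 : l ≠ 0 := by
    rintro rfl
    rw [zero_pow hm.ne'] at hl
    exact (Finset.prod_ne_zero_iff.2 fun (i : ℕ) _ => ht (i : ZMod m)) hl.symm
  have hz := Complex.isPrimitiveRoot_exp m hm.ne'
  set z := Complex.exp (2 * Real.pi * Complex.I / m)
  let u : ZMod m → ℂ := fun k => l * z ^ k.val
  have hu : Function.Injective u := by
    intro j k hjk
    have := mul_left_cancel₀ hl0 hjk
    exact ZMod.val_injective m (hz.pow_inj (ZMod.val_lt _) (ZMod.val_lt _) this)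
  have hu0 : ∀ k, u k ≠ 0 := fun k => mul_ne_zero hl0 (pow_ne_zero _ (hz.ne_zero hm.ne'))
  choose v hv hv' using fun k => bv_cycle_eig F ht (u k) (by
    simp only [u]
    rw [mul_pow, hl, ← pow_mul, mul_comm k.val, pow_mul, hz.pow_eq_one, one_pow, mul_one])
  have hconj := bv_conj_diag _ u hu v hv hv'
  rw [← hev] at hconj
  obtain ⟨b, hb⟩ := bvEv_conj c _ _ hconj.symm
  have : BVGood c (ZMod m) := ⟨b, u, hu, hu0, hb⟩
  exact this.reindex (Fintype.equivFinOfCardEq (ZMod.card m))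

lemma bv_homog {d : ℕ} (hd : 0 < d)
    (c : List ℕ →₀ ℂ) (hc : ∀ w ∈ c.support, w.length = d) (hc0 : c ≠ 0) (n : ℕ)
    (hn : (d + 1) * (2 * d + 1) ≤ n) : BVGood c (Fin n) := by
  have h1 : BVGood c (Fin (d + 1)) := by
    refine bv_cycle_good (-1) ?_ (by omega) c hc hc0
    have : ((d + 1 : ℕ) : ZMod (d + 1)) = 0 := ZMod.natCast_self _
    push_cast at this
    linear_combination - this
  have h2 : BVGood c (Fin (2 * d + 1)) := by
    refine bv_cycle_good (-2) ?_ (by omega) c hc hc0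
    have : ((2 * d + 1 : ℕ) : ZMod (2 * d + 1)) = 0 := ZMod.natCast_self _
    push_cast at this
    linear_combination - this
  -- n = q (d+1) + r = b (2d+1) + k (d+1) with b = d+1-r
  have hr := Nat.mod_lt n (Nat.succ_pos d)
  have hq := Nat.div_add_mod n (d + 1)
  set r := n % (d + 1)
  set q := n / (d + 1)
  obtain ⟨b, hb⟩ : ∃ b, b + r = d + 1 := ⟨d + 1 - r, by omega⟩
  have hqb : 2 * b ≤ q + 1 := by
    have : 2 * d + 1 ≤ q := by
      rw [Nat.le_div_iff_mul_le (Nat.succ_pos d)]; linarith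
    omega
  obtain ⟨k, hk⟩ : ∃ k, k + 2 * b = q + 1 := ⟨q + 1 - 2 * b, by omega⟩
  have hfin : k * (d + 1) + b * (2 * d + 1) = n := by
    zify at *
    rw [← hq]
    linear_combination (d + 1 : ℤ) * hk - hb
  rw [← hfin]
  exact (h1.mul hd hc k).add hd hc (h2.mul hd hc b)

open Matrix Polynomial in
lemma bv_aeval_mulVec {ι : Type*} [Fintype ι] [DecidableEq ι] (A : Matrix ι ι ℂ) (x : ℂ) (v : ι → ℂ)
    (h : A *ᵥ v = x • v) (p : ℂ[X]) : (aeval A p) *ᵥ v = (p.eval x) • v := by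
  induction p using Polynomial.induction_on' with
  | add p q hp hq => simp [Matrix.add_mulVec, hp, hq, add_smul]
  | monomial k r =>
    have hk : ∀ k : ℕ, (A ^ k) *ᵥ v = (x ^ k) • v := by
      intro k
      induction k with
      | zero => simp
      | succ k ih =>
        rw [pow_succ, ← Matrix.mulVec_mulVec, h, Matrix.mulVec_smul, ih, smul_smul, pow_succ, mul_comm]
    rw [Polynomial.aeval_monomial, Polynomial.eval_monomial, ← Algebra.smul_def, Matrix.smul_mulVec,
      hk, smul_smul]

open Matrix Polynomial in
/-- if the derivative of the charpoly at A is invertible then `A` has distinct eigenvalues -/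
lemma bv_distinct {n : ℕ} (A : Matrix (Fin n) (Fin n) ℂ)
    (h : (aeval A (derivative A.charpoly)).det ≠ 0) :
    ∃ d : Fin n → ℂ, Function.Injective d ∧ IsConj (diagonal d) A := by
  have hnd : A.charpoly.roots.Nodup := by
    rw [Multiset.nodup_iff_count_le_one]
    intro x
    rw [Polynomial.count_roots]
    by_contra! hlt
    rw [Polynomial.one_lt_rootMultiplicity_iff_isRoot A.charpoly_monic.ne_zero] at hlt
    obtain ⟨v, hv, hv'⟩ := bv_exists_eigvec A x hlt.1
    apply h
    rw [← Matrix.exists_mulVec_eq_zero_iff]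
    refine ⟨v, hv, ?_⟩
    rw [bv_aeval_mulVec A x v hv', hlt.2.eq_zero, zero_smul]
  have hcard : A.charpoly.roots.toList.length = n := by
    rw [Multiset.length_toList, IsAlgClosed.card_roots_eq_natDegree, Matrix.charpoly_natDegree_eq_dim]
    simp
  have hnd' : A.charpoly.roots.toList.Nodup := by
    rwa [← Multiset.coe_nodup, Multiset.coe_toList]
  refine ⟨fun i => A.charpoly.roots.toList.get (Fin.cast hcard.symm i), ?_, ?_⟩
  · intro i j hij
    have := (List.nodup_iff_injective_get.1 hnd') hij
    simpa using this
  · apply bv_conj_diag'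
    · intro i j hij
      have := (List.nodup_iff_injective_get.1 hnd') hij
      simpa using this
    · intro i
      have : A.charpoly.roots.toList.get (Fin.cast hcard.symm i) ∈ A.charpoly.roots :=
        Multiset.mem_toList.1 (List.get_mem _ _)
      exact Polynomial.isRoot_of_mem_roots this

open Matrix Polynomial in
lemma bv_diag_disc {n : ℕ} (d : Fin n → ℂ) (hd : Function.Injective d) :
    (aeval (diagonal d) (derivative (diagonal d).charpoly)).det ≠ 0 := by
  intro h
  rw [← Matrix.exists_mulVec_eq_zero_iff] at h
  obtain ⟨v, hv, hv'⟩ := h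
  have hdiag : ∀ p : ℂ[X], aeval (diagonal d) p = diagonal (fun i => p.eval (d i)) := by
    intro p
    have := (Polynomial.aeval_algHom_apply (Matrix.diagonalAlgHom ℂ (n := Fin n) (α := ℂ)) d p)
    simp only [Matrix.diagonalAlgHom_apply] at this
    rw [this]
    congr 1
    ext i
    have h2 := Polynomial.aeval_algHom_apply (Pi.evalAlgHom ℂ (fun _ : Fin n => ℂ) i) d p
    refine h2.symm.trans ?_
    change aeval (d i) p = _
    rw [Polynomial.coe_aeval_eq_eval]
  rw [hdiag] at hv'
  apply hv
  ext i
  have h1 := congrFun hv' i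
  rw [Matrix.mulVec_diagonal] at h1
  rcases mul_eq_zero.1 h1 with h2 | h2
  · exfalso
    have hch : (diagonal d).charpoly = ∏ i, (X - C (d i)) := Matrix.charpoly_diagonal d
    have hsep : ((diagonal d).charpoly).Separable := by
      rw [hch]
      exact Polynomial.separable_prod_X_sub_C_iff.2 hd
    have hroot : ((diagonal d).charpoly).eval (d i) = 0 := by
      rw [hch, Polynomial.eval_prod]
      exact Finset.prod_eq_zero (Finset.mem_univ i) (by simp)
    obtain ⟨a, b, hab⟩ := hsep
    have := congrArg (Polynomial.eval (d i)) hab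
    simp [h2, hroot] at this
  · exact h2

open Matrix Polynomial in
lemma bv_perturb {n : ℕ} (G : Matrix (Fin n) (Fin n) ℂ[X]) (d : Fin n → ℂ) (hd : Function.Injective d)
    (h0 : (evalRingHom (0 : ℂ)).mapMatrix G = diagonal d) :
    ∃ s : ℂ, s ≠ 0 ∧ ∃ d' : Fin n → ℂ, Function.Injective d' ∧
      IsConj (diagonal d') ((evalRingHom s).mapMatrix G) := by
  let D : ℂ[X] := (aeval G (derivative G.charpoly)).det
  have hD : ∀ s : ℂ, D.eval s = (aeval ((evalRingHom s).mapMatrix G)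
      (derivative ((evalRingHom s).mapMatrix G).charpoly)).det := by
    intro s
    change evalRingHom s D = _
    simp only [D]
    rw [RingHom.map_det]
    congr 1
    rw [RingHom.mapMatrix_apply (evalRingHom s) G, Matrix.charpoly_map, Polynomial.derivative_map,
      ← RingHom.mapMatrix_apply]
    apply Polynomial.map_aeval_eq_aeval_map
    refine RingHom.ext fun x => ?_
    ext i j
    · by_cases hij : i = j
      · subst hij; simp [Matrix.algebraMap_matrix_apply]
      · simp [Matrix.algebraMap_matrix_apply, hij]
  have hD0 : D ≠ 0 := by
    intro h
    have := hD 0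
    rw [h0, h, Polynomial.eval_zero] at this
    exact bv_diag_disc d hd this.symm
  have hXD : X * D ≠ 0 := mul_ne_zero X_ne_zero hD0
  obtain ⟨s, hs⟩ : ∃ s : ℂ, (X * D).eval s ≠ 0 := by
    by_contra! hcon
    exact hXD (Polynomial.funext fun s => by rw [hcon s, Polynomial.eval_zero])
  rw [Polynomial.eval_mul, Polynomial.eval_X] at hs
  refine ⟨s, left_ne_zero_of_mul hs, bv_distinct _ ?_⟩
  rw [← hD]
  exact right_ne_zero_of_mul hs

open Matrix Polynomial in
lemma bv_main {c : List ℕ →₀ ℂ} (hc : ∃ w ∈ c.support, w ≠ []) :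
    ∃ N : ℕ, ∀ n, N ≤ n → ∃ (a : ℕ → Matrix (Fin n) (Fin n) ℂ) (d : Fin n → ℂ),
      Function.Injective d ∧ bvEv c a = diagonal d := by
  obtain ⟨w1, hw1, hw1n⟩ := hc
  obtain ⟨w0, hw0, hmax⟩ := Finset.exists_max_image c.support List.length ⟨w1, hw1⟩
  set k := w0.length with hk
  have hk0 : 0 < k := lt_of_lt_of_le (List.length_pos_iff.2 hw1n) (hmax w1 hw1)
  let c' := c.filter fun w => w.length = k
  have hc' : ∀ w ∈ c'.support, w.length = k := by
    intro w hw
    rw [Finsupp.support_filter] at hw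
    exact (Finset.mem_filter.1 hw).2
  have hcz : c' ≠ 0 := by
    intro h
    have : c' w0 = c w0 := Finsupp.filter_apply_pos _ _ rfl
    rw [h] at this
    exact (Finsupp.mem_support_iff.1 hw0) this.symm
  refine ⟨(k + 1) * (2 * k + 1), fun n hn => ?_⟩
  obtain ⟨a, d, hd, -, had⟩ := bv_homog hk0 c' hc' hcz n hn
  let G : Matrix (Fin n) (Fin n) ℂ[X] :=
    c.sum fun w x => (C x * X ^ (k - w.length)) • (C : ℂ →+* ℂ[X]).mapMatrix (w.map a).prod
  have hG : ∀ s : ℂ, (evalRingHom s).mapMatrix G =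
      c.sum fun w x => (x * s ^ (k - w.length)) • (w.map a).prod := by
    intro s
    simp only [G, Finsupp.sum, map_sum]
    apply Finset.sum_congr rfl
    intro w _
    ext i j
    simp
    ring
  have h0 : (evalRingHom (0 : ℂ)).mapMatrix G = diagonal d := by
    rw [hG, ← had, bvEv]
    simp only [Finsupp.sum, c', Finsupp.support_filter, Finset.sum_filter]
    apply Finset.sum_congr rfl
    intro w hw
    have := hmax w hw
    by_cases h : w.length = k
    · simp [h]
    · rw [zero_pow (by omega)]
      simp [h]
  obtain ⟨s, hs, d', hd', hconj⟩ := bv_perturb G d hd h0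
  rw [hG] at hconj
  -- rescale
  have hscale : bvEv c (fun i => s⁻¹ • a i) =
      (s⁻¹ ^ k) • (c.sum fun w x => (x * s ^ (k - w.length)) • (w.map a).prod) := by
    rw [bvEv_smul, Finsupp.smul_sum]
    apply Finsupp.sum_congr
    intro w hw
    rw [smul_smul]
    congr 1
    have := hmax w hw
    obtain ⟨r, hr⟩ := Nat.exists_eq_add_of_le this
    rw [hr, Nat.add_sub_cancel_left, pow_add, inv_pow, inv_pow]
    field_simp
  have hconj2 : IsConj (diagonal (fun i => s⁻¹ ^ k * d' i)) (bvEv c (fun i => s⁻¹ • a i)) := by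
    obtain ⟨P, hP⟩ := hconj
    refine ⟨P, ?_⟩
    have hP : (P : Matrix (Fin n) (Fin n) ℂ) * diagonal d' = _ * P := hP
    change (P : Matrix (Fin n) (Fin n) ℂ) * _ = _ * P
    rw [hscale, Matrix.smul_mul, ← hP, ← Matrix.mul_smul]
    congr 1
    ext i j
    by_cases hij : i = j
    · subst hij; simp
    · simp [hij]
  obtain ⟨b, hb⟩ := bvEv_conj c _ _ hconj2.symm
  refine ⟨b, _, ?_, hb⟩
  intro i j hij
  exact hd' (mul_left_cancel₀ (pow_ne_zero _ (inv_ne_zero hs)) hij)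

/-- Theorem of Brešar and Volčič: for every nonconstant noncommutative polynomial `f`
with complex coefficients, for all large enough `n` every trace-zero matrix in `Mₙ(ℂ)`
lies in `f(Mₙ(ℂ)) - f(Mₙ(ℂ))`. -/
theorem bresar_volcic_trace_zero
    (f : FreeAlgebra ℂ ℕ) (hf : ∀ c : ℂ, f ≠ algebraMap ℂ (FreeAlgebra ℂ ℕ) c) :
    ∃ N : ℕ, ∀ n : ℕ, N ≤ n →
      ∀ X : Matrix (Fin n) (Fin n) ℂ, X.trace = 0 →
        ∃ s t : Matrix (Fin n) (Fin n) ℂ,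
          (∃ a : ℕ → Matrix (Fin n) (Fin n) ℂ, FreeAlgebra.lift ℂ a f = s) ∧
          (∃ a : ℕ → Matrix (Fin n) (Fin n) ℂ, FreeAlgebra.lift ℂ a f = t) ∧
          X = s - t := by
  obtain ⟨c, rfl⟩ := bv_exists_coef f
  have hc : ∃ w ∈ c.support, w ≠ [] := by
    by_contra! hcon
    apply hf (c [])
    have hs : c.support ⊆ {[]} := fun w hw => by simp [hcon w hw]
    rw [bvEv, Finsupp.sum_of_support_subset c hs _ (by simp)]
    simp [Algebra.algebraMap_eq_smul_one]
  obtain ⟨N, hN⟩ := bv_main hc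
  refine ⟨N, fun n hn X hX => ?_⟩
  obtain ⟨a, d, hd, had⟩ := hN n hn
  obtain ⟨s, t, hs, ht, hst⟩ := bv_diff X hX d hd
  rw [← had] at hs ht
  obtain ⟨b, hb⟩ := bvEv_conj c _ _ hs
  obtain ⟨b', hb'⟩ := bvEv_conj c _ _ ht
  exact ⟨s, t, ⟨b, by rw [bv_lift, hb]⟩, ⟨b', by rw [bv_lift, hb']⟩, hst⟩
end

section
/- Let K be a quadratically closed field, i.e., every element of K is a square, and let f be a multilinear polynomial, i.e., f = Σ_{σ ∈ S_n} c_σ X_{σ(1)} ⋯ X_{σ(n)} with coefficients c_σ ∈ K. Then the image f(M₂(K)) = {f(a₁,…,a_n) | aᵢ ∈ M₂(K)} is a K-linear subspace of M₂(K), i.e., it is closed under addition and under multiplication by scalars and contains 0. -/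
/-- Evaluation of the multilinear (noncommutative) polynomial
`∑ σ ∈ Sₙ, c σ • X_{σ(1)} ⋯ X_{σ(n)}` at the tuple `a`. -/
noncomputable def mlinEval {K : Type*} [CommSemiring K] {A : Type*} [Semiring A]
    [Algebra K A] {n : ℕ} (c : Equiv.Perm (Fin n) → K) (a : Fin n → A) : A :=
  ∑ σ : Equiv.Perm (Fin n), c σ • (List.ofFn fun i => a (σ i)).prod

open Matrix

namespace LK

section general
variable {K : Type*} [Field K]

/-- The multilinear map underlying `mlinEval`. -/
noncomputable def ml {A : Type*} [Ring A] [Algebra K A] {n : ℕ} (c : Equiv.Perm (Fin n) → K) :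
    MultilinearMap K (fun _ : Fin n => A) A :=
  ∑ σ : Equiv.Perm (Fin n), c σ • (MultilinearMap.mkPiAlgebraFin K n A).domDomCongr σ

theorem ml_apply {A : Type*} [Ring A] [Algebra K A] {n : ℕ} (c : Equiv.Perm (Fin n) → K)
    (a : Fin n → A) : ml c a = mlinEval c a := by
  simp [ml, mlinEval]

theorem ml_map {A B : Type*} [Ring A] [Algebra K A] [Ring B] [Algebra K B] {n : ℕ}
    (c : Equiv.Perm (Fin n) → K) (φ : A →ₐ[K] B) (a : Fin n → A) :
    ml c (fun i => φ (a i)) = φ (ml c a) := by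
  rw [ml_apply, ml_apply]
  simp only [mlinEval, map_sum, map_smul, map_list_prod, List.map_ofFn]
  rfl

theorem ofFn_prod_mem {A : Type*} [Ring A] [Algebra K A] {G : Type*} [AddCommGroup G]
    (S : G → Submodule K A) (h1 : (1 : A) ∈ S 0)
    (hm : ∀ a b x y, x ∈ S a → y ∈ S b → x * y ∈ S (a + b)) :
    ∀ {n : ℕ} (d : Fin n → G) (x : Fin n → A), (∀ i, x i ∈ S (d i)) →
      (List.ofFn x).prod ∈ S (∑ i, d i) := by
  intro n
  induction n with
  | zero => intro d x _; simpa using h1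
  | succ n ih =>
    intro d x hx
    rw [List.ofFn_succ, List.prod_cons, Fin.sum_univ_succ]
    exact hm _ _ _ _ (hx 0) (ih _ _ fun i => hx i.succ)

theorem ml_mem {A : Type*} [Ring A] [Algebra K A] {G : Type*} [AddCommGroup G]
    (S : G → Submodule K A) (h1 : (1 : A) ∈ S 0)
    (hm : ∀ a b x y, x ∈ S a → y ∈ S b → x * y ∈ S (a + b))
    {n : ℕ} (c : Equiv.Perm (Fin n) → K) (d : Fin n → G) (x : Fin n → A)
    (hx : ∀ i, x i ∈ S (d i)) : ml c x ∈ S (∑ i, d i) := by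
  rw [ml_apply]
  refine Submodule.sum_mem _ fun σ _ => Submodule.smul_mem _ _ ?_
  rw [← Equiv.sum_comp σ d]
  exact ofFn_prod_mem S h1 hm _ _ fun i => hx _

variable {ι : Type*} [Fintype ι] [DecidableEq ι] {E : ι → Type*} [∀ i, AddCommGroup (E i)]
  [∀ i, Module K (E i)]

open Function in
/-- A common value in one coordinate. -/
theorem common_coord (T U : MultilinearMap K E K) (x y : ∀ i, E i) (hx : T x ≠ 0) (hy : U y ≠ 0)
    (i : ι) : ∃ z, T (update x i z) ≠ 0 ∧ U (update y i z) ≠ 0 := by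
  by_cases h1 : U (update y i (x i)) = 0
  · by_cases h2 : T (update x i (y i)) = 0
    · refine ⟨x i + y i, ?_, ?_⟩
      · rw [T.map_update_add, h2, update_eq_self, add_zero]; exact hx
      · rw [U.map_update_add, h1, update_eq_self, zero_add]; exact hy
    · exact ⟨y i, h2, by rwa [update_eq_self]⟩
  · exact ⟨x i, by rwa [update_eq_self], h1⟩

open Function in
theorem connected {α : Type*} (T : MultilinearMap K E K) (g : (∀ i, E i) → α)
    (h : ∀ x i z, T x ≠ 0 → T (update x i z) ≠ 0 → g (update x i z) = g x)
    (x y : ∀ i, E i) (hx : T x ≠ 0) (hy : T y ≠ 0) : g x = g y := by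
  suffices H : ∀ s : Finset ι, ∀ x y : ∀ i, E i, (∀ i, i ∉ s → x i = y i) → T x ≠ 0 → T y ≠ 0 →
      g x = g y from H Finset.univ x y (by simp) hx hy
  intro s
  induction s using Finset.induction_on with
  | empty =>
    intro x y hxy _ _
    have : x = y := funext fun i => hxy i (by simp)
    rw [this]
  | insert i s _ ih =>
    intro x y hxy hx hy
    obtain ⟨z, h1, h2⟩ := common_coord T T x y hx hy i
    rw [← h x i z hx h1, ← h y i z hy h2]
    refine ih _ _ (fun j hj => ?_) h1 h2
    by_cases hji : j = i
    · subst hji; simp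
    · rw [update_of_ne hji, update_of_ne hji]
      exact hxy j (by simp [hji, hj])

open Function in
theorem common_point (T U : MultilinearMap K E K) (x y : ∀ i, E i) (hx : T x ≠ 0) (hy : U y ≠ 0) :
    ∃ z, T z ≠ 0 ∧ U z ≠ 0 := by
  suffices H : ∀ s : Finset ι, ∀ x y : ∀ i, E i, (∀ i, i ∉ s → x i = y i) → T x ≠ 0 → U y ≠ 0 →
      ∃ z, T z ≠ 0 ∧ U z ≠ 0 from H Finset.univ x y (by simp) hx hy
  intro s
  induction s using Finset.induction_on with
  | empty =>
    intro x y hxy hx hy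
    have : x = y := funext fun i => hxy i (by simp)
    exact ⟨y, this ▸ hx, hy⟩
  | insert i s _ ih =>
    intro x y hxy hx hy
    obtain ⟨z, h1, h2⟩ := common_coord T U x y hx hy i
    refine ih _ _ (fun j hj => ?_) h1 h2
    by_cases hji : j = i
    · subst hji; simp
    · rw [update_of_ne hji, update_of_ne hji]
      exact hxy j (by simp [hji, hj])

open Function in
theorem ratio (T U : MultilinearMap K E K) (x y : ∀ i, E i) (hx : T x ≠ 0) (hy : T y ≠ 0)
    (hxy : U x * T y ≠ U y * T x) :
    ∃ p i z, T p * U (update p i z) - T (update p i z) * U p ≠ 0 := by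
  by_contra! H
  apply hxy
  have := connected T (fun p => U p / T p) (fun p i z hp hz => by
    have := H p i z
    rw [div_eq_div_iff hz hp]
    linear_combination this) x y hx hy

  rwa [div_eq_div_iff hx hy] at this

open Function in
theorem onto {M : Type*} [AddCommGroup M] [Module K M] (F : MultilinearMap K E M)
    (T U : M →ₗ[K] K) (x y : ∀ i, E i) (hx : T (F x) ≠ 0) (hy : T (F y) ≠ 0)
    (hxy : U (F x) * T (F y) ≠ U (F y) * T (F x)) (a b : K) :
    ∃ z, T (F z) = a ∧ U (F z) = b := by
  obtain ⟨p, i, z, h⟩ := ratio (T.compMultilinearMap F) (U.compMultilinearMap F) x y hx hy hxy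
  simp only [LinearMap.compMultilinearMap_apply] at h
  set D := T (F p) * U (F (update p i z)) - T (F (update p i z)) * U (F p) with hD
  refine ⟨update p i (((a * U (F (update p i z)) - b * T (F (update p i z))) / D) • p i
    + ((b * T (F p) - a * U (F p)) / D) • z), ?_, ?_⟩
  · rw [F.map_update_add, F.map_update_smul, F.map_update_smul, update_eq_self]
    simp only [map_add, map_smul, smul_eq_mul]
    field_simp
    rw [hD]; ring
  · rw [F.map_update_add, F.map_update_smul, F.map_update_smul, update_eq_self]
    simp only [map_add, map_smul, smul_eq_mul]
    field_simp
    rw [hD]; ring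

end general

section mat
variable {K : Type*} [Field K]

/-- Conjugation by an invertible matrix. -/
def conjHom (g g' : Matrix (Fin 2) (Fin 2) K) (h : g' * g = 1) (h' : g * g' = 1) :
    Matrix (Fin 2) (Fin 2) K →ₐ[K] Matrix (Fin 2) (Fin 2) K :=
  AlgHom.ofLinearMap
    { toFun := fun x => g * x * g'
      map_add' := fun x y => by rw [mul_add, add_mul]
      map_smul' := fun r x => by simp }
    (by simp [h'])
    (fun x y => by
      change g * (x * y) * g' = g * x * g' * (g * y * g')
      calc g * (x * y) * g' = g * x * 1 * y * g' := by noncomm_ring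
        _ = g * x * (g' * g) * y * g' := by rw [h]
        _ = _ := by noncomm_ring)

theorem conjHom_apply (g g' : Matrix (Fin 2) (Fin 2) K) (h : g' * g = 1) (h' : g * g' = 1)
    (x : Matrix (Fin 2) (Fin 2) K) : conjHom g g' h h' x = g * x * g' := rfl

/-- Grading of the matrices induced by weights of the coordinates. -/
def gr {G : Type*} [AddCommGroup G] (φ : Fin 2 → G) (k : G) :
    Submodule K (Matrix (Fin 2) (Fin 2) K) where
  carrier := {M | ∀ i j, M i j ≠ 0 → φ j - φ i = k}
  add_mem' := by
    intro a b ha hb i j hij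
    by_cases h : a i j = 0
    · exact hb i j fun h' => hij (by simp [h, h'])
    · exact ha i j h
  zero_mem' := by intro i j h; simp at h
  smul_mem' := by
    intro r a ha i j hij
    exact ha i j fun h' => hij (by simp [h'])

theorem mem_gr {G : Type*} [AddCommGroup G] (φ : Fin 2 → G) (k : G)
    (M : Matrix (Fin 2) (Fin 2) K) : M ∈ gr φ k ↔ ∀ i j, M i j ≠ 0 → φ j - φ i = k := Iff.rfl

theorem gr_one {G : Type*} [AddCommGroup G] (φ : Fin 2 → G) :
    (1 : Matrix (Fin 2) (Fin 2) K) ∈ gr φ 0 := by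
  intro i j h
  by_cases hij : i = j
  · simp [hij]
  · exact absurd (Matrix.one_apply_ne hij) h

theorem gr_mul {G : Type*} [AddCommGroup G] (φ : Fin 2 → G) (a b : G)
    (x y : Matrix (Fin 2) (Fin 2) K) (hx : x ∈ gr φ a) (hy : y ∈ gr φ b) :
    x * y ∈ gr φ (a + b) := by
  intro i j h
  rw [Matrix.mul_apply] at h
  obtain ⟨l, -, hl⟩ := Finset.exists_ne_zero_of_sum_ne_zero h
  have h1 := hx i l (left_ne_zero_of_mul hl)
  have h2 := hy l j (right_ne_zero_of_mul hl)
  rw [← h1, ← h2]; abel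

/-- Integer weights. -/
def wz : Fin 2 → ℤ := ![0, 1]
/-- Weights mod two. -/
def w2 : Fin 2 → ZMod 2 := ![0, 1]

theorem gr_z_le (k : ℤ) (x : Matrix (Fin 2) (Fin 2) K) (hx : x ∈ gr wz k) :
    x ∈ gr w2 (k : ZMod 2) := by
  intro i j h
  rw [← hx i j h]
  fin_cases i <;> fin_cases j <;> simp [wz, w2]

/-- Homogeneous components. -/
def comp (x : Matrix (Fin 2) (Fin 2) K) : Fin 3 → Matrix (Fin 2) (Fin 2) K :=
  ![!![0, 0; x 1 0, 0], !![x 0 0, 0; 0, x 1 1], !![0, x 0 1; 0, 0]]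

theorem comp_sum (x : Matrix (Fin 2) (Fin 2) K) : ∑ j, comp x j = x := by
  ext i j
  fin_cases i <;> fin_cases j <;> simp [comp, Fin.sum_univ_three]

theorem comp_mem (x : Matrix (Fin 2) (Fin 2) K) (j : Fin 3) :
    comp x j ∈ gr wz ((j : ℕ) - 1 : ℤ) := by
  intro a b
  fin_cases j <;> fin_cases a <;> fin_cases b <;> simp [comp, wz]

/-- A nonvanishing functional of `f` does not vanish at some homogeneous tuple. -/
theorem exists_homog {n : ℕ} (F : MultilinearMap K (fun _ : Fin n => Matrix (Fin 2) (Fin 2) K) K)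
    (x : Fin n → Matrix (Fin 2) (Fin 2) K) (hx : F x ≠ 0) :
    ∃ (d : Fin n → ℤ) (w : Fin n → Matrix (Fin 2) (Fin 2) K),
      (∀ i, w i ∈ gr wz (d i)) ∧ F w ≠ 0 := by
  have h : F x = ∑ r : Fin n → Fin 3, F fun i => comp (x i) (r i) := by
    rw [← F.map_sum]; simp only [comp_sum]
  rw [h] at hx
  obtain ⟨r, -, hr⟩ := Finset.exists_ne_zero_of_sum_ne_zero hx
  exact ⟨_, _, fun i => comp_mem (x i) (r i), hr⟩

/-- The entry functional. -/
def ent (i j : Fin 2) : Matrix (Fin 2) (Fin 2) K →ₗ[K] K := Matrix.entryLinearMap K K i j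

@[simp] theorem ent_apply (i j : Fin 2) (M : Matrix (Fin 2) (Fin 2) K) : ent i j M = M i j := rfl

/-- A non-scalar matrix. -/
def NS (M : Matrix (Fin 2) (Fin 2) K) : Prop := M 0 1 ≠ 0 ∨ M 1 0 ≠ 0 ∨ M 0 0 ≠ M 1 1

theorem not_NS {M : Matrix (Fin 2) (Fin 2) K} (h : ¬ NS M) : M = M 0 0 • 1 := by
  simp only [NS, not_or, not_not] at h
  obtain ⟨h1, h2, h3⟩ := h
  ext i j
  fin_cases i <;> fin_cases j <;> simp [h1, h2, h3]

/-- Companion matrix. -/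
def cm (t d : K) : Matrix (Fin 2) (Fin 2) K := !![0, -d; 1, t]

theorem conj_cm_aux (M g : Matrix (Fin 2) (Fin 2) K) (hg : g.det ≠ 0)
    (h : M * g = g * cm M.trace M.det) :
    ∃ g g' : Matrix (Fin 2) (Fin 2) K, g' * g = 1 ∧ g * g' = 1 ∧
      M = g * cm M.trace M.det * g' := by
  have hu : IsUnit g.det := isUnit_iff_ne_zero.mpr hg
  refine ⟨g, g⁻¹, Matrix.nonsing_inv_mul g hu, Matrix.mul_nonsing_inv g hu, ?_⟩
  rw [← h, mul_assoc, Matrix.mul_nonsing_inv g hu, mul_one]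

theorem conj_cm {M : Matrix (Fin 2) (Fin 2) K} (h : NS M) :
    ∃ g g' : Matrix (Fin 2) (Fin 2) K, g' * g = 1 ∧ g * g' = 1 ∧
      M = g * cm M.trace M.det * g' := by
  have key : ∀ u v : K, u * (M 1 0 * u + M 1 1 * v) - (M 0 0 * u + M 0 1 * v) * v ≠ 0 →
      ∃ g g' : Matrix (Fin 2) (Fin 2) K, g' * g = 1 ∧ g * g' = 1 ∧
        M = g * cm M.trace M.det * g' := by
    intro u v huv
    refine conj_cm_aux M !![u, M 0 0 * u + M 0 1 * v; v, M 1 0 * u + M 1 1 * v] ?_ ?_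
    · rw [Matrix.det_fin_two_of]; exact huv
    · ext i j
      fin_cases i <;> fin_cases j <;>
        simp [Matrix.mul_apply, Fin.sum_univ_two, cm, Matrix.trace_fin_two, Matrix.det_fin_two] <;>
        ring
  by_cases h1 : M 1 0 = 0
  · by_cases h2 : M 0 1 = 0
    · have h3 : M 0 0 ≠ M 1 1 := by
        rcases h with h | h | h
        · exact absurd h2 h
        · exact absurd h1 h
        · exact h
      refine key 1 1 ?_
      rw [h1, h2]
      intro h; apply h3; linear_combination -h
    · refine key 0 1 ?_
      simpa using h2
  · refine key 1 0 ?_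
    simpa using h1

end mat

section image
variable {K : Type*} [Field K] {n : ℕ} (c : Equiv.Perm (Fin n) → K)

/-- Membership in the image. -/
def Im (M : Matrix (Fin 2) (Fin 2) K) : Prop :=
  ∃ a : Fin n → Matrix (Fin 2) (Fin 2) K, ml c a = M

variable {c}

theorem im_hom (φ : Matrix (Fin 2) (Fin 2) K →ₐ[K] Matrix (Fin 2) (Fin 2) K)
    {M : Matrix (Fin 2) (Fin 2) K} (h : Im c M) : Im c (φ M) := by
  obtain ⟨a, rfl⟩ := h
  exact ⟨_, ml_map c φ a⟩

theorem im_smul (hn : 1 ≤ n) (r : K) {M : Matrix (Fin 2) (Fin 2) K} (h : Im c M) :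
    Im c (r • M) := by
  obtain ⟨a, rfl⟩ := h
  refine ⟨Function.update a ⟨0, hn⟩ (r • a ⟨0, hn⟩), ?_⟩
  rw [MultilinearMap.map_update_smul, Function.update_eq_self]

theorem im_similar {M N : Matrix (Fin 2) (Fin 2) K} (hM : NS M) (hN : NS N)
    (ht : M.trace = N.trace) (hd : M.det = N.det) (h : Im c M) : Im c N := by
  obtain ⟨g, g', h1, h2, h3⟩ := conj_cm hM
  obtain ⟨k, k', k1, k2, k3⟩ := conj_cm hN
  have h4 : Im c (cm M.trace M.det) := by
    have := im_hom (conjHom g' g h2 h1) h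
    rw [conjHom_apply] at this
    have e : g' * M * g = cm M.trace M.det := by
      conv_lhs => rw [h3]
      calc g' * (g * cm M.trace M.det * g') * g = (g' * g) * cm M.trace M.det * (g' * g) := by
            noncomm_ring
        _ = _ := by rw [h1]; simp
    rwa [e] at this
  rw [ht, hd] at h4
  have := im_hom (conjHom k k' k1 k2) h4
  rwa [conjHom_apply, ← k3] at this

/-- Conjugation by the swap of coordinates. -/
def swp : Matrix (Fin 2) (Fin 2) K →ₐ[K] Matrix (Fin 2) (Fin 2) K :=
  conjHom !![0, 1; 1, 0] !![0, 1; 1, 0] (by simp [Matrix.one_fin_two]) (by simp [Matrix.one_fin_two])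

theorem swp_eq (M : Matrix (Fin 2) (Fin 2) K) : swp M = !![M 1 1, M 1 0; M 0 1, M 0 0] := by
  rw [swp, conjHom_apply]
  ext i j
  fin_cases i <;> fin_cases j <;>
    simp [Matrix.mul_apply, Fin.sum_univ_two, Matrix.vecMul, dotProduct]

theorem swp_mem (k : ZMod 2) (M : Matrix (Fin 2) (Fin 2) K) (h : M ∈ gr w2 k) :
    swp M ∈ gr w2 k := by
  rw [swp_eq]
  have h00 := h 0 0
  have h01 := h 0 1
  have h10 := h 1 0
  have h11 := h 1 1
  intro i j
  fin_cases i <;> fin_cases j <;> simp_all [w2]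

/-- Conjugation by an upper unipotent matrix. -/
def unip : Matrix (Fin 2) (Fin 2) K →ₐ[K] Matrix (Fin 2) (Fin 2) K :=
  conjHom !![1, 1; 0, 1] !![1, -1; 0, 1] (by simp [Matrix.one_fin_two])
    (by simp [Matrix.one_fin_two])

theorem unip_01 (M : Matrix (Fin 2) (Fin 2) K) :
    unip M 0 1 = M 0 1 + M 1 1 - M 0 0 - M 1 0 := by
  rw [unip, conjHom_apply]
  simp [Matrix.mul_apply, Fin.sum_univ_two, Matrix.vecMul, dotProduct]; ring

theorem unip_00 (M : Matrix (Fin 2) (Fin 2) K) :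
    unip M 0 0 = M 0 0 + M 1 0 := by
  rw [unip, conjHom_apply]
  simp [Matrix.mul_apply, Fin.sum_univ_two, Matrix.vecMul, dotProduct]

theorem exists_01 (h : ∃ x, Im c x ∧ NS x) : ∃ x, Im c x ∧ x 0 1 ≠ 0 := by
  by_contra! H
  obtain ⟨x, hx, hns⟩ := h
  have h1 := H x hx
  have h2 := H _ (im_hom swp hx)
  have h3 := H _ (im_hom unip hx)
  rw [swp_eq] at h2
  rw [unip_01] at h3
  simp at h2
  rcases hns with h | h | h
  · exact h h1
  · exact h h2
  · apply h; linear_combination -h3 + h1 - h2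

theorem exists_w (h : ∃ x, Im c x ∧ NS x) :
    ∃ (d : Fin n → ℤ) (w : Fin n → Matrix (Fin 2) (Fin 2) K),
      (∀ i, w i ∈ gr wz (d i)) ∧ ∑ i, d i = 1 ∧ (ml c w) 0 1 ≠ 0 ∧ (ml c w) 1 0 = 0 ∧
      (ml c w) 0 0 = 0 ∧ (ml c w) 1 1 = 0 := by
  obtain ⟨_, ⟨x, rfl⟩, hx⟩ := exists_01 h
  obtain ⟨d, w, hw, hne⟩ := exists_homog ((ent 0 1).compMultilinearMap (ml c)) x hx
  have hm := ml_mem (gr wz) (gr_one wz) (gr_mul wz) c d w hw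
  have hne : (ml c w) 0 1 ≠ 0 := hne
  have hs : ∑ i, d i = 1 := by rw [← hm 0 1 hne]; simp [wz]
  rw [hs] at hm
  refine ⟨d, w, hw, hs, hne, ?_, ?_, ?_⟩
  · by_contra h; have := hm _ _ h; simp [wz] at this
  · by_contra h; have := hm _ _ h; simp [wz] at this
  · by_contra h; have := hm _ _ h; simp [wz] at this

open Function in
theorem odd_facts (h : ∃ x, Im c x ∧ NS x) :
    (∃ A, Im c A ∧ A 0 0 = 0 ∧ A 1 1 = 0 ∧ A 0 1 ≠ 0 ∧ A 1 0 ≠ 0) ∧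
    ∃ (x : Fin n → Matrix (Fin 2) (Fin 2) K) (i : Fin n) (z : Matrix (Fin 2) (Fin 2) K),
      (ml c x) 0 0 = 0 ∧ (ml c x) 1 1 = 0 ∧ (ml c (update x i z)) 0 0 = 0 ∧
      (ml c (update x i z)) 1 1 = 0 ∧
      (ml c x) 0 1 * (ml c (update x i z)) 1 0 - (ml c (update x i z)) 0 1 * (ml c x) 1 0 ≠ 0 := by
  obtain ⟨d, w, hw, hs, h01, h10, -, -⟩ := exists_w h
  let E : Fin n → Type _ := fun i => (gr w2 (d i : ZMod 2) : Submodule K (Matrix (Fin 2) (Fin 2) K))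
  let F : MultilinearMap K E (Matrix (Fin 2) (Fin 2) K) :=
    (ml c).compLinearMap fun i => (gr w2 (d i : ZMod 2)).subtype
  have hF : ∀ x : ∀ i, E i, F x = ml c (fun i => (x i).1) := fun x => rfl
  have hF1 : ∀ x : ∀ i, E i, F x ∈ gr w2 1 := by
    intro x
    have := ml_mem (gr w2) (gr_one w2) (gr_mul w2) c (fun i => (d i : ZMod 2)) (fun i => (x i).1)
      (fun i => (x i).2)
    rw [← Int.cast_sum, hs, Int.cast_one] at this
    exact this
  have h00 : ∀ x : ∀ i, E i, (F x) 0 0 = 0 := by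
    intro x; by_contra h; have := hF1 x _ _ h; simp [w2] at this
  have h11 : ∀ x : ∀ i, E i, (F x) 1 1 = 0 := by
    intro x; by_contra h; have := hF1 x _ _ h; simp [w2] at this
  let w' : ∀ i, E i := fun i => ⟨w i, gr_z_le _ _ (hw i)⟩
  let v' : ∀ i, E i := fun i => ⟨swp (w i), swp_mem _ _ (gr_z_le _ _ (hw i))⟩
  have hv : F v' = swp (ml c w) := ml_map c swp w
  obtain ⟨y, hy1, hy2⟩ := common_point ((ent 0 1).compMultilinearMap F)
    ((ent 1 0).compMultilinearMap F) w' v' h01 (by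
      rw [LinearMap.compMultilinearMap_apply, hv, swp_eq]; simpa using h01)
  refine ⟨⟨F y, ⟨_, rfl⟩, h00 y, h11 y, hy1, hy2⟩, ?_⟩
  obtain ⟨p, i, z, hpz⟩ := ratio ((ent 0 1).compMultilinearMap F)
    ((ent 1 0).compMultilinearMap F) w' y h01 hy1 (by
      have h3 : ((ent 1 0).compMultilinearMap F) w' = 0 := h10
      rw [h3, zero_mul]
      exact (mul_ne_zero hy2 h01).symm)
  have hu : F (update p i z) = ml c (update (fun i => (p i).1) i z.1) := by
    rw [hF]; congr 1; funext k
    exact Function.apply_update (fun i (x : E i) => x.1) p i z k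
  refine ⟨fun i => (p i).1, i, z.1, h00 p, h11 p, ?_, ?_, ?_⟩
  · rw [← hu]; exact h00 _
  · rw [← hu]; exact h11 _
  · rw [← hu]; exact hpz

/-- All non-scalar traceless matrices are in the image. -/
theorem traceless (hquad : ∀ a : K, ∃ b : K, b ^ 2 = a) (hn : 1 ≤ n)
    (h : ∃ x, Im c x ∧ NS x) (M : Matrix (Fin 2) (Fin 2) K) (hM : NS M) (ht : M.trace = 0) :
    Im c M := by
  by_cases hd : M.det = 0
  · obtain ⟨d, w, -, -, h01, h10, h00, h11⟩ := exists_w h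
    refine im_similar (Or.inl h01) hM ?_ ?_ ⟨w, rfl⟩
    · rw [ht, Matrix.trace_fin_two, h00, h11, add_zero]
    · rw [hd, Matrix.det_fin_two, h00, h10]; ring
  · obtain ⟨⟨A, hA, h00, h11, h01, h10⟩, -⟩ := odd_facts h
    obtain ⟨r, hr⟩ := hquad (-M.det / (A 0 1 * A 1 0))
    have hp : A 0 1 * A 1 0 ≠ 0 := mul_ne_zero h01 h10
    have hr0 : r ≠ 0 := by
      rintro rfl
      rw [eq_div_iff hp] at hr
      apply hd; linear_combination hr
    refine im_similar (M := r • A) (Or.inl ?_) hM ?_ ?_ (im_smul hn r hA)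
    · simpa using ⟨hr0, h01⟩
    · rw [ht, Matrix.trace_smul, Matrix.trace_fin_two, h00, h11]; simp
    · rw [Matrix.det_fin_two]
      simp only [Matrix.smul_apply, smul_eq_mul, h00, h11]
      rw [eq_div_iff hp] at hr
      linear_combination -hr

end image

section two
variable {K : Type*} [Field K] {n : ℕ} {c : Equiv.Perm (Fin n) → K}

/-- In characteristic two, the grading attached to a quadratic separable subalgebra. -/
def qd (t d : K) : ZMod 2 → Submodule K (Matrix (Fin 2) (Fin 2) K) := fun k =>
  if k = 0 then
    { carrier := {M | M 0 1 = d * M 1 0 ∧ M 1 1 = M 0 0 + t * M 1 0}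
      add_mem' := by
        rintro a b ⟨h1, h2⟩ ⟨h3, h4⟩
        constructor
        · simp only [Matrix.add_apply]; rw [h1, h3]; ring
        · simp only [Matrix.add_apply]; rw [h2, h4]; ring
      zero_mem' := by simp
      smul_mem' := by
        rintro r a ⟨h1, h2⟩
        constructor
        · simp only [Matrix.smul_apply, smul_eq_mul]; rw [h1]; ring
        · simp only [Matrix.smul_apply, smul_eq_mul]; rw [h2]; ring }
  else
    { carrier := {M | M 0 1 = t * M 0 0 + d * M 1 0 ∧ M 1 1 = M 0 0}
      add_mem' := by
        rintro a b ⟨h1, h2⟩ ⟨h3, h4⟩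
        constructor
        · simp only [Matrix.add_apply]; rw [h1, h3]; ring
        · simp only [Matrix.add_apply]; rw [h2, h4]
      zero_mem' := by simp
      smul_mem' := by
        rintro r a ⟨h1, h2⟩
        constructor
        · simp only [Matrix.smul_apply, smul_eq_mul]; rw [h1]; ring
        · simp only [Matrix.smul_apply, smul_eq_mul]; rw [h2] }

theorem mem_qd0 (t d : K) (M : Matrix (Fin 2) (Fin 2) K) :
    M ∈ qd t d 0 ↔ M 0 1 = d * M 1 0 ∧ M 1 1 = M 0 0 + t * M 1 0 := by
  simp only [qd, if_true]; rfl

theorem mem_qd1 (t d : K) (M : Matrix (Fin 2) (Fin 2) K) :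
    M ∈ qd t d 1 ↔ M 0 1 = t * M 0 0 + d * M 1 0 ∧ M 1 1 = M 0 0 := by
  simp only [qd, one_ne_zero, if_false]; rfl

theorem qd_one (t d : K) : (1 : Matrix (Fin 2) (Fin 2) K) ∈ qd t d 0 := by
  rw [mem_qd0]; simp

theorem zmod2_cases (k : ZMod 2) : k = 0 ∨ k = 1 := by
  revert k; decide

theorem qd_mul (h2 : (2 : K) = 0) (t d : K) (a b : ZMod 2)
    (x y : Matrix (Fin 2) (Fin 2) K) (hx : x ∈ qd t d a) (hy : y ∈ qd t d b) :
    x * y ∈ qd t d (a + b) := by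
  rcases zmod2_cases a with rfl | rfl <;> rcases zmod2_cases b with rfl | rfl
  · rw [add_zero]
    rw [mem_qd0] at *
    simp only [Matrix.mul_apply, Fin.sum_univ_two]
    obtain ⟨h1, h3⟩ := hx
    obtain ⟨h4, h5⟩ := hy
    rw [h1, h3, h4, h5]
    constructor <;> ring
  · rw [zero_add]
    rw [mem_qd0] at hx
    rw [mem_qd1] at *
    simp only [Matrix.mul_apply, Fin.sum_univ_two]
    obtain ⟨h1, h3⟩ := hx
    obtain ⟨h4, h5⟩ := hy
    rw [h1, h3, h4, h5]
    constructor
    · linear_combination (-t * d * x 1 0 * y 1 0) * h2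
    · linear_combination (t * x 1 0 * y 0 0) * h2
  · rw [add_zero]
    rw [mem_qd0] at hy
    rw [mem_qd1] at *
    simp only [Matrix.mul_apply, Fin.sum_univ_two]
    obtain ⟨h1, h3⟩ := hx
    obtain ⟨h4, h5⟩ := hy
    rw [h1, h3, h4, h5]
    constructor
    · ring
    · ring
  · have : (1 : ZMod 2) + 1 = 0 := by decide
    rw [this]
    rw [mem_qd1] at hx hy
    rw [mem_qd0] at *
    simp only [Matrix.mul_apply, Fin.sum_univ_two]
    obtain ⟨h1, h3⟩ := hx
    obtain ⟨h4, h5⟩ := hy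
    rw [h1, h3, h4, h5]
    constructor
    · linear_combination (t * x 0 0 * y 0 0) * h2
    · linear_combination (-t * x 0 0 * y 1 0) * h2

/-- Conjugation by the involution exchanging the eigenvalues. -/
def jc (h2 : (2 : K) = 0) (t : K) : Matrix (Fin 2) (Fin 2) K →ₐ[K] Matrix (Fin 2) (Fin 2) K :=
  conjHom !![1, t; 0, 1] !![1, t; 0, 1]
    (by
      have : t + t = 0 := by linear_combination t * h2
      simp [Matrix.one_fin_two, this])
    (by
      have : t + t = 0 := by linear_combination t * h2
      simp [Matrix.one_fin_two, this])

theorem jc_eq (h2 : (2 : K) = 0) (t : K) (M : Matrix (Fin 2) (Fin 2) K) :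
    jc h2 t M = !![M 0 0 + t * M 1 0, (M 0 0 + t * M 1 0) * t + M 0 1 + t * M 1 1;
      M 1 0, M 1 0 * t + M 1 1] := by
  rw [jc, conjHom_apply]
  ext i j
  fin_cases i <;> fin_cases j <;>
    simp [Matrix.mul_apply, Fin.sum_univ_two, Matrix.vecMul, dotProduct] <;> ring

theorem jc_mem (h2 : (2 : K) = 0) (t d : K) (k : ZMod 2) (M : Matrix (Fin 2) (Fin 2) K)
    (h : M ∈ qd t d k) : jc h2 t M ∈ qd t d k := by
  rw [jc_eq]
  rcases zmod2_cases k with rfl | rfl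
  · rw [mem_qd0] at *
    obtain ⟨h3, h4⟩ := h
    simp
    rw [h3, h4]
    constructor
    · linear_combination (t * M 0 0 + t * t * M 1 0) * h2
    · ring
  · rw [mem_qd1] at *
    obtain ⟨h3, h4⟩ := h
    simp
    rw [h3, h4]
    constructor
    · linear_combination (t * M 0 0) * h2
    · ring

/-- Components for the grading `qd`. -/
def qc (t d : K) (x : Matrix (Fin 2) (Fin 2) K) : ZMod 2 → Matrix (Fin 2) (Fin 2) K := fun k =>
  if k = 0 then
    !![x 0 0 - (x 0 1 - d * x 1 0) / t, d * ((x 1 1 - x 0 0) / t);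
      (x 1 1 - x 0 0) / t, x 1 1 - (x 0 1 - d * x 1 0) / t]
  else
    !![(x 0 1 - d * x 1 0) / t, x 0 1 - d * ((x 1 1 - x 0 0) / t);
      x 1 0 - (x 1 1 - x 0 0) / t, (x 0 1 - d * x 1 0) / t]

theorem qc_sum (t d : K) (x : Matrix (Fin 2) (Fin 2) K) : ∑ j, qc t d x j = x := by
  have : (Finset.univ : Finset (ZMod 2)) = {0, 1} := by decide
  rw [this, Finset.sum_pair (by decide)]
  ext i j
  fin_cases i <;> fin_cases j <;> simp [qc]

theorem qc_mem (t d : K) (ht : t ≠ 0) (x : Matrix (Fin 2) (Fin 2) K) (j : ZMod 2) :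
    qc t d x j ∈ qd t d j := by
  rcases zmod2_cases j with rfl | rfl
  · rw [mem_qd0]
    simp [qc]
    field_simp
    ring
  · rw [mem_qd1]
    simp [qc]
    field_simp
    ring

theorem char_two_all (h2 : (2 : K) = 0) (hT : ∃ x, Im c x ∧ x.trace ≠ 0) (t d : K) (ht : t ≠ 0)
    (M : Matrix (Fin 2) (Fin 2) K) (hM : M ∈ qd t d 0) : Im c M := by
  obtain ⟨_, ⟨x, rfl⟩, hx⟩ := hT
  let T : Matrix (Fin 2) (Fin 2) K →ₗ[K] K := Matrix.traceLinearMap (Fin 2) K K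
  have hTa : ∀ M, T M = M.trace := fun M => rfl
  have hs : ml c x = ∑ r : Fin n → ZMod 2, ml c fun i => qc t d (x i) (r i) := by
    rw [← MultilinearMap.map_sum]; simp only [qc_sum]
  rw [← hTa, hs, map_sum] at hx
  obtain ⟨r, -, hr⟩ := Finset.exists_ne_zero_of_sum_ne_zero hx
  have hmem := ml_mem (qd t d) (qd_one t d) (qd_mul h2 t d) c r _
    (fun i => qc_mem t d ht (x i) (r i))
  have hsum : ∑ i, r i = 0 := by
    rcases zmod2_cases (∑ i, r i) with h | h
    · exact h
    · rw [h, mem_qd1] at hmem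
      exfalso; apply hr
      rw [hTa, Matrix.trace_fin_two, hmem.2]
      linear_combination (ml c (fun i => qc t d (x i) (r i)) 0 0) * h2
  let E : Fin n → Type _ := fun i => (qd t d (r i) : Submodule K (Matrix (Fin 2) (Fin 2) K))
  let F : MultilinearMap K E (Matrix (Fin 2) (Fin 2) K) :=
    (ml c).compLinearMap fun i => (qd t d (r i)).subtype
  have hF1 : ∀ x : ∀ i, E i, F x ∈ qd t d 0 := by
    intro x
    have := ml_mem (qd t d) (qd_one t d) (qd_mul h2 t d) c r (fun i => (x i).1)
      (fun i => (x i).2)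
    rw [hsum] at this
    exact this
  have hT0 : ∀ N ∈ qd t d 0, T N = t * N 1 0 := by
    intro N hN
    rw [mem_qd0] at hN
    rw [hTa, Matrix.trace_fin_two, hN.2]
    linear_combination (N 0 0) * h2
  let u : ∀ i, E i := fun i => ⟨_, qc_mem t d ht (x i) (r i)⟩
  let v : ∀ i, E i := fun i => ⟨_, jc_mem h2 t d _ _ (qc_mem t d ht (x i) (r i))⟩
  have hv : F v = jc h2 t (F u) := ml_map c (jc h2 t) _
  have hu : T (F u) ≠ 0 := hr
  have hvT : T (F v) = T (F u) := by
    rw [hT0 _ (hF1 v), hT0 _ (hF1 u), hv, jc_eq]; simp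
  have hvU : (F v) 0 0 = (F u) 0 0 + T (F u) := by
    rw [hT0 _ (hF1 u), hv, jc_eq]; simp
  obtain ⟨z, hz1, hz2⟩ := onto F T (ent 0 0) u v hu (by rw [hvT]; exact hu) (by
    rw [hvT, ent_apply, ent_apply, hvU]
    intro h
    apply mul_ne_zero hu hu
    linear_combination -h) (T M) (M 0 0)
  refine ⟨fun i => (z i).1, ?_⟩
  change F z = M
  have h3 := hF1 z
  rw [hT0 _ h3, hT0 _ hM] at hz1
  have h10 := mul_left_cancel₀ ht hz1
  rw [mem_qd0] at h3 hM
  rw [ent_apply] at hz2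
  ext i j
  fin_cases i <;> fin_cases j
  · exact hz2
  · simp only [Fin.mk_zero, Fin.mk_one, Fin.zero_eta]
    rw [h3.1, hM.1, h10]
  · exact h10
  · simp only [Fin.mk_one]
    rw [h3.2, hM.2, h10, hz2]

theorem char_two_top (h2 : (2 : K) = 0) (hT : ∃ x, Im c x ∧ x.trace ≠ 0)
    (M : Matrix (Fin 2) (Fin 2) K) (hM : M.trace ≠ 0) : Im c M := by
  have hns : NS M := by
    by_contra h
    have := not_NS h
    apply hM
    rw [this, Matrix.trace_fin_two]
    simp
    linear_combination (M 0 0) * h2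
  have hc : Im c (cm M.trace M.det) := by
    refine char_two_all h2 hT M.trace (-M.det) hM _ ?_
    rw [mem_qd0]; simp [cm]
  refine im_similar (M := cm M.trace M.det) ?_ hns ?_ ?_ hc
  · exact Or.inr (Or.inl (by simp [cm]))
  · simp [cm, Matrix.trace_fin_two]
  · simp [cm, Matrix.det_fin_two]

theorem char_two_one (hn : 1 ≤ n) (h2 : (2 : K) = 0) (h : ∃ x, Im c x ∧ NS x) :
    Im c (1 : Matrix (Fin 2) (Fin 2) K) := by
  by_cases hT : ∃ x, Im c x ∧ x.trace ≠ 0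
  · exact char_two_all h2 hT 1 0 one_ne_zero _ (qd_one _ _)
  · push Not at hT
    obtain ⟨x, hx, h01⟩ := exists_01 h
    have : ∃ y, Im c y ∧ y 0 0 ≠ 0 := by
      by_contra! H
      have h3 := H _ (im_hom swp hx)
      have h4 := H _ (im_hom unip (im_hom swp hx))
      rw [unip_00, h3, zero_add, swp_eq] at h4
      exact h01 (by simpa using h4)
    obtain ⟨_, ⟨y, rfl⟩, hy⟩ := this
    obtain ⟨d, w, hw, hne⟩ := exists_homog ((ent 0 0).compMultilinearMap (ml c)) y hy
    have hm := ml_mem (gr wz) (gr_one wz) (gr_mul wz) c d w hw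
    have hne : (ml c w) 0 0 ≠ 0 := hne
    have hs : ∑ i, d i = 0 := by rw [← hm 0 0 hne]; simp
    rw [hs] at hm
    have h10 : (ml c w) 1 0 = 0 := by
      by_contra h; have := hm _ _ h; simp [wz] at this
    have h01 : (ml c w) 0 1 = 0 := by
      by_contra h; have := hm _ _ h; simp [wz] at this
    have htr := hT _ ⟨w, rfl⟩
    rw [Matrix.trace_fin_two] at htr
    have hns : ¬ NS (ml c w) := by
      rintro (h | h | h)
      · exact h h01
      · exact h h10
      · apply h; linear_combination htr - (ml c w 1 1) * h2
    have := im_smul hn ((ml c w) 0 0)⁻¹ (⟨w, rfl⟩ : Im c (ml c w))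
    rw [not_NS hns, smul_smul] at this
    simpa [hne] using this

end two

section odd
variable {K : Type*} [Field K] {n : ℕ} {c : Equiv.Perm (Fin n) → K}

theorem ne_two_one (hn : 1 ≤ n) (hT : ∃ x, Im c x ∧ x.trace ≠ 0) :
    Im c (1 : Matrix (Fin 2) (Fin 2) K) := by
  obtain ⟨_, ⟨x, rfl⟩, hx⟩ := hT
  let T : Matrix (Fin 2) (Fin 2) K →ₗ[K] K := Matrix.traceLinearMap (Fin 2) K K
  have hTa : ∀ M, T M = M 0 0 + M 1 1 := fun M => Matrix.trace_fin_two M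
  obtain ⟨d, w, hw, hne⟩ := exists_homog (T.compMultilinearMap (ml c)) x hx
  have hne : T (ml c w) ≠ 0 := hne
  have hm := ml_mem (gr wz) (gr_one wz) (gr_mul wz) c d w hw
  have hs : ∑ i, d i = 0 := by
    by_contra hs
    apply hne
    rw [hTa]
    have h0 : (ml c w) 0 0 = 0 := by
      by_contra h; exact hs (by rw [← hm _ _ h]; simp)
    have h1 : (ml c w) 1 1 = 0 := by
      by_contra h; exact hs (by rw [← hm _ _ h]; simp)
    rw [h0, h1, add_zero]
  let E : Fin n → Type _ := fun i => (gr w2 (d i : ZMod 2) : Submodule K (Matrix (Fin 2) (Fin 2) K))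
  let F : MultilinearMap K E (Matrix (Fin 2) (Fin 2) K) :=
    (ml c).compLinearMap fun i => (gr w2 (d i : ZMod 2)).subtype
  have hF1 : ∀ x : ∀ i, E i, F x ∈ gr w2 0 := by
    intro x
    have := ml_mem (gr w2) (gr_one w2) (gr_mul w2) c (fun i => (d i : ZMod 2)) (fun i => (x i).1)
      (fun i => (x i).2)
    rw [← Int.cast_sum, hs, Int.cast_zero] at this
    exact this
  have h01 : ∀ x : ∀ i, E i, (F x) 0 1 = 0 := by
    intro x; by_contra h; have := hF1 x _ _ h; simp [w2] at this
  have h10 : ∀ x : ∀ i, E i, (F x) 1 0 = 0 := by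
    intro x; by_contra h; have := hF1 x _ _ h; simp [w2] at this
  have fin : ∀ z : ∀ i, E i, (F z) 0 0 = (F z) 1 1 → (F z) 0 0 ≠ 0 →
      Im c (1 : Matrix (Fin 2) (Fin 2) K) := by
    intro z hz hz0
    have hns : ¬ NS (F z) := by
      rintro (h | h | h)
      · exact h (h01 z)
      · exact h (h10 z)
      · exact h hz
    have := im_smul hn ((F z) 0 0)⁻¹ (⟨_, rfl⟩ : Im c (F z))
    rw [not_NS hns, smul_smul] at this
    simpa [hz0] using this
  let w' : ∀ i, E i := fun i => ⟨w i, gr_z_le _ _ (hw i)⟩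
  let v' : ∀ i, E i := fun i => ⟨swp (w i), swp_mem _ _ (gr_z_le _ _ (hw i))⟩
  have hv : F v' = swp (F w') := ml_map c swp w
  have hne : T (F w') ≠ 0 := hne
  by_cases heq : (F w') 0 0 = (F w') 1 1
  · refine fin w' heq ?_
    intro h0
    apply hne
    rw [hTa, ← heq, h0, add_zero]
  · have hvT : T (F v') = T (F w') := by
      rw [hv, swp_eq, hTa, hTa]; simp [add_comm]
    have hvU : (F v') 0 0 = (F w') 1 1 := by
      rw [hv, swp_eq]; simp
    have hpos : ∃ a b : K, a ≠ 0 ∧ b = a ∧ a + b = a + a := ⟨1, 1, one_ne_zero, rfl, rfl⟩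
    obtain ⟨z, hz1, hz2⟩ := onto F T (ent 0 0) w' v' hne (by rw [hvT]; exact hne) (by
      rw [hvT, ent_apply, ent_apply, hvU]
      intro h
      exact heq (mul_right_cancel₀ hne h)) (1 + 1) 1
    rw [ent_apply] at hz2
    rw [hTa, hz2] at hz1
    refine fin z ?_ (by rw [hz2]; exact one_ne_zero)
    rw [hz2]; linear_combination -hz1

/-- The discriminant of the characteristic polynomial on the pencil spanned by two matrices:
the linear coefficient. -/
def bb {R : Type*} [CommRing R] (A B : Matrix (Fin 2) (Fin 2) R) : R :=
  2 * ((A 0 0 - A 1 1) * (B 0 0 - B 1 1)) + 4 * (A 0 1 * B 1 0 + A 1 0 * B 0 1)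

/-- Discriminant of the characteristic polynomial. -/
def dd {R : Type*} [CommRing R] (A : Matrix (Fin 2) (Fin 2) R) : R :=
  (A 0 0 - A 1 1) ^ 2 + 4 * (A 0 1 * A 1 0)

/-- Discriminant of the discriminant. -/
def gg {R : Type*} [CommRing R] (A B : Matrix (Fin 2) (Fin 2) R) : R :=
  bb A B ^ 2 - 4 * dd A * dd B

theorem gg_map {R S : Type*} [CommRing R] [CommRing S] (φ : R →+* S)
    (A B : Matrix (Fin 2) (Fin 2) R) : gg (A.map φ) (B.map φ) = φ (gg A B) := by
  have e2 : φ 2 = 2 := map_ofNat φ 2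
  have e4 : φ 4 = 4 := map_ofNat φ 4
  simp [gg, bb, dd, e2, e4]

theorem infinite_of (hquad : ∀ a : K, ∃ b : K, b ^ 2 = a) (h2 : (2 : K) ≠ 0) : Infinite K := by
  by_contra hf
  rw [not_infinite_iff_finite] at hf
  have hs : Function.Surjective (fun a : K => a ^ 2) := hquad
  have hi := Finite.injective_iff_surjective.mpr hs
  have : (1 : K) = -1 := hi (by simp)
  apply h2; linear_combination this

open Function Polynomial in
theorem good_line [Infinite K] (h2 : (2 : K) ≠ 0) (hT : ∃ x, Im c x ∧ x.trace ≠ 0)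
    (h : ∃ x, Im c x ∧ NS x) :
    ∃ (x : Fin n → Matrix (Fin 2) (Fin 2) K) (i : Fin n) (z : Matrix (Fin 2) (Fin 2) K),
      (ml c x).trace ≠ 0 ∧ gg (ml c x) (ml c (update x i z)) ≠ 0 := by
  obtain ⟨_, ⟨y, rfl⟩, hy⟩ := hT
  obtain ⟨-, x, i, z, h1, h3, h4, h5, h6⟩ := odd_facts h
  let X' : Fin n → Matrix (Fin 2) (Fin 2) K[X] := fun k =>
    (x k).map C + (X : K[X]) • ((y k).map C - (x k).map C)
  let ev : K → (Matrix (Fin 2) (Fin 2) K[X] →ₐ[K] Matrix (Fin 2) (Fin 2) K) := fun r =>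
    (aeval r).mapMatrix
  have hev : ∀ r M, ev r M = M.map (aeval r : K[X] →ₐ[K] K).toRingHom := fun r M => rfl
  have hX : ∀ r k, ev r (X' k) = x k + r • (y k - x k) := by
    intro r k
    ext a b
    simp [hev, X']
  have hZ : ∀ r, ev r (z.map C) = z := by
    intro r; ext a b; simp [hev]
  have e1 : ∀ r, ev r (ml c X') = ml c (fun k => x k + r • (y k - x k)) := by
    intro r; rw [← ml_map]; simp only [hX]
  have e2 : ∀ r, ev r (ml c (update X' i (z.map C))) =
      ml c (update (fun k => x k + r • (y k - x k)) i z) := by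
    intro r; rw [← ml_map]; congr 1; funext k
    rw [Function.apply_update (fun _ => ev r)]
    simp only [hX, hZ]
  have t1 : ∀ r, (ml c (fun k => x k + r • (y k - x k))).trace = aeval r (ml c X').trace := by
    intro r
    rw [← e1, hev, Matrix.trace_fin_two, Matrix.trace_fin_two, map_add]; rfl
  have t2 : ∀ r, gg (ml c (fun k => x k + r • (y k - x k)))
      (ml c (update (fun k => x k + r • (y k - x k)) i z)) =
      aeval r (gg (ml c X') (ml c (update X' i (z.map C)))) := by
    intro r
    rw [← e1, ← e2, hev, hev, gg_map]; rfl
  have n1 : (ml c X').trace ≠ 0 := by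
    intro h0
    have := t1 1
    rw [h0, map_zero] at this
    apply hy
    simpa using this
  have n2 : gg (ml c X') (ml c (update X' i (z.map C))) ≠ 0 := by
    intro h0
    have := t2 0
    rw [h0, map_zero] at this
    simp only [zero_smul, add_zero] at this
    have e : gg (ml c x) (ml c (update x i z)) = 2 ^ 4 *
      ((ml c x) 0 1 * (ml c (update x i z)) 1 0 - (ml c (update x i z)) 0 1 * (ml c x) 1 0) ^ 2 := by
      simp only [gg, bb, dd, h1, h3, h4, h5]; ring
    have e' : gg (ml c x) (ml c (update x i z)) = 0 := this
    rw [e] at e'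
    exact mul_ne_zero (pow_ne_zero _ h2) (pow_ne_zero _ h6) e'
  obtain ⟨r, hr⟩ : ∃ r, eval r ((ml c X').trace * gg (ml c X') (ml c (update X' i (z.map C)))) ≠ 0 := by
    by_contra! H
    exact mul_ne_zero n1 n2 (Polynomial.funext fun r => by rw [H r, eval_zero])
  rw [eval_mul] at hr
  refine ⟨fun k => x k + r • (y k - x k), i, z, ?_, ?_⟩
  · rw [t1]; exact left_ne_zero_of_mul hr
  · rw [t2]; exact right_ne_zero_of_mul hr

theorem solve_quad (hquad : ∀ a : K, ∃ b : K, b ^ 2 = a) (h2 : (2 : K) ≠ 0) (p q r : K)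
    (h : q ^ 2 - 4 * p * r ≠ 0) (k : K) : ∃ s : K, p + q * s + r * s ^ 2 = k := by
  by_cases hr : r = 0
  · have hq : q ≠ 0 := by rintro rfl; apply h; rw [hr]; ring
    refine ⟨(k - p) / q, ?_⟩
    rw [hr]; field_simp; ring
  · obtain ⟨e, he⟩ := hquad (q ^ 2 - 4 * (p - k) * r)
    refine ⟨(e - q) / (2 * r), ?_⟩
    field_simp
    linear_combination he

open Function in
theorem ne_two_top (hquad : ∀ a : K, ∃ b : K, b ^ 2 = a) (hn : 1 ≤ n) (h2 : (2 : K) ≠ 0)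
    (hT : ∃ x, Im c x ∧ x.trace ≠ 0) (h : ∃ x, Im c x ∧ NS x)
    (M : Matrix (Fin 2) (Fin 2) K) (hM : M.trace ≠ 0) (hns : NS M) : Im c M := by
  haveI := infinite_of hquad h2
  obtain ⟨x, i, z, hx, hg⟩ := good_line h2 hT h
  set A := ml c x with hA
  set B := ml c (update x i z) with hB
  set N := B - (B.trace / A.trace) • A with hN
  have hcomb : ∀ s : K, Im c (A + s • N) := by
    intro s
    refine ⟨update x i ((1 - s * (B.trace / A.trace)) • x i + s • z), ?_⟩
    rw [MultilinearMap.map_update_add, MultilinearMap.map_update_smul,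
      MultilinearMap.map_update_smul, update_eq_self, ← hA, ← hB, hN]
    module
  have hNt : N.trace = 0 := by
    rw [hN, Matrix.trace_sub, Matrix.trace_smul, smul_eq_mul, div_mul_cancel₀ _ hx, sub_self]
  have hgN : gg A N ≠ 0 := by
    have : gg A N = gg A B := by
      rw [hN]
      simp only [gg, bb, dd, Matrix.sub_apply, Matrix.smul_apply, smul_eq_mul]
      ring
    rwa [this]
  have hdd : ∀ s, dd (A + s • N) = dd A + bb A N * s + dd N * s ^ 2 := by
    intro s
    simp only [bb, dd, Matrix.add_apply, Matrix.smul_apply, smul_eq_mul]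
    ring
  have hdet : ∀ Y : Matrix (Fin 2) (Fin 2) K, 4 * Y.det = Y.trace ^ 2 - dd Y := by
    intro Y
    rw [Matrix.det_fin_two, Matrix.trace_fin_two, dd]; ring
  obtain ⟨s, hs⟩ := solve_quad hquad h2 (dd A) (bb A N) (dd N) hgN
    (dd M * (A.trace / M.trace) ^ 2)
  have hm : M.trace / A.trace ≠ 0 := div_ne_zero hM hx
  have hnsA : NS (A + s • N) := by
    by_contra hh
    simp only [NS, not_or, not_not, Matrix.add_apply, Matrix.smul_apply, smul_eq_mul] at hh
    obtain ⟨k1, k2, k3⟩ := hh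
    apply hgN
    have a01 : A 0 1 = -(s * N 0 1) := by linear_combination k1
    have a10 : A 1 0 = -(s * N 1 0) := by linear_combination k2
    have a00 : A 0 0 = A 1 1 + s * N 1 1 - s * N 0 0 := by linear_combination k3
    simp only [gg, bb, dd, a01, a10, a00]
    ring
  have h4 : (4 : K) ≠ 0 := by
    have : (4 : K) = 2 * 2 := by norm_num
    rw [this]; exact mul_ne_zero h2 h2
  have htr : ((M.trace / A.trace) • (A + s • N)).trace = M.trace := by
    rw [Matrix.trace_smul, Matrix.trace_add, Matrix.trace_smul, hNt, smul_zero, add_zero,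
      smul_eq_mul, div_mul_cancel₀ _ hx]
  refine im_similar (M := (M.trace / A.trace) • (A + s • N)) ?_ hns htr ?_
    (im_smul hn _ (hcomb s))
  · rcases hnsA with h | h | h
    · left; rw [Matrix.smul_apply, smul_eq_mul]; exact mul_ne_zero hm h
    · right; left; rw [Matrix.smul_apply, smul_eq_mul]; exact mul_ne_zero hm h
    · right; right
      rw [Matrix.smul_apply, smul_eq_mul, Matrix.smul_apply, smul_eq_mul]
      intro h'; exact h (mul_left_cancel₀ hm h')
  · apply mul_left_cancel₀ h4
    rw [hdet, hdet, htr]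
    have : dd ((M.trace / A.trace) • (A + s • N)) = (M.trace / A.trace) ^ 2 * dd (A + s • N) := by
      simp only [dd, Matrix.smul_apply, smul_eq_mul]; ring
    rw [this, hdd, hs]
    field_simp

end odd

theorem scalar_im {K : Type*} [Field K] {n : ℕ} {c : Equiv.Perm (Fin n) → K} (hn : 1 ≤ n)
    (h1 : Im c (1 : Matrix (Fin 2) (Fin 2) K)) (M : Matrix (Fin 2) (Fin 2) K) (hM : ¬ NS M) :
    Im c M := by
  rw [not_NS hM]
  exact im_smul hn _ h1

theorem main {K : Type*} [Field K] (hquad : ∀ a : K, ∃ b : K, b ^ 2 = a)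
    {n : ℕ} (hn : 1 ≤ n) (c : Equiv.Perm (Fin n) → K) :
    ∃ V : Submodule K (Matrix (Fin 2) (Fin 2) K), ∀ x, Im c x ↔ x ∈ V := by
  have hzero : Im c (0 : Matrix (Fin 2) (Fin 2) K) := by
    have := im_smul hn 0 (⟨0, rfl⟩ : Im c (ml c 0))
    simpa using this
  by_cases h : ∃ x, Im c x ∧ NS x
  · by_cases hT : ∃ x, Im c x ∧ x.trace ≠ 0
    · refine ⟨⊤, fun M => ⟨fun _ => trivial, fun _ => ?_⟩⟩
      by_cases hns : NS M
      · by_cases hM : M.trace = 0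
        · exact traceless hquad hn h M hns hM
        · by_cases h2 : (2 : K) = 0
          · exact char_two_top h2 hT M hM
          · exact ne_two_top hquad hn h2 hT h M hM hns
      · exact scalar_im hn (ne_two_one hn hT) M hns
    · push Not at hT
      refine ⟨LinearMap.ker (Matrix.traceLinearMap (Fin 2) K K), fun M => ?_⟩
      rw [LinearMap.mem_ker, Matrix.traceLinearMap_apply]
      refine ⟨fun hM => hT M hM, fun hM => ?_⟩
      by_cases hns : NS M
      · exact traceless hquad hn h M hns hM
      · by_cases h2 : (2 : K) = 0
        · exact scalar_im hn (char_two_one hn h2 h) M hns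
        · have e := not_NS hns
          rw [e, Matrix.trace_smul, Matrix.trace_one, smul_eq_mul, Fintype.card_fin] at hM
          have h0 : M 0 0 = 0 := by
            rcases mul_eq_zero.mp hM with h | h
            · exact h
            · exact absurd (by exact_mod_cast h) h2
          rw [e, h0, zero_smul]; exact hzero
  · push Not at h
    by_cases h0 : ∀ x, Im c x → x = 0
    · refine ⟨⊥, fun M => ?_⟩
      rw [Submodule.mem_bot]
      exact ⟨h0 M, fun e => e ▸ hzero⟩
    · push Not at h0
      obtain ⟨x, hx, hx0⟩ := h0
      have e := not_NS (h x hx)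
      have h00 : x 0 0 ≠ 0 := by
        intro h'; apply hx0; rw [e, h', zero_smul]
      have h1 : Im c (1 : Matrix (Fin 2) (Fin 2) K) := by
        have := im_smul hn (x 0 0)⁻¹ hx
        rw [e, smul_smul] at this
        simpa [h00] using this
      refine ⟨Submodule.span K {1}, fun M => ?_⟩
      rw [Submodule.mem_span_singleton]
      constructor
      · intro hM
        exact ⟨_, (not_NS (h M hM)).symm⟩
      · rintro ⟨a, rfl⟩
        exact im_smul hn a h1

end LK

/-- Theorem of Kanel-Belov, Malev and Rowen (the L'vov–Kaplansky conjecture for `2×2`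
matrices): if `K` is a quadratically closed field and `f` is a multilinear polynomial,
then the image `f(M₂(K))` is a `K`-linear subspace of `M₂(K)`. -/
theorem lvov_kaplansky_two_by_two
    (K : Type*) [Field K] (hquad : ∀ a : K, ∃ b : K, b ^ 2 = a)
    (n : ℕ) (hn : 1 ≤ n) (c : Equiv.Perm (Fin n) → K) :
    ∃ V : Submodule K (Matrix (Fin 2) (Fin 2) K),
      {x : Matrix (Fin 2) (Fin 2) K |
        ∃ a : Fin n → Matrix (Fin 2) (Fin 2) K, x = mlinEval c a} = (V : Set _) := by
  obtain ⟨V, hV⟩ := LK.main hquad hn c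
  refine ⟨V, ?_⟩
  ext x
  rw [SetLike.mem_coe, ← hV x]
  constructor
  · rintro ⟨a, ha⟩
    exact ⟨a, by rw [LK.ml_apply, ha]⟩
  · rintro ⟨a, ha⟩
    exact ⟨a, by rw [← ha, LK.ml_apply]⟩
end

section
/- Let K be a commutative unital ring and n ≥ 2. Then every matrix in M_n(K) that is a sum of commutators [a,b] = ab − ba is a sum of two commutators (i.e., the commutator width of M_n(K) is at most 2). If moreover K is a principal ideal domain, then every matrix in M_n(K) that is a sum of commutators is itself a single commutator (i.e., the commutator width of M_n(K) is 1). -/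
open Matrix

namespace CW

def dsum {K : Type*} [CommRing K] (c : ℕ → ℕ → K) : ℕ → ℕ → K
  | 0, j => c 0 j
  | i+1, 0 => c (i+1) 0
  | i+1, j+1 => dsum c i j + c (i+1) (j+1)

/-- Part 1 core. -/
theorem shift_solve {K : Type*} [CommRing K] (n : ℕ) (c : ℕ → ℕ → K)
    (h : ∀ i, i < n + 1 → dsum c i n = 0) :
    ∃ P Q : Matrix (Fin (n+1)) (Fin (n+1)) K,
      (Matrix.of fun i j : Fin (n+1) => c i j) = P * Q - Q * P := by
  refine ⟨Matrix.of fun i j => if (i:ℕ) = j + 1 then 1 else 0,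
    Matrix.of fun i j => match (j:ℕ) with
      | 0 => 0
      | m+1 => - dsum c i m, ?_⟩
  ext ⟨i, hi⟩ ⟨j, hj⟩
  simp only [Matrix.sub_apply, Matrix.mul_apply, Matrix.of_apply, ite_mul, one_mul, zero_mul,
    mul_ite, mul_one, mul_zero]
  have h2 : (∑ l : Fin (n+1), if (l:ℕ) = j + 1 then (match (l:ℕ) with
      | 0 => (0:K)
      | m+1 => - dsum c i m) else 0) = if j + 1 < n + 1 then - dsum c i j else 0 := by
    split_ifs with hjn
    · rw [Finset.sum_eq_single ⟨j+1, hjn⟩]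
      · simp
      · intro b _ hb
        rw [if_neg]
        intro h; exact hb (Fin.ext h)
      · simp
    · apply Finset.sum_eq_zero
      intro b _
      rw [if_neg]; have := b.2; omega
  rw [h2]
  rcases i with _ | i
  · rw [Finset.sum_eq_zero]
    · split_ifs with hjn
      · simp [dsum]
      · have : j = n := by omega
        subst this
        simpa [dsum] using h 0 (by omega)
    · intro b _; simp
  · rw [Finset.sum_eq_single ⟨i, by omega⟩]
    · simp only [if_true]
      rcases j with _ | j
      · split_ifs with hjn
        · simp [dsum]
        · have : n = 0 := by omega
          omega
      · split_ifs with hjn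
        · simp only [dsum]; ring
        · have : j + 1 = n := by omega
          subst this
          have := h (i+1) (by omega)
          simp only [dsum] at this
          linear_combination this
    · intro b _ hb
      rw [if_neg]
      intro h; apply hb; ext; simp at h; simp [h]
    · simp

theorem dsum_sub_row {K : Type*} [CommRing K] (c : ℕ → ℕ → K) (b : ℕ → K) (i j : ℕ) (hij : i ≤ j) :
    dsum (fun i j => c i j - if i = 0 then b j else 0) i j = dsum c i j - b (j - i) := by
  induction i generalizing j with
  | zero => simp [dsum]
  | succ i ih =>
    rcases j with _ | j
    · omega
    · simp only [dsum]
      rw [ih j (by omega)]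
      simp; ring

theorem dsum_diag {K : Type*} [CommRing K] (c : ℕ → ℕ → K) (i : ℕ) :
    dsum c i i = ∑ k ∈ Finset.range (i+1), c k k := by
  induction i with
  | zero => simp [dsum]
  | succ i ih => rw [Finset.sum_range_succ, dsum, ih]

theorem two_comm {K : Type*} [CommRing K] (n : ℕ) (A : Matrix (Fin (n+1)) (Fin (n+1)) K)
    (hA : A.trace = 0) : ∃ a₁ b₁ a₂ b₂ : Matrix (Fin (n+1)) (Fin (n+1)) K,
        A = (a₁ * b₁ - b₁ * a₁) + (a₂ * b₂ - b₂ * a₂) := by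
  let c : ℕ → ℕ → K := fun i j => if h : i < n+1 ∧ j < n+1 then A ⟨i, h.1⟩ ⟨j, h.2⟩ else 0
  have hc : ∀ i j : Fin (n+1), c i j = A i j := by
    intro i j; exact dif_pos ⟨i.2, j.2⟩
  let b : ℕ → K := fun r => dsum c (n - r) n
  have hb0 : b 0 = 0 := by
    simp only [b, Nat.sub_zero, dsum_diag]
    rw [Finset.sum_range]
    simp only [hc]; exact hA
  obtain ⟨P, Q, hPQ⟩ := shift_solve n (fun i j => c i j - if i = 0 then b j else 0) (by
    intro i hi
    rw [dsum_sub_row _ _ _ _ (by omega)]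
    have : n - (n - i) = i := by omega
    simp [b, this])
  refine ⟨P, Q, Matrix.single 0 0 1, Matrix.of fun i j => if (i:ℕ) = 0 then b j else 0, ?_⟩
  rw [← hPQ]
  ext i j
  simp only [Matrix.add_apply, Matrix.sub_apply, Matrix.of_apply, hc, Matrix.mul_apply,
    Matrix.single_apply]
  rw [Finset.sum_eq_single 0, Finset.sum_eq_single 0]
  · by_cases hi : i = 0
    · subst hi
      by_cases hj : j = 0
      · subst hj; simp [hb0]
      · have : ¬ (0 = j) := fun h => hj h.symm
        simp [this]
    · have h2 : ¬ ((i:ℕ) = 0) := fun h => hi (Fin.ext h)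
      have h3 : ¬ (0 = i) := fun h => hi h.symm
      simp [h2, h3]
  · intro l _ hl
    have : ¬ (0 = l) := fun h => hl h.symm
    simp [this]
  · simp
  · intro l _ hl
    have : ¬ (0 = l) := fun h => hl h.symm
    simp [this]
  · simp

theorem trace_of_mem {K : Type*} [CommRing K] {n : ℕ} (X : Matrix (Fin n) (Fin n) K)
    (h : X ∈ AddSubgroup.closure {x : Matrix (Fin n) (Fin n) K | ∃ a b, x = a * b - b * a}) :
    X.trace = 0 := by
  have : AddSubgroup.closure {x : Matrix (Fin n) (Fin n) K | ∃ a b, x = a * b - b * a}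
      ≤ (Matrix.traceAddMonoidHom (Fin n) K).ker := by
    rw [AddSubgroup.closure_le]
    rintro x ⟨a, b, rfl⟩
    simp only [SetLike.mem_coe, AddMonoidHom.mem_ker, Matrix.traceAddMonoidHom_apply,
      Matrix.trace_sub]
    rw [Matrix.trace_mul_comm, sub_self]
  exact this h

/-! ### Arithmetic -/

theorem exists_split {K : Type*} [CommRing K] [IsDomain K] [IsPrincipalIdealRing K] (s q : K)
    (hq : q ≠ 0) : ∃ t, IsCoprime t s ∧ ∀ p, Prime p → p ∣ q → p ∣ t ∨ p ∣ s := by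
  induction q using UniqueFactorizationMonoid.induction_on_prime with
  | h₁ => exact absurd rfl hq
  | h₂ x hx =>
    exact ⟨1, isCoprime_one_left, fun p hp h => absurd (isUnit_of_dvd_unit h hx) hp.not_isUnit⟩
  | h₃ a p ha hp ih =>
    obtain ⟨t, ht, h⟩ := ih ha
    by_cases hps : p ∣ s
    · refine ⟨t, ht, fun r hr hd => ?_⟩
      rcases hr.dvd_or_dvd hd with h1 | h1
      · exact Or.inr (((hr.dvd_prime_iff_associated hp).1 h1).dvd.trans hps)
      · exact h r hr h1
    · refine ⟨p * t, IsCoprime.mul_left (hp.coprime_iff_not_dvd.2 hps) ht, fun r hr hd => ?_⟩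
      rcases hr.dvd_or_dvd hd with h1 | h1
      · exact Or.inl (h1.mul_right _)
      · rcases h r hr h1 with h2 | h2
        · exact Or.inl (h2.mul_left _)
        · exact Or.inr h2

theorem exists_shift {K : Type*} [CommRing K] [IsDomain K] [IsPrincipalIdealRing K] (D s q : K)
    (hq : q ≠ 0) (h : IsCoprime D s) : ∃ w, IsCoprime (D * w + s) q := by
  obtain ⟨t, ht, h2⟩ := exists_split s q hq
  refine ⟨t, isCoprime_of_prime_dvd (fun h => hq h.2) ?_⟩
  intro p hp h3 h4
  rcases h2 p hp h4 with h5 | h5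
  · have : p ∣ s := (dvd_add_right (h5.mul_left D)).1 h3
    exact hp.not_isUnit (ht.isUnit_of_dvd' h5 this)
  · have : p ∣ D * t := (dvd_add_left h5).1 h3
    rcases hp.dvd_or_dvd this with h6 | h6
    · exact hp.not_isUnit (h.isUnit_of_dvd' h6 h5)
    · exact hp.not_isUnit (ht.isUnit_of_dvd' h6 h5)

theorem exists_xy_core {K : Type*} [CommRing K] [IsDomain K] [IsPrincipalIdealRing K] {n : ℕ}
    (e : ℕ → Prop) [DecidablePred e] (he : ∀ i, e (i+1) ↔ ¬ e i)
    (D s : K) (hDs : IsCoprime D s) (c z : Fin n → K) (hz : ∑ i, z i * c i = 1)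
    (hq : ∑ i : Fin n, (if e i then 0 else c i) ≠ 0) :
    ∃ (t : K) (y : ℕ → K), (∀ i, t * D ∣ y i * y (i+1) - 1) ∧
      t * s + ∑ i : Fin n, y i * c i = 0 := by
  set q1 := ∑ i : Fin n, (if e i then 0 else c i) with hq1
  set q0 := ∑ i : Fin n, (if e i then c i else 0) with hq0
  obtain ⟨a, b, hab⟩ := hDs
  obtain ⟨w, hw⟩ := exists_shift D (-b) q1 hq ⟨a, -s, by linear_combination hab⟩
  set u := D * w + -b with hu
  have hus : u * s + 1 = D * (w * s + a) := by rw [hu]; linear_combination -hab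
  set g := w * s + a
  set t := u * u * q0 + q1 with ht
  have hut : IsCoprime u (t * D) := by
    refine IsCoprime.mul_right ?_ ?_
    · rw [ht, mul_assoc, IsCoprime.mul_add_left_right_iff]
      exact hw
    · exact ⟨-s, g, by linear_combination -hus⟩
  obtain ⟨v, m, hvm⟩ := hut
  set R := u * q0 + v * q1 + t * s with hR
  set w0 := v * (g - m * q1) + m * R with hw0
  have hRw : R = t * D * w0 := by
    rw [hw0]
    have h1 : u * R = t * D * (g - m * q1) := by
      rw [hR]; linear_combination (q1) * hvm + t * hus - ht
    linear_combination v * h1 - R * hvm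
  let zz : ℕ → K := fun i => if h : i < n then z ⟨i, h⟩ else 0
  refine ⟨t, fun i => (if e i then u else v) - t * D * (w0 * zz i), ?_, ?_⟩
  · intro i
    have h2 : ∀ P Q : K, t * D ∣ (u - t * D * P) * (v - t * D * Q) - 1 := by
      intro P Q
      exact ⟨-m - P * v - Q * u + t * D * P * Q, by linear_combination hvm⟩
    by_cases hi : e i
    · have : ¬ e (i+1) := by rw [he]; exact not_not.2 hi
      simp only [hi, this, if_true, if_false]
      exact h2 _ _
    · have : e (i+1) := (he i).2 hi
      simp only [hi, this, if_true, if_false]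
      rw [mul_comm (v - _)]
      exact h2 _ _
  · have h3 : ∑ i : Fin n, ((if e i then u else v) - t * D * (w0 * zz i)) * c i =
        u * q0 + v * q1 - t * D * w0 * ∑ i, z i * c i := by
      rw [hq0, hq1, Finset.mul_sum, Finset.mul_sum, Finset.mul_sum, ← Finset.sum_add_distrib,
        ← Finset.sum_sub_distrib]
      refine Finset.sum_congr rfl fun i _ => ?_
      have : zz i = z i := dif_pos i.2
      rw [this]
      split_ifs <;> ring
    rw [h3, hz]
    linear_combination hRw

theorem exists_xy {K : Type*} [CommRing K] [IsDomain K] [IsPrincipalIdealRing K] {n : ℕ}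
    (σ : K) (a : Fin n → K) : ∃ (x : K) (y : ℕ → K), (∀ i, x ∣ y i * y (i+1) - 1) ∧
      x * σ + ∑ i : Fin n, y i * a i = 0 := by
  obtain ⟨G, hG⟩ := IsPrincipalIdealRing.principal (Ideal.span (Set.range a))
  have hG' : Ideal.span (Set.range a) = Ideal.span {G} := hG
  have h1 : ∀ i, G ∣ a i := by
    intro i
    rw [← Ideal.mem_span_singleton, ← hG']
    exact Ideal.subset_span ⟨i, rfl⟩
  choose c hc using h1
  by_cases hG0 : G = 0
  · exact ⟨0, fun _ => 1, fun _ => by simp, by simp [hc, hG0]⟩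
  have h3 : G ∈ Ideal.span (Set.range a) := by rw [hG']; exact Ideal.mem_span_singleton_self G
  obtain ⟨z, hz⟩ := Ideal.mem_span_range_iff_exists_fun.1 h3
  have hz1 : ∑ i, z i * c i = 1 := by
    apply mul_left_cancel₀ hG0
    rw [Finset.mul_sum, mul_one]
    conv_rhs => rw [← hz]
    refine Finset.sum_congr rfl fun i _ => ?_
    rw [hc]; ring
  obtain ⟨h, D, s, hDs, hD, hs⟩ : ∃ h D s, IsCoprime D s ∧ G = h * D ∧ σ = h * s := by
    obtain ⟨g, hg⟩ := IsPrincipalIdealRing.principal (Ideal.span {G, σ})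
    have hg' : Ideal.span {G, σ} = Ideal.span {g} := hg
    have hgG : g ∣ G := by
      rw [← Ideal.mem_span_singleton, ← hg']; exact Ideal.subset_span (by simp)
    have hgs : g ∣ σ := by
      rw [← Ideal.mem_span_singleton, ← hg']; exact Ideal.subset_span (by simp)
    obtain ⟨D, hD⟩ := hgG
    obtain ⟨s, hs⟩ := hgs
    have : g ∈ Ideal.span {G, σ} := by rw [hg']; exact Ideal.mem_span_singleton_self g
    obtain ⟨u, v, huv⟩ := Ideal.mem_span_pair.1 this
    have hg0 : g ≠ 0 := by rintro rfl; simp at hD; exact hG0 hD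
    refine ⟨g, D, s, ⟨u, v, ?_⟩, hD, hs⟩
    apply mul_left_cancel₀ hg0
    conv_rhs => rw [mul_one, ← huv, hD, hs]
    ring
  have fin : (∃ (t : K) (y : ℕ → K), (∀ i, t * D ∣ y i * y (i+1) - 1) ∧
      t * s + ∑ i : Fin n, y i * c i = 0) → ∃ (x : K) (y : ℕ → K), (∀ i, x ∣ y i * y (i+1) - 1) ∧
      x * σ + ∑ i : Fin n, y i * a i = 0 := by
    rintro ⟨t, y, h1, h2⟩
    refine ⟨t * D, y, h1, ?_⟩
    have : ∑ i : Fin n, y i * a i = G * ∑ i : Fin n, y i * c i := by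
      rw [Finset.mul_sum]
      refine Finset.sum_congr rfl fun i _ => ?_
      rw [hc]; ring
    rw [this, hs, hD]
    linear_combination h * D * h2
  by_cases hq1 : ∑ i : Fin n, (if Even (i:ℕ) then 0 else c i) = 0
  · by_cases hq0 : ∑ i : Fin n, (if ¬ Even (i:ℕ) then 0 else c i) = 0
    · refine ⟨0, fun _ => 1, fun _ => by simp, ?_⟩
      have : ∑ i, c i = 0 := by
        have h4 : ∑ i, c i = ∑ i : Fin n, (if Even (i:ℕ) then 0 else c i) +
            ∑ i : Fin n, (if ¬ Even (i:ℕ) then 0 else c i) := by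
          rw [← Finset.sum_add_distrib]
          refine Finset.sum_congr rfl fun i _ => ?_
          by_cases hi : Even (i:ℕ) <;> simp [hi]
        rw [h4, hq1, hq0, add_zero]
      simp [hc, ← Finset.mul_sum, this]
    · exact fin (exists_xy_core (fun i => ¬ Even i) (fun i => by rw [Nat.even_add_one])
        D s hDs c z hz1 hq0)
  · exact fin (exists_xy_core (fun i => Even i) (fun i => Nat.even_add_one) D s hDs c z hz1 hq1)

end CW

namespace CW
/-! ### Hessenberg reduction -/

theorem bezout2 {K : Type*} [CommRing K] [IsDomain K] [IsPrincipalIdealRing K] (a b : K) :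
    ∃ α β γ δ : K, α * δ - β * γ = 1 ∧ a * β + b * δ = 0 := by
  by_cases hab : a = 0 ∧ b = 0
  · exact ⟨1, 0, 0, 1, by simp, by simp [hab]⟩
  obtain ⟨g, hg⟩ := IsPrincipalIdealRing.principal (Ideal.span {a, b})
  have hg' : Ideal.span {a, b} = Ideal.span {g} := hg
  have hgG : g ∣ a := by
    rw [← Ideal.mem_span_singleton, ← hg']; exact Ideal.subset_span (by simp)
  have hgs : g ∣ b := by
    rw [← Ideal.mem_span_singleton, ← hg']; exact Ideal.subset_span (by simp)
  obtain ⟨D, hD⟩ := hgG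
  obtain ⟨s, hs⟩ := hgs
  have : g ∈ Ideal.span {a, b} := by rw [hg']; exact Ideal.mem_span_singleton_self g
  obtain ⟨u, v, huv⟩ := Ideal.mem_span_pair.1 this
  have hg0 : g ≠ 0 := by rintro rfl; apply hab; simp [hD, hs]
  refine ⟨u, -s, v, D, ?_, by rw [hD, hs]; ring⟩
  apply mul_left_cancel₀ hg0
  conv_rhs => rw [mul_one, ← huv, hD, hs]
  ring

def rot {K : Type*} [CommRing K] {n : ℕ} (p q : Fin n) (α β γ δ : K) : Matrix (Fin n) (Fin n) K :=
  Matrix.of fun i j =>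
    if j = p then (if i = p then α else if i = q then γ else 0)
    else if j = q then (if i = p then β else if i = q then δ else 0)
    else if i = j then 1 else 0

theorem mul_rot {K : Type*} [CommRing K] {n : ℕ} (p q : Fin n) (hpq : p ≠ q) (α β γ δ : K)
    (A : Matrix (Fin n) (Fin n) K) (i j : Fin n) :
    (A * rot p q α β γ δ) i j = if j = p then A i p * α + A i q * γ else
      if j = q then A i p * β + A i q * δ else A i j := by
  simp only [Matrix.mul_apply, rot, Matrix.of_apply]
  have key : ∀ s t : K, ∑ l, A i l * (if l = p then s else if l = q then t else 0) =
      A i p * s + A i q * t := by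
    intro s t
    rw [← Finset.sum_subset (Finset.subset_univ {p, q}), Finset.sum_pair hpq]
    · simp [hpq.symm]
    · intro l _ hl
      simp at hl
      simp [hl.1, hl.2]
  split_ifs with h1 h2
  · exact key α γ
  · exact key β δ
  · simp

theorem rot_mul_row {K : Type*} [CommRing K] {n : ℕ} (p q : Fin n) (α β γ δ : K)
    (A : Matrix (Fin n) (Fin n) K) (i j : Fin n) (hp : i ≠ p) (hq : i ≠ q) :
    (rot p q α β γ δ * A) i j = A i j := by
  simp only [Matrix.mul_apply, rot, Matrix.of_apply]
  rw [Finset.sum_eq_single i]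
  · simp [hp, hq]
  · intro b _ hb
    simp [hp, hq, hb.symm]
  · simp

theorem rot_inv {K : Type*} [CommRing K] {n : ℕ} (p q : Fin n) (hpq : p ≠ q) (α β γ δ : K)
    (h : α * δ - β * γ = 1) : rot p q α β γ δ * rot p q δ (-β) (-γ) α = 1 := by
  ext i j
  rw [mul_rot p q hpq]
  simp only [rot, Matrix.of_apply, Matrix.one_apply]
  have hqp := hpq.symm
  by_cases hj : j = p
  · subst hj
    by_cases hi : i = j
    · subst hi; simp [hqp]; linear_combination h
    · by_cases hi2 : i = q
      · subst hi2; simp [hi]; ring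
      · simp [hi, hi2]
  · by_cases hj2 : j = q
    · subst hj2
      by_cases hi : i = j
      · subst hi; simp [hqp]; linear_combination h
      · by_cases hi2 : i = p
        · subst hi2; simp [hi, hj]; ring
        · simp [hi, hi2, hj]
    · simp [hj, hj2]

def Conj {K : Type*} [CommRing K] {n : ℕ} (A B : Matrix (Fin n) (Fin n) K) : Prop :=
  ∃ P Q : Matrix (Fin n) (Fin n) K, P * Q = 1 ∧ Q * P = 1 ∧ B = P * A * Q

theorem Conj.trans {K : Type*} [CommRing K] {n : ℕ} {A B C : Matrix (Fin n) (Fin n) K}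
    (h1 : Conj A B) (h2 : Conj B C) : Conj A C := by
  obtain ⟨P, Q, h, h', rfl⟩ := h1
  obtain ⟨P', Q', k, k', rfl⟩ := h2
  refine ⟨P' * P, Q * Q', ?_, ?_, by simp only [Matrix.mul_assoc]⟩
  · rw [Matrix.mul_assoc, ← Matrix.mul_assoc P, h, Matrix.one_mul, k]
  · rw [Matrix.mul_assoc, ← Matrix.mul_assoc Q', k', Matrix.one_mul, h']

theorem Conj.trace {K : Type*} [CommRing K] {n : ℕ} {A B : Matrix (Fin n) (Fin n) K}
    (h1 : Conj A B) : B.trace = A.trace := by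
  obtain ⟨P, Q, h, h', rfl⟩ := h1
  rw [Matrix.trace_mul_comm, ← Matrix.mul_assoc, h', Matrix.one_mul]

theorem Conj.comm {K : Type*} [CommRing K] {n : ℕ} {A B : Matrix (Fin n) (Fin n) K}
    (h1 : Conj A B) (h : ∃ X Y, B = X * Y - Y * X) : ∃ X Y, A = X * Y - Y * X := by
  obtain ⟨P, Q, h2, h3, rfl⟩ := h1
  obtain ⟨X, Y, h⟩ := h
  refine ⟨Q * X * P, Q * Y * P, ?_⟩
  have h4 : A = Q * (P * A * Q) * P := by
    rw [Matrix.mul_assoc P, ← Matrix.mul_assoc Q, h3, Matrix.one_mul, Matrix.mul_assoc, h3,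
      Matrix.mul_one]
  have h5 : ∀ U V : Matrix (Fin n) (Fin n) K, Q * U * P * (Q * V * P) = Q * (U * V) * P := by
    intro U V
    calc Q * U * P * (Q * V * P) = Q * U * (P * Q) * V * P := by simp only [Matrix.mul_assoc]
      _ = _ := by rw [h2]; simp only [Matrix.mul_assoc, Matrix.mul_one, Matrix.one_mul]
  rw [h4, h, h5, h5, Matrix.mul_sub, Matrix.sub_mul]

theorem hess_step {K : Type*} [CommRing K] [IsDomain K] [IsPrincipalIdealRing K] {n : ℕ}
    (A : Matrix (Fin n) (Fin n) K) (k j : ℕ)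
    (hA : ∀ i l : Fin n, (i:ℕ) + 2 ≤ l → ((i:ℕ) < k ∨ ((i:ℕ) = k ∧ (l:ℕ) < j)) → A i l = 0) :
    ∃ B, Conj A B ∧ ∀ i l : Fin n, (i:ℕ) + 2 ≤ l →
      ((i:ℕ) < k ∨ ((i:ℕ) = k ∧ (l:ℕ) < j + 1)) → B i l = 0 := by
  by_cases hj : k + 2 ≤ j ∧ j < n
  swap
  · refine ⟨A, ⟨1, 1, by simp, by simp, by simp⟩, fun i l h1 h2 => hA i l h1 ?_⟩
    have := l.2
    omega
  obtain ⟨hkj, hjn⟩ := hj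
  let p : Fin n := ⟨k+1, by omega⟩
  let q : Fin n := ⟨j, hjn⟩
  let r : Fin n := ⟨k, by omega⟩
  have hpq : p ≠ q := by intro h; simp [p, q] at h; omega
  obtain ⟨α, β, γ, δ, hdet, h0⟩ := bezout2 (A r p) (A r q)
  refine ⟨rot p q δ (-β) (-γ) α * A * rot p q α β γ δ, ⟨_, _, ?_, ?_, rfl⟩, ?_⟩
  · have := rot_inv p q hpq δ (-β) (-γ) α (by linear_combination hdet)
    simpa using this
  · exact rot_inv p q hpq α β γ δ hdet
  · intro i l hil h
    have hip : i ≠ p := by intro h; simp only [h, p] at *; omega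
    have hiq : i ≠ q := by intro h; simp only [h, q] at *; omega
    rw [Matrix.mul_assoc, rot_mul_row _ _ _ _ _ _ _ _ _ hip hiq, mul_rot p q hpq]
    split_ifs with h1 h2
    · subst h1
      simp only [p] at hil
      rw [hA i p (by simp [p]; omega) (by omega), hA i q (by simp [q]; omega) (by omega)]
      simp
    · subst h2
      by_cases hik : (i:ℕ) = k
      · have : i = r := Fin.ext hik
        rw [this]; exact h0
      · rw [hA i p (by simp [p]; omega) (by omega), hA i q (by simp [q]; omega) (by omega)]
        simp
    · have : (l:ℕ) ≠ j := fun h => h2 (Fin.ext h)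
      exact hA i l hil (by omega)

theorem hess {K : Type*} [CommRing K] [IsDomain K] [IsPrincipalIdealRing K] {n : ℕ}
    (A : Matrix (Fin n) (Fin n) K) :
    ∃ B, Conj A B ∧ ∀ i l : Fin n, (i:ℕ) + 2 ≤ l → B i l = 0 := by
  have key : ∀ k j : ℕ, ∃ B, Conj A B ∧ ∀ i l : Fin n, (i:ℕ) + 2 ≤ l →
      ((i:ℕ) < k ∨ ((i:ℕ) = k ∧ (l:ℕ) < j)) → B i l = 0 := by
    intro k
    induction k with
    | zero =>
      intro j
      induction j with
      | zero => exact ⟨A, ⟨1, 1, by simp, by simp, by simp⟩, by omega⟩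
      | succ j ih =>
        obtain ⟨B, h1, h2⟩ := ih
        obtain ⟨C, h3, h4⟩ := hess_step B 0 j h2
        exact ⟨C, h1.trans h3, h4⟩
    | succ k ihk =>
      intro j
      induction j with
      | zero =>
        obtain ⟨B, h1, h2⟩ := ihk n
        refine ⟨B, h1, fun i l h h' => h2 i l h ?_⟩
        have := l.2
        omega
      | succ j ih =>
        obtain ⟨B, h1, h2⟩ := ih
        obtain ⟨C, h3, h4⟩ := hess_step B (k+1) j h2
        exact ⟨C, h1.trans h3, h4⟩
  obtain ⟨B, h1, h2⟩ := key n 0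
  exact ⟨B, h1, fun i l h => h2 i l h (Or.inl i.2)⟩

end CW

namespace CW
/-! ### The matrix X -/

def lam {K : Type*} [CommRing K] (x : K) (i : ℕ) : K := if Even i then 0 else x

theorem lam_succ_add {K : Type*} [CommRing K] (x : K) (i : ℕ) : lam x i + lam x (i+1) = x := by
  by_cases h : Even i <;> simp [lam, h, Nat.even_add_one]

theorem lam_add_two {K : Type*} [CommRing K] (x : K) (i : ℕ) : lam x (i+2) = lam x i := by
  by_cases h : Even i <;> simp [lam, h, Nat.even_add_one]

theorem lam_sq {K : Type*} [CommRing K] (x : K) (i : ℕ) : lam x i * lam x i = x * lam x i := by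
  by_cases h : Even i <;> simp [lam, h]

def XM {K : Type*} [CommRing K] (n : ℕ) (x : K) (y z : ℕ → K) : Matrix (Fin n) (Fin n) K :=
  Matrix.of fun i j => if (i:ℕ) = j then lam x i else if (i:ℕ) = j + 1 then y j
    else if (i:ℕ) = j + 2 then z j else 0

theorem XM_upper {K : Type*} [CommRing K] {n : ℕ} (x : K) (y z : ℕ → K) (i j : Fin n)
    (h : (i:ℕ) < j) : XM n x y z i j = 0 := by
  simp only [XM, Matrix.of_apply]
  rw [if_neg, if_neg, if_neg] <;> omega

theorem XM_zero {K : Type*} [CommRing K] {n : ℕ} (x : K) (y z : ℕ → K) (i j : Fin n)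
    (h1 : (i:ℕ) ≠ j) (h2 : (i:ℕ) ≠ j + 1) (h3 : (i:ℕ) ≠ j + 2) : XM n x y z i j = 0 := by
  simp only [XM, Matrix.of_apply]
  rw [if_neg h1, if_neg h2, if_neg h3]

theorem XM_mulVec0 {K : Type*} [CommRing K] {n : ℕ} (x : K) (y z : ℕ → K) (u : Fin n → K)
    (h : 0 < n) : ∑ l, XM n x y z ⟨0, h⟩ l * u l = 0 := by
  apply Finset.sum_eq_zero
  intro l _
  by_cases hl : (l:ℕ) = 0
  · simp [XM, hl, lam]
  · rw [XM_upper _ _ _ _ _ (by simp; omega), zero_mul]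

theorem XM_mulVec1 {K : Type*} [CommRing K] {n : ℕ} (x : K) (y z : ℕ → K) (u : Fin n → K)
    (h : 1 < n) : ∑ l, XM n x y z ⟨1, h⟩ l * u l = x * u ⟨1, h⟩ + y 0 * u ⟨0, by omega⟩ := by
  have hne : (⟨1, h⟩ : Fin n) ≠ ⟨0, by omega⟩ := by simp
  rw [← Finset.sum_subset (Finset.subset_univ {⟨1, h⟩, ⟨0, by omega⟩}), Finset.sum_pair hne]
  · simp [XM, lam]
  · intro l _ hl
    simp [Fin.ext_iff] at hl
    rw [XM_upper _ _ _ _ _ (by simp; omega), zero_mul]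

theorem XM_mulVec2 {K : Type*} [CommRing K] {n : ℕ} (x : K) (y z : ℕ → K) (u : Fin n → K)
    (m : ℕ) (h : m + 2 < n) : ∑ l, XM n x y z ⟨m+2, h⟩ l * u l = lam x m * u ⟨m+2, h⟩ +
      (y (m+1) * u ⟨m+1, by omega⟩ + z m * u ⟨m, by omega⟩) := by
  have hne : (⟨m+1, by omega⟩ : Fin n) ≠ ⟨m, by omega⟩ := by simp
  have hne2 : (⟨m+2, by omega⟩ : Fin n) ∉
    ({⟨m+1, by omega⟩, ⟨m, by omega⟩} : Finset (Fin n)) := by simp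
  rw [← Finset.sum_subset (Finset.subset_univ {⟨m+2, h⟩, ⟨m+1, by omega⟩, ⟨m, by omega⟩}),
    Finset.sum_insert hne2, Finset.sum_pair hne]
  · simp [XM, lam_add_two]
  · intro l _ hl
    simp [Fin.ext_iff] at hl
    rw [XM_zero _ _ _ _ _ (by simp; omega) (by simp; omega) (by simp; omega), zero_mul]

def NM {K : Type*} [CommRing K] (n : ℕ) (x : K) (y z : ℕ → K) : Matrix (Fin n) (Fin n) K :=
  XM n x y z * XM n x y z - x • XM n x y z

theorem NM_low {K : Type*} [CommRing K] {n : ℕ} (x : K) (y z : ℕ → K) (i j : Fin n)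
    (h : (i:ℕ) < j + 2) : NM n x y z i j = 0 := by
  simp only [NM, Matrix.sub_apply, Matrix.mul_apply, Matrix.smul_apply, smul_eq_mul]
  obtain ⟨i, hi⟩ := i
  obtain ⟨j, hj⟩ := j
  simp only at h
  rcases i with _ | _ | m
  · rw [XM_mulVec0]
    by_cases hj0 : j = 0
    · subst hj0; simp [XM, lam]
    · rw [XM_upper _ _ _ _ _ (by simp; omega)]; simp
  · rw [XM_mulVec1]
    rcases j with _ | _ | j
    · simp [XM, lam]
    · simp [XM, lam]
    · rw [XM_upper _ _ _ _ _ (by simp), XM_upper _ _ _ _ _ (by simp)]; simp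
  · rw [XM_mulVec2]
    rw [XM_upper _ _ _ ⟨m, _⟩ _ (by simp; omega)]
    by_cases h1 : j = m + 1
    · subst h1
      simp [XM]
      linear_combination y (m+1) * lam_succ_add x m
    · rw [XM_upper _ _ _ ⟨m+1, _⟩ _ (by simp; omega)]
      by_cases h2 : j = m + 2
      · subst h2
        simp [XM, lam_add_two]
        linear_combination lam_sq x m
      · rw [XM_upper _ _ _ ⟨m+2, _⟩ _ (by simp; omega)]; simp

def Good {K : Type*} [CommRing K] (x : K) (y z : ℕ → K) : Prop :=
  ∀ i, y i * y (i+1) + (2 * lam x i - x) * z i = 1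

theorem NM_two {K : Type*} [CommRing K] {n : ℕ} (x : K) (y z : ℕ → K) (hg : Good x y z) (m : ℕ)
    (h : m + 2 < n) : NM n x y z ⟨m+2, h⟩ ⟨m, by omega⟩ = 1 := by
  simp only [NM, Matrix.sub_apply, Matrix.mul_apply, Matrix.smul_apply, smul_eq_mul]
  rw [XM_mulVec2]
  simp [XM]
  linear_combination hg m

theorem pow_low {K : Type*} [CommRing K] {n : ℕ} (x : K) (y z : ℕ → K) (r : ℕ) (i j : Fin n)
    (h : (i:ℕ) < j + 2) : (XM n x y z ^ (r+1) - x ^ r • XM n x y z) i j = 0 := by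
  induction r generalizing i j with
  | zero => simp
  | succ r ih =>
    have : XM n x y z ^ (r+1+1) - x ^ (r+1) • XM n x y z =
      XM n x y z * (XM n x y z ^ (r+1) - x ^ r • XM n x y z) + x ^ r • NM n x y z := by
      rw [NM, pow_succ' (XM n x y z) (r+1), Matrix.mul_sub, smul_sub, Matrix.mul_smul, smul_smul,
        pow_succ x r]
      abel
    rw [this, Matrix.add_apply, Matrix.smul_apply, NM_low _ _ _ _ _ h, Matrix.mul_apply,
      Finset.sum_eq_zero]
    · simp
    · intro l _
      by_cases hl : (i:ℕ) < l
      · rw [XM_upper _ _ _ _ _ hl, zero_mul]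
      · rw [ih l j (by omega), mul_zero]

theorem trace_low {K : Type*} [CommRing K] {n : ℕ} (M A : Matrix (Fin n) (Fin n) K)
    (hM : ∀ i j : Fin n, (i:ℕ) < j + 2 → M i j = 0)
    (hA : ∀ i j : Fin n, (i:ℕ) + 2 ≤ j → A i j = 0) : (M * A).trace = 0 := by
  rw [Matrix.trace]
  apply Finset.sum_eq_zero
  intro i _
  rw [Matrix.diag_apply, Matrix.mul_apply]
  apply Finset.sum_eq_zero
  intro j _
  by_cases h : (i:ℕ) < j + 2
  · rw [hM i j h, zero_mul]
  · rw [hA j i (by omega), mul_zero]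

theorem trace_pow {K : Type*} [CommRing K] {n : ℕ} (x : K) (y z : ℕ → K)
    (A : Matrix (Fin n) (Fin n) K)
    (hA : ∀ i j : Fin n, (i:ℕ) + 2 ≤ j → A i j = 0) (h0 : A.trace = 0)
    (h1 : (XM n x y z * A).trace = 0) (r : ℕ) : (XM n x y z ^ r * A).trace = 0 := by
  rcases r with _ | r
  · simpa using h0
  · have h2 := trace_low _ A (pow_low (n := n) x y z r) hA
    rw [Matrix.sub_mul, Matrix.trace_sub, Matrix.smul_mul, Matrix.trace_smul, h1] at h2
    simpa using h2

theorem trace_XM {K : Type*} [CommRing K] {n : ℕ} (x : K) (y z : ℕ → K)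
    (A : Matrix (Fin n) (Fin n) K)
    (hA : ∀ i j : Fin n, (i:ℕ) + 2 ≤ j → A i j = 0) :
    (XM n x y z * A).trace = ∑ j : Fin n, (lam x j * A j j +
      y j * (if h : (j:ℕ) + 1 < n then A j ⟨j+1, h⟩ else 0)) := by
  rw [Matrix.trace_mul_comm, Matrix.trace]
  refine Finset.sum_congr rfl fun j _ => ?_
  rw [Matrix.diag_apply, Matrix.mul_apply]
  have h1 : ∀ i, A j i * XM n x y z i j = (if i = j then lam x j * A j j else 0) +
      (if (i:ℕ) = j + 1 then y j * A j i else 0) := by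
    intro i
    by_cases hij : i = j
    · subst hij; simp [XM]; ring
    · have hij' : (i:ℕ) ≠ j := fun h => hij (Fin.ext h)
      by_cases h2 : (i:ℕ) = j + 1
      · simp [XM, hij, h2]; ring
      · rw [if_neg hij, if_neg h2]
        by_cases h3 : (i:ℕ) < j
        · rw [XM_upper _ _ _ _ _ h3]; simp
        · rw [hA j i (by omega)]; simp
  rw [Finset.sum_congr rfl fun i _ => h1 i, Finset.sum_add_distrib, Finset.sum_ite_eq']
  congr 1
  · simp
  · split_ifs with h
    · rw [Finset.sum_eq_single ⟨j+1, h⟩]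
      · simp
      · intro b _ hb
        rw [if_neg]; intro h; exact hb (Fin.ext h)
      · simp
    · rw [mul_zero]
      apply Finset.sum_eq_zero
      intro b _
      rw [if_neg]; have := b.2; omega

/-! ### Cyclicity over fields -/

theorem span_top {k : Type*} [Field k] {n : ℕ} (S : Submodule k (Fin n → k))
    (h : ∀ i : Fin n, ∃ u ∈ S, u i ≠ 0 ∧ ∀ j < i, u j = 0) : S = ⊤ := by
  have key : ∀ m : ℕ, ∀ w : Fin n → k, (∀ j : Fin n, (j:ℕ) + m < n → w j = 0) → w ∈ S := by
    intro m
    induction m with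
    | zero =>
      intro w hw
      have : w = 0 := funext fun j => hw j (by omega)
      rw [this]; exact S.zero_mem
    | succ m ih =>
      intro w hw
      by_cases hm : m + 1 ≤ n
      · obtain ⟨u, huS, hu0, hu⟩ := h ⟨n - (m+1), by omega⟩
        set i : Fin n := ⟨n - (m+1), by omega⟩ with hi
        have : w = (w - (w i / u i) • u) + (w i / u i) • u := by simp
        rw [this]
        refine S.add_mem (ih _ ?_) (S.smul_mem _ huS)
        intro j hj
        by_cases hji : j = i
        · subst hji; simp [hu0]
        · have h1 : (j:ℕ) ≠ n - (m+1) := fun h => hji (Fin.ext h)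
          have h2 : (j:ℕ) < n - (m+1) := by omega
          have h3 := hu j (Fin.lt_def.2 h2)
          simp [h3, hw j (by omega)]
      · exact ih w fun j hj => hw j (by omega)
  exact eq_top_iff.2 fun w _ => key n w fun j hj => by omega

theorem centralizer {k : Type*} [Field k] {n : ℕ} (x : k) (y z : ℕ → k) (hg : Good x y z)
    (h0 : x ≠ 0 ∨ y 0 ≠ 0) (C : Matrix (Fin n) (Fin n) k)
    (hC : C * XM n x y z = XM n x y z * C) : ∃ f : Polynomial k, C = Polynomial.aeval (XM n x y z) f := by
  set X := XM n x y z with hX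
  obtain ⟨v1, hv1⟩ : ∃ v1 : k, x * v1 + y 0 ≠ 0 := by
    by_cases hy : y 0 = 0
    · exact ⟨1, by simpa [hy] using h0⟩
    · exact ⟨0, by simpa using hy⟩
  let v : Fin n → k := fun i => if (i:ℕ) = 0 then 1 else if (i:ℕ) = 1 then v1 else 0
  let ev : Polynomial k →ₗ[k] (Fin n → k) :=
    { toFun := fun f => Polynomial.aeval X f *ᵥ v
      map_add' := by intro f g; rw [map_add, Matrix.add_mulVec]
      map_smul' := by intro c f; rw [map_smul, Matrix.smul_mulVec]; rfl }
  have hev : ∀ f, ev f = Polynomial.aeval X f *ᵥ v := fun f => rfl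
  have htop : LinearMap.range ev = ⊤ := by
    have hXS : ∀ u ∈ LinearMap.range ev, X *ᵥ u ∈ LinearMap.range ev := by
      rintro _ ⟨f, rfl⟩
      refine ⟨Polynomial.X * f, ?_⟩
      rw [hev, hev, map_mul, Polynomial.aeval_X, Matrix.mulVec_mulVec]
    apply span_top
    have key : ∀ i : ℕ, ∀ hi : i < n, ∃ u ∈ LinearMap.range ev, u ⟨i, hi⟩ ≠ 0 ∧
        ∀ j : Fin n, (j:ℕ) < i → u j = 0 := by
      intro i
      induction i using Nat.twoStepInduction with
      | zero =>
        intro hi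
        exact ⟨v, ⟨1, by simp [hev]⟩, by simp [v], by omega⟩
      | one =>
        intro hi
        refine ⟨X *ᵥ v, hXS v ⟨1, by simp [hev]⟩, ?_, ?_⟩
        · change ∑ l, X ⟨1, hi⟩ l * v l ≠ 0
          rw [hX, XM_mulVec1]
          simpa [v] using hv1
        · intro j hj
          have : j = ⟨0, by omega⟩ := Fin.ext (by simp; omega)
          rw [this]
          change ∑ l, X ⟨0, _⟩ l * v l = 0
          rw [hX, XM_mulVec0]
      | more i ih _ =>
        intro hi
        obtain ⟨u, huS, hu0, hu⟩ := ih (by omega)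
        have hN : NM n x y z *ᵥ u ∈ LinearMap.range ev := by
          rw [NM, Matrix.sub_mulVec, ← Matrix.mulVec_mulVec, Matrix.smul_mulVec]
          exact Submodule.sub_mem _ (hXS _ (hXS _ huS)) (Submodule.smul_mem _ _ (hXS _ huS))
        refine ⟨_, hN, ?_, ?_⟩
        · change ∑ l, NM n x y z ⟨i+2, hi⟩ l * u l ≠ 0
          rw [Finset.sum_eq_single ⟨i, by omega⟩]
          · rw [NM_two x y z hg]; simpa using hu0
          · intro l _ hl
            have hl' : (l:ℕ) ≠ i := fun h => hl (Fin.ext h)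
            by_cases h : (l:ℕ) < i
            · rw [hu l h, mul_zero]
            · rw [NM_low _ _ _ _ _ (by simp; omega), zero_mul]
          · simp
        · intro j hj
          change ∑ l, NM n x y z j l * u l = 0
          apply Finset.sum_eq_zero
          intro l _
          by_cases h : (l:ℕ) < i
          · rw [hu l h, mul_zero]
          · rw [NM_low _ _ _ _ _ (by omega), zero_mul]
    intro i
    obtain ⟨u, h1, h2, h3⟩ := key i i.2
    exact ⟨u, h1, h2, fun j hj => h3 j hj⟩
  have hcomm : ∀ g : Polynomial k, Commute C (Polynomial.aeval X g) := by
    intro g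
    have hCX : Commute C X := hC
    induction g using Polynomial.induction_on' with
    | add p q hp hq => rw [map_add]; exact hp.add_right hq
    | monomial m a =>
      rw [Polynomial.aeval_monomial]
      exact (Algebra.commute_algebraMap_right a C).mul_right (hCX.pow_right m)
  obtain ⟨f, hf⟩ : C *ᵥ v ∈ LinearMap.range ev := by rw [htop]; trivial
  refine ⟨f, ?_⟩
  apply Matrix.ext_of_mulVec_single
  intro i
  obtain ⟨g, hgi⟩ : (Pi.single i 1 : Fin n → k) ∈ LinearMap.range ev := by rw [htop]; trivial
  rw [← hgi, hev, Matrix.mulVec_mulVec, (hcomm g).eq, ← Matrix.mulVec_mulVec, ← hf, hev,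
    Matrix.mulVec_mulVec, Matrix.mulVec_mulVec, ← map_mul, ← map_mul, mul_comm]

theorem field_solve {k : Type*} [Field k] {n : ℕ} (x : k) (y z : ℕ → k) (hg : Good x y z)
    (h0 : x ≠ 0 ∨ y 0 ≠ 0) (A : Matrix (Fin n) (Fin n) k)
    (hA : ∀ r : ℕ, (XM n x y z ^ r * A).trace = 0) :
    ∃ Y, A = XM n x y z * Y - Y * XM n x y z := by
  set X := XM n x y z with hX
  let ad : Matrix (Fin n) (Fin n) k →ₗ[k] Matrix (Fin n) (Fin n) k :=
    LinearMap.mulLeft k X - LinearMap.mulRight k X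
  have had : ∀ Y, ad Y = X * Y - Y * X := fun Y => rfl
  by_contra hne
  have hnm : A ∉ LinearMap.range ad := by
    rintro ⟨Y, hY⟩; exact hne ⟨Y, by rw [← had, hY]⟩
  obtain ⟨φ, hφA, hφ⟩ := Submodule.exists_le_ker_of_notMem hnm
  let C : Matrix (Fin n) (Fin n) k := Matrix.of fun i j => φ (Matrix.single j i 1)
  have hφC : ∀ M, φ M = (C * M).trace := by
    intro M
    conv_lhs => rw [Matrix.matrix_eq_sum_single M]
    rw [Matrix.trace_mul_comm]
    simp only [map_sum, Matrix.trace, Matrix.diag_apply, Matrix.mul_apply, C, Matrix.of_apply]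
    refine Finset.sum_congr rfl fun i _ => Finset.sum_congr rfl fun j _ => ?_
    have : Matrix.single i j (M i j) = M i j • Matrix.single i j (1:k) := by
      rw [Matrix.smul_single]; simp
    rw [this, map_smul, smul_eq_mul]
  have hcom : C * X = X * C := by
    rw [Matrix.ext_iff_trace_mul_right]
    intro Y
    have h1 : φ (ad Y) = 0 := hφ ⟨Y, rfl⟩
    rw [had, hφC, Matrix.mul_sub, Matrix.trace_sub, ← Matrix.mul_assoc, ← Matrix.mul_assoc,
      sub_eq_zero] at h1
    rw [h1, Matrix.trace_mul_comm, ← Matrix.mul_assoc]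
  obtain ⟨f, hf⟩ := centralizer x y z hg h0 C hcom
  apply hφA
  rw [hφC, hf, Polynomial.aeval_eq_sum_range, Finset.sum_mul, Matrix.trace_sum]
  apply Finset.sum_eq_zero
  intro r _
  rw [Matrix.smul_mul, Matrix.trace_smul, hA r, smul_zero]

end CW
namespace CW
/-! ### Descent -/

theorem XM_map {K L : Type*} [CommRing K] [CommRing L] (φ : K →+* L) (n : ℕ) (x : K)
    (y z : ℕ → K) : (XM n x y z).map φ = XM n (φ x) (fun i => φ (y i)) (fun i => φ (z i)) := by
  ext i j
  simp only [Matrix.map_apply, XM, Matrix.of_apply, lam]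
  split_ifs <;> simp

theorem Good.map {K L : Type*} [CommRing K] [CommRing L] (φ : K →+* L) {x : K}
    {y z : ℕ → K} (h : Good x y z) : Good (φ x) (fun i => φ (y i)) (fun i => φ (z i)) := by
  intro i
  have h1 : lam (φ x) i = φ (lam x i) := by simp only [lam]; split_ifs <;> simp
  have h2 := congrArg φ (h i)
  simp only [map_add, map_mul, map_sub, map_one, map_ofNat] at h2
  rw [h1]
  exact h2

theorem descend {K : Type*} [CommRing K] [IsDomain K] [IsPrincipalIdealRing K] {n : ℕ} (x : K)
    (y z : ℕ → K) (hg : Good x y z) (h0 : IsCoprime x (y 0)) (p : K) (hp : Prime p)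
    (B Y : Matrix (Fin n) (Fin n) K) (h : p • B = XM n x y z * Y - Y * XM n x y z) :
    ∃ Y', B = XM n x y z * Y' - Y' * XM n x y z := by
  have hmax : (Ideal.span {p}).IsMaximal :=
    PrincipalIdealRing.isMaximal_of_irreducible hp.irreducible
  let _ : Field (K ⧸ Ideal.span {p}) := Ideal.Quotient.field _
  let φ : K →+* K ⧸ Ideal.span {p} := Ideal.Quotient.mk _
  have hφp : φ p = 0 := Ideal.Quotient.eq_zero_iff_mem.2 (Ideal.mem_span_singleton_self p)
  have hcom : Y.map φ * XM n (φ x) (fun i => φ (y i)) (fun i => φ (z i)) =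
      XM n (φ x) (fun i => φ (y i)) (fun i => φ (z i)) * Y.map φ := by
    rw [← XM_map, ← Matrix.map_mul, ← Matrix.map_mul, eq_comm, ← sub_eq_zero,
      ← Matrix.map_sub φ (map_sub φ), ← h]
    ext i j
    simp [hφp]
  obtain ⟨f, hf⟩ := centralizer (φ x) _ _ (hg.map φ) (by
    by_contra hcon
    push Not at hcon
    have h1 := h0.map φ
    rw [hcon.1, hcon.2] at h1
    exact not_isCoprime_zero_zero h1) (Y.map φ) hcom
  obtain ⟨F, rfl⟩ := Polynomial.map_surjective φ Ideal.Quotient.mk_surjective f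
  have h2 : Polynomial.aeval (XM n (φ x) (fun i => φ (y i)) (fun i => φ (z i))) (F.map φ) =
      (Polynomial.aeval (XM n x y z) F).map φ := by
    rw [← XM_map]
    rw [← RingHom.mapMatrix_apply, ← RingHom.mapMatrix_apply, Polynomial.aeval_def,
      Polynomial.aeval_def, Polynomial.hom_eval₂, Polynomial.eval₂_map]
    congr 1
    ext a i j
    simp [Matrix.algebraMap_matrix_apply, apply_ite φ]
  have h3 : ∀ i j, p ∣ (Y - Polynomial.aeval (XM n x y z) F) i j := by
    intro i j
    rw [← Ideal.mem_span_singleton, ← Ideal.Quotient.eq_zero_iff_mem]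
    have := congrFun (congrFun (hf.trans h2) i) j
    simp only [Matrix.map_apply] at this
    rw [Matrix.sub_apply, map_sub, sub_eq_zero]
    exact this
  choose Y' hY' using h3
  have h4 : Y - Polynomial.aeval (XM n x y z) F = p • Matrix.of Y' := by
    ext i j; rw [hY']; rfl
  have h5 : Commute (XM n x y z) (Polynomial.aeval (XM n x y z) F) := by
    rw [commute_iff_eq]
    have := Polynomial.aeval_X (R := K) (XM n x y z)
    calc XM n x y z * Polynomial.aeval (XM n x y z) F =
        Polynomial.aeval (XM n x y z) (Polynomial.X * F) := by rw [map_mul, this]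
      _ = _ := by rw [mul_comm, map_mul, this]
  refine ⟨Matrix.of Y', ?_⟩
  have h6 : p • B = p • (XM n x y z * Matrix.of Y' - Matrix.of Y' * XM n x y z) := by
    rw [h, smul_sub, ← Matrix.mul_smul, ← Matrix.smul_mul, ← h4, Matrix.mul_sub, Matrix.sub_mul,
      h5.eq]
    abel
  ext i j
  have := congrFun (congrFun h6 i) j
  exact mul_left_cancel₀ hp.ne_zero this

theorem descend_all {K : Type*} [CommRing K] [IsDomain K] [IsPrincipalIdealRing K] {n : ℕ} (x : K)
    (y z : ℕ → K) (hg : Good x y z) (h0 : IsCoprime x (y 0)) (r : K) (hr : r ≠ 0)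
    (B : Matrix (Fin n) (Fin n) K) (h : ∃ Y, r • B = XM n x y z * Y - Y * XM n x y z) :
    ∃ Y', B = XM n x y z * Y' - Y' * XM n x y z := by
  induction r using UniqueFactorizationMonoid.induction_on_prime with
  | h₁ => exact absurd rfl hr
  | h₂ u hu =>
    obtain ⟨Y, hY⟩ := h
    obtain ⟨u, rfl⟩ := hu
    refine ⟨(↑u⁻¹ : K) • Y, ?_⟩
    rw [Matrix.mul_smul, Matrix.smul_mul, ← smul_sub, ← hY, smul_smul]
    simp
  | h₃ a p ha hp ih =>
    obtain ⟨Y, hY⟩ := h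
    rw [mul_smul] at hY
    exact ih ha (descend x y z hg h0 p hp _ Y hY)

theorem pid_solve {K : Type*} [CommRing K] [IsDomain K] [IsPrincipalIdealRing K] {n : ℕ} (x : K)
    (y z : ℕ → K) (hg : Good x y z) (h0 : IsCoprime x (y 0)) (A : Matrix (Fin n) (Fin n) K)
    (hA : ∀ r : ℕ, (XM n x y z ^ r * A).trace = 0) :
    ∃ Y, A = XM n x y z * Y - Y * XM n x y z := by
  let F := FractionRing K
  let φ : K →+* F := algebraMap K F
  have hinj : Function.Injective φ := IsFractionRing.injective K F
  obtain ⟨Y, hY⟩ := field_solve (φ x) _ _ (hg.map φ) (by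
    by_contra hcon
    push Not at hcon
    have h1 := h0.map φ
    rw [hcon.1, hcon.2] at h1
    exact not_isCoprime_zero_zero h1) (A.map φ) (by
      intro r
      rw [← XM_map, ← RingHom.mapMatrix_apply, ← RingHom.mapMatrix_apply, ← map_pow, ← map_mul,
        RingHom.mapMatrix_apply, ← AddMonoidHom.map_trace φ, hA, map_zero])
  obtain ⟨b, hb⟩ := IsLocalization.exist_integer_multiples_of_finite (nonZeroDivisors K)
    (fun ij : Fin n × Fin n => Y ij.1 ij.2)
  choose Y' hY' using hb
  apply descend_all x y z hg h0 (b:K) (nonZeroDivisors.coe_ne_zero b)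
  refine ⟨Matrix.of fun i j => Y' (i, j), ?_⟩
  have h1 : (Matrix.of fun i j => Y' (i, j)).map φ = φ b • Y := by
    ext i j
    have := hY' (i, j)
    simp only [Algebra.smul_def] at this
    exact this
  apply Matrix.map_injective hinj
  beta_reduce
  rw [Matrix.map_sub φ (map_sub φ), Matrix.map_mul, Matrix.map_mul, h1, XM_map, Matrix.mul_smul,
    Matrix.smul_mul, ← smul_sub, ← hY]
  ext i j
  simp

theorem one_comm {K : Type*} [CommRing K] [IsDomain K] [IsPrincipalIdealRing K] {n : ℕ}
    (hn : 2 ≤ n) (A : Matrix (Fin n) (Fin n) K) (hA : A.trace = 0) :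
    ∃ a b : Matrix (Fin n) (Fin n) K, A = a * b - b * a := by
  obtain ⟨B, hAB, hB⟩ := hess A
  apply hAB.comm
  have hBt : B.trace = 0 := by rw [hAB.trace, hA]
  obtain ⟨x, y, hxy, hsum⟩ := exists_xy (∑ j : Fin n, lam (1:K) j * B j j)
    (fun j : Fin n => if h : (j:ℕ) + 1 < n then B j ⟨j+1, h⟩ else 0)
  have hz : ∀ i, ∃ z, y i * y (i+1) + (2 * lam x i - x) * z = 1 := by
    intro i
    obtain ⟨m, hm⟩ := hxy i
    simp only [lam]
    split_ifs
    · exact ⟨m, by linear_combination hm⟩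
    · exact ⟨-m, by linear_combination hm⟩
  choose z hz using hz
  have hy0 : IsCoprime x (y 0) := by
    obtain ⟨m, hm⟩ := hxy 0
    exact ⟨-m, y (0+1), by linear_combination hm⟩
  have h1 : (XM n x y z * B).trace = 0 := by
    rw [trace_XM _ _ _ _ hB, Finset.sum_add_distrib]
    have : ∑ j : Fin n, lam x j * B j j = x * ∑ j : Fin n, lam (1:K) j * B j j := by
      rw [Finset.mul_sum]
      refine Finset.sum_congr rfl fun j _ => ?_
      simp only [lam]; split_ifs <;> simp
    rw [this]
    exact hsum
  obtain ⟨Y, hY⟩ := pid_solve x y z hz hy0 B (trace_pow x y z B hB hBt h1)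
  exact ⟨_, Y, hY⟩

end CW


/-- For `n ≥ 2` and a commutative unital ring `K`, every matrix in `Mₙ(K)` that is a sum
of commutators is a sum of two commutators (Mesyan, Rosset–Rosset); and if `K` is a
principal ideal domain, every such matrix is a single commutator (Shoda,
Albert–Muckenhoupt, Stasinski). -/
theorem commutator_width_matrices
    (K : Type*) [CommRing K] (n : ℕ) (hn : 2 ≤ n) :
    (∀ X : Matrix (Fin n) (Fin n) K,
      X ∈ AddSubgroup.closure {x : Matrix (Fin n) (Fin n) K | ∃ a b, x = a * b - b * a} →
      ∃ a₁ b₁ a₂ b₂ : Matrix (Fin n) (Fin n) K,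
        X = (a₁ * b₁ - b₁ * a₁) + (a₂ * b₂ - b₂ * a₂)) ∧
    (IsDomain K → IsPrincipalIdealRing K →
      ∀ X : Matrix (Fin n) (Fin n) K,
        X ∈ AddSubgroup.closure {x : Matrix (Fin n) (Fin n) K | ∃ a b, x = a * b - b * a} →
        ∃ a b : Matrix (Fin n) (Fin n) K, X = a * b - b * a) := by
  refine ⟨fun X hX => ?_, fun h1 h2 X hX => ?_⟩
  · obtain ⟨m, rfl⟩ : ∃ m, n = m + 1 := ⟨n - 1, by omega⟩
    exact CW.two_comm m X (CW.trace_of_mem X hX)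
  · exact CW.one_comm hn X (CW.trace_of_mem X hX)
end
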